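/- Let p be prime, A ⊆ 𝔽_p a set, and f_A(x) = A(x) − |A|/p its balanced function. Then C₅(A) − |A|^{10}/p³ − 2|A|⁶ ≲ |A|⁷/p + (|A|⁴/p²)·C₃(f_A) + (E⁺(f_A))^{1/6} |A|^{11/2} + (Ē^×(f_A))^{1/2} |A|^{9/2}, where C₃(f_A) = Σ_l i(l)³ − (|A|²/p) Σ_l i(l)² with i(l) = |l ∩ (A×A)| and the sums over all lines l containing at least two points of A×A (so that Σ_l i(l)³ − (|A|²/p)Σ_l i(l)² ≤ C₃(f_A) is used as an upper-bound quantity). -/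

import Mathlib

open scoped Classical Pointwise

noncomputable section

/-- Number of collinear `k`-tuples of points of `A × B`. -/
def Ctuples (F : Type*) [Field F] (k : ℕ) (A B : Finset F) : ℕ :=
  ((Fintype.piFinset fun _ : Fin k => A ×ˢ B).filter fun f => Collinear F (Set.range f)).card

/-- Additive energy of two finite sets. -/
def addE (F : Type*) [Field F] (A B : Finset F) : ℕ :=
  (((A ×ˢ A) ×ˢ B ×ˢ B).filter fun q => q.1.1 - q.2.1 = q.1.2 - q.2.2).card

/-- Multiplicative energy of two finite sets. -/
def mulE (F : Type*) [Field F] (A B : Finset F) : ℕ :=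
  (((A ×ˢ A) ×ˢ B ×ˢ B).filter fun q => q.1.1 * q.2.2 = q.1.2 * q.2.1).card

/-- `max_s E^×(A - s)`. -/
def mulEbar (F : Type*) [Field F] (A : Finset F) : ℕ :=
  ⨆ s : F, mulE F (A.image fun a => a - s) (A.image fun a => a - s)

def repSub (F : Type*) [Field F] (A B : Finset F) (x : F) : ℕ :=
  ((A ×ˢ B).filter fun q => q.1 - q.2 = x).card

def addEk (F : Type*) [Field F] (k : ℕ) (A : Finset F) : ℕ :=
  ∑ x ∈ A - A, repSub F A A x ^ k

def repDiv (F : Type*) [Field F] (A B : Finset F) (x : F) : ℕ :=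
  ((A ×ˢ B).filter fun q => q.2 ≠ 0 ∧ q.1 / q.2 = x).card

def mulEk (F : Type*) [Field F] (k : ℕ) (A : Finset F) : ℕ :=
  ∑ x ∈ A / A, repDiv F A A x ^ k

def mulEkbar (F : Type*) [Field F] (k : ℕ) (A : Finset F) : ℕ :=
  ⨆ s : F, mulEk F k (A.image fun a => a - s)

/-- Number of points of `A × B` on the graph of `x ↦ l.1 * x + l.2`. -/
def nPts {F : Type*} [Field F] (A B : Finset F) (l : F × F) : ℕ :=
  ((A ×ˢ B).filter fun q => q.2 = l.1 * q.1 + l.2).card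

/-- τ-rich lines of `𝓛`. -/
def Lrich {F : Type*} [Field F] (A B : Finset F) (L : Finset (F × F)) (τ : ℝ) : Finset (F × F) :=
  L.filter fun l => τ ≤ (nPts A B l : ℝ)

def affMap {F : Type*} [Field F] (l : F × F) : F → F := fun x => l.1 * x + l.2

def affInv {F : Type*} [Field F] (l : F × F) : F → F := fun x => (x - l.2) / l.1

/-- alternating product `l₁ ∘ l₂⁻¹ ∘ l₃ ∘ l₄⁻¹ ∘ ⋯` in the affine group. -/
def altAff {F : Type*} [Field F] {k : ℕ} (a : Fin k → F × F) : F → F :=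
  (List.ofFn fun i : Fin k => if (i : ℕ) % 2 = 0 then affMap (a i) else affInv (a i)).foldr
    (· ∘ ·) id

def TaffSet {F : Type*} [Field F] (k : ℕ) (L : Finset (F × F)) : ℕ :=
  (((Fintype.piFinset fun _ : Fin k => L) ×ˢ Fintype.piFinset fun _ : Fin k => L).filter
    fun q => altAff q.1 = altAff q.2).card

def affEnergy {F : Type*} [Field F] (L : Finset (F × F)) : ℕ :=
  (((L ×ˢ L) ×ˢ L ×ˢ L).filter fun q =>
    affMap q.1.1 ∘ affInv q.1.2 = affMap q.2.1 ∘ affInv q.2.2).card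

/-- incidences between `A × B` and the graphs of the maps in `L`. -/
def nInc {F : Type*} [Field F] (A B : Finset F) (L : Finset (F × F)) : ℕ :=
  (((A ×ˢ B) ×ˢ L).filter fun q => q.1.2 = q.2.1 * q.1.1 + q.2.2).card

/-- balanced function of `A ⊆ 𝔽_p`. -/
def balanced {p : ℕ} [NeZero p] (A : Finset (ZMod p)) : ZMod p → ℝ :=
  fun x => (if x ∈ A then 1 else 0) - (A.card : ℝ) / p

def addEfun {p : ℕ} [NeZero p] (f : ZMod p → ℝ) : ℝ :=
  ∑ x, ∑ y, ∑ z, ∑ w, if x - y = z - w then f x * f y * f z * f w else 0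

def mulEfun {p : ℕ} [NeZero p] (f : ZMod p → ℝ) : ℝ :=
  ∑ x, ∑ y, ∑ z, ∑ w, if x * w = z * y then f x * f y * f z * f w else 0

def mulEbarFun {p : ℕ} [NeZero p] (f : ZMod p → ℝ) : ℝ :=
  ⨆ s : ZMod p, mulEfun fun x => f (x + s)

/-- a line in the plane: `inl (a,b)` is `y = a x + b`, `inr c` is `x = c`. -/
def onLine {F : Type*} [Field F] (l : (F × F) ⊕ F) (q : F × F) : Prop :=
  match l with
  | .inl ab => q.2 = ab.1 * q.1 + ab.2
  | .inr c => q.1 = c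

def iLine {F : Type*} [Field F] (A B : Finset F) (l : (F × F) ⊕ F) : ℕ :=
  ((A ×ˢ B).filter fun q => onLine l q).card

def altSum {M : Type*} [AddCommGroup M] {k : ℕ} (x : Fin k → M) : M :=
  ∑ i : Fin k, if (i : ℕ) % 2 = 0 then x i else -x i

def TaddSet {M : Type*} [AddCommGroup M] (k : ℕ) (A : Finset M) : ℕ :=
  (((Fintype.piFinset fun _ : Fin k => A) ×ˢ Fintype.piFinset fun _ : Fin k => A).filter
    fun q => altSum q.1 = altSum q.2).card

def TaddFun {p : ℕ} [NeZero p] (k : ℕ) (f : ZMod p → ℝ) : ℝ :=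
  ∑ x : Fin k → ZMod p, ∑ y : Fin k → ZMod p,
    if altSum x = altSum y then (∏ i, f (x i)) * ∏ i, f (y i) else 0

def TaffFun {p : ℕ} [Fact p.Prime] (k : ℕ) (f : ZMod p × ZMod p → ℝ) : ℝ :=
  ∑ a ∈ Fintype.piFinset fun _ : Fin k => (Finset.univ.filter fun l : ZMod p × ZMod p => l.1 ≠ 0),
    ∑ b ∈ Fintype.piFinset fun _ : Fin k => (Finset.univ.filter fun l : ZMod p × ZMod p => l.1 ≠ 0),
      if altAff a = altAff b then (∏ i, f (a i)) * ∏ i, f (b i) else 0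

/-- `Ẽ^×_k (X, Y)`. -/
def tmulEk (F : Type*) [Field F] (k : ℕ) (X Y : Finset F) : ℕ :=
  (((Fintype.piFinset fun _ : Fin k => X.erase 0) ×ˢ
      Fintype.piFinset fun _ : Fin k => Y.erase 0).filter
    fun q => ∀ i j : Fin k, q.1 i * q.2 j = q.1 j * q.2 i).card

def addEkG {G : Type*} [AddCommGroup G] (k : ℕ) (A : Finset G) : ℕ :=
  ∑ x ∈ A - A, (((A ×ˢ A).filter fun q => q.1 - q.2 = x).card) ^ k

end

open MvPolynomial in
/-- The grading homomorphism `X i ↦ X i * T ^ w i`. -/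
noncomputable def gradeHom {σ K : Type*} [Field K] (w : σ → ℕ) :
    MvPolynomial σ K →ₐ[K] Polynomial (MvPolynomial σ K) :=
  aeval fun i => Polynomial.C (X i) * Polynomial.X ^ w i

namespace MvPolynomial
variable {σ K : Type*} [Field K]

theorem gradeHom_monomial (w : σ → ℕ) (d : σ →₀ ℕ) (a : K) :
    gradeHom w (monomial d a) = Polynomial.monomial (Finsupp.weight w d) (monomial d a) := by
  rw [gradeHom, aeval_monomial, monomial_eq (a := a), ← Polynomial.C_mul_X_pow_eq_monomial,
    Finsupp.weight_apply, Polynomial.C_mul]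
  simp only [Finsupp.prod, mul_pow, Finset.prod_mul_distrib, map_prod, Polynomial.C_pow, ← pow_mul,
    Finset.prod_pow_eq_pow_sum, Finsupp.sum, smul_eq_mul]
  rw [mul_assoc, IsScalarTower.algebraMap_apply K (MvPolynomial σ K)]
  simp [mul_comm, algebraMap_eq]

theorem coeff_coeff_gradeHom (w : σ → ℕ) (f : MvPolynomial σ K) (n : ℕ) (d : σ →₀ ℕ) :
    coeff d ((gradeHom w f).coeff n) = if Finsupp.weight w d = n then coeff d f else 0 := by
  induction f using MvPolynomial.induction_on' with
  | monomial u a =>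
    rw [gradeHom_monomial, Polynomial.coeff_monomial]
    by_cases h : u = d
    · subst h; split_ifs <;> simp
    · split_ifs <;> simp [coeff_monomial, h]
  | add p q hp hq =>
    simp only [map_add, Polynomial.coeff_add, coeff_add, hp, hq]
    split_ifs <;> simp

theorem natDegree_gradeHom (w : σ → ℕ) (f : MvPolynomial σ K) :
    (gradeHom w f).natDegree = weightedTotalDegree w f := by
  apply le_antisymm
  · rw [Polynomial.natDegree_le_iff_coeff_eq_zero]
    intro n hn
    ext d
    rw [coeff_coeff_gradeHom, coeff_zero]
    split_ifs with h
    · by_contra hd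
      have := le_weightedTotalDegree w (mem_support_iff.2 hd)
      omega
    · rfl
  · refine Finset.sup_le fun d hd => Polynomial.le_natDegree_of_ne_zero fun h => ?_
    have := coeff_coeff_gradeHom w f (Finsupp.weight w d) d
    rw [h, if_pos rfl, coeff_zero] at this
    exact mem_support_iff.1 hd this.symm

theorem gradeHom_ne_zero (w : σ → ℕ) {f : MvPolynomial σ K} (hf : f ≠ 0) : gradeHom w f ≠ 0 := by
  obtain ⟨d, hd⟩ := ne_zero_iff.1 hf
  intro h
  have := coeff_coeff_gradeHom w f (Finsupp.weight w d) d
  rw [h, if_pos rfl] at this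
  exact hd (by simpa using this.symm)

theorem weightedTotalDegree_mul_of_ne_zero (w : σ → ℕ) {f g : MvPolynomial σ K} (hf : f ≠ 0)
    (hg : g ≠ 0) :
    weightedTotalDegree w (f * g) = weightedTotalDegree w f + weightedTotalDegree w g := by
  simp only [← natDegree_gradeHom, map_mul]
  exact Polynomial.natDegree_mul (gradeHom_ne_zero w hf) (gradeHom_ne_zero w hg)

theorem weightedTotalDegree_mul_le' (w : σ → ℕ) (f g : MvPolynomial σ K) :
    weightedTotalDegree w (f * g) ≤ weightedTotalDegree w f + weightedTotalDegree w g := by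
  simp only [← natDegree_gradeHom, map_mul]
  exact Polynomial.natDegree_mul_le

theorem weightedTotalDegree_add_le_max (w : σ → ℕ) (f g : MvPolynomial σ K) :
    weightedTotalDegree w (f + g) ≤ max (weightedTotalDegree w f) (weightedTotalDegree w g) := by
  simp only [← natDegree_gradeHom, map_add]
  exact Polynomial.natDegree_add_le _ _

theorem weightedTotalDegree_sub_le_max (w : σ → ℕ) (f g : MvPolynomial σ K) :
    weightedTotalDegree w (f - g) ≤ max (weightedTotalDegree w f) (weightedTotalDegree w g) := by
  simp only [← natDegree_gradeHom, map_sub]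
  exact Polynomial.natDegree_sub_le _ _

theorem weightedTotalDegree_le_of_dvd (w : σ → ℕ) {f g : MvPolynomial σ K} (hg : g ≠ 0)
    (h : f ∣ g) : weightedTotalDegree w f ≤ weightedTotalDegree w g := by
  obtain ⟨c, rfl⟩ := h
  rw [weightedTotalDegree_mul_of_ne_zero w (left_ne_zero_of_mul hg) (right_ne_zero_of_mul hg)]
  omega

theorem weightedTotalDegree_le_iff (w : σ → ℕ) (f : MvPolynomial σ K) (n : ℕ) :
    weightedTotalDegree w f ≤ n ↔ ∀ d, coeff d f ≠ 0 → Finsupp.weight w d ≤ n := by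
  rw [weightedTotalDegree, Finset.sup_le_iff]
  simp only [mem_support_iff]

theorem weightedTotalDegree_pderiv_le (w : σ → ℕ) (i : σ) (f : MvPolynomial σ K) :
    weightedTotalDegree w (pderiv i f) + w i ≤ weightedTotalDegree w f ∨ pderiv i f = 0 := by
  by_cases h0 : pderiv i f = 0
  · exact Or.inr h0
  left
  obtain ⟨d, hd, hw⟩ : ∃ d ∈ (pderiv i f).support,
      weightedTotalDegree w (pderiv i f) = Finsupp.weight w d := by
    have := Finset.exists_mem_eq_sup (pderiv i f).support
      (MvPolynomial.support_nonempty.2 h0) (fun s => Finsupp.weight w s)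
    exact this
  rw [hw]
  have h1 : coeff (d + Finsupp.single i 1) f ≠ 0 := by
    rw [mem_support_iff, coeff_pderiv] at hd
    exact left_ne_zero_of_mul hd
  have := le_weightedTotalDegree w (mem_support_iff.2 h1)
  simpa [map_add, Finsupp.weight_single] using this

theorem weightedTotalDegree_pderiv_le' (w : σ → ℕ) (i : σ) (f : MvPolynomial σ K) :
    weightedTotalDegree w (pderiv i f) ≤ weightedTotalDegree w f := by
  rcases weightedTotalDegree_pderiv_le w i f with h | h
  · omega
  · simp [h, weightedTotalDegree_zero]

theorem natDegree_aeval_le {R : Type*} [CommRing R] [Algebra K R] (w : σ → ℕ)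
    (f : MvPolynomial σ K) (g : σ → Polynomial R) (hg : ∀ i, (g i).natDegree ≤ w i) :
    (aeval g f).natDegree ≤ weightedTotalDegree w f := by
  rw [aeval_def, eval₂_eq]
  refine Polynomial.natDegree_sum_le_of_forall_le _ _ fun d hd => ?_
  refine le_trans ?_ (le_weightedTotalDegree w hd)
  refine Polynomial.natDegree_mul_le.trans ?_
  rw [IsScalarTower.algebraMap_apply K R, Polynomial.algebraMap_eq, Polynomial.natDegree_C, zero_add]
  refine (Polynomial.natDegree_prod_le _ _).trans ?_
  rw [Finsupp.weight_apply, Finsupp.sum]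
  refine Finset.sum_le_sum fun i _ => Polynomial.natDegree_pow_le.trans ?_
  exact Nat.mul_le_mul_left _ (hg i)

end MvPolynomial

namespace MvPolynomial

theorem finrank_restrictTotalDegree_fin_two (F : Type*) [Field F] (D : ℕ) :
    Module.finrank F (restrictTotalDegree (Fin 2) F D) = (D + 1) * (D + 2) / 2 := by
  have hb := Module.finrank_eq_nat_card_basis
    (basisRestrictSupport F {n : Fin 2 →₀ ℕ | (n.sum fun _ e => e) ≤ D})
  rw [restrictTotalDegree, hb]
  have e : {n : Fin 2 →₀ ℕ | (n.sum fun _ e => e) ≤ D} ≃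
      ↥((Finset.range (D + 1)).sigma fun i => Finset.range (i + 1)) :=
    { toFun := fun n => ⟨⟨n.1 0 + n.1 1, n.1 0⟩, by
        have := n.2
        rw [Set.mem_ofPred_eq, Finsupp.sum_fintype _ _ (fun _ => rfl)] at this
        simp only [Fin.sum_univ_two] at this
        simp only [Finset.mem_sigma, Finset.mem_range]
        omega⟩
      invFun := fun q => ⟨Finsupp.equivFunOnFinite.symm ![q.1.2, q.1.1 - q.1.2], by
        have := q.2
        simp only [Finset.mem_sigma, Finset.mem_range] at this
        rw [Set.mem_ofPred_eq, Finsupp.sum_fintype _ _ (fun _ => rfl)]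
        simp only [Fin.sum_univ_two, Finsupp.equivFunOnFinite_symm_apply_apply,
          Matrix.cons_val_zero, Matrix.cons_val_one]
        omega⟩
      left_inv := fun n => by
        apply Subtype.ext
        apply Finsupp.ext
        intro i
        fin_cases i <;> simp
      right_inv := fun q => by
        have := q.2
        simp only [Finset.mem_sigma, Finset.mem_range] at this
        apply Subtype.ext
        refine Sigma.ext ?_ ?_
        · simp only [Finsupp.equivFunOnFinite_symm_apply_apply,
            Matrix.cons_val_zero, Matrix.cons_val_one]
          omega
        · simp }
  rw [Nat.card_congr e, Nat.card_eq_fintype_card, Fintype.card_coe, Finset.card_sigma]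
  simp only [Finset.card_range]
  have h := Finset.sum_range_succ' (fun i => i) (D + 1)
  simp only [add_zero] at h
  rw [← h, Finset.sum_range_id]
  congr 1
  simp
  ring

/-- Some polynomial of bounded degree separates a point from the others. -/
theorem exists_separating {F : Type*} [Field F] (Z : Finset (Fin 2 → F)) (z : Fin 2 → F) :
    ∃ f : MvPolynomial (Fin 2) F, f.totalDegree ≤ Z.card ∧ eval z f ≠ 0 ∧
      ∀ w ∈ Z, w ≠ z → eval w f = 0 := by
  induction Z using Finset.induction_on with
  | empty => exact ⟨1, by simp, by simp, by simp⟩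
  | insert w Z hw ih =>
    obtain ⟨f, h1, h2, h3⟩ := ih
    by_cases hwz : w = z
    · refine ⟨f, h1.trans (Finset.card_le_card (Finset.subset_insert _ _)), h2, fun v hv hvz => ?_⟩
      rcases Finset.mem_insert.1 hv with rfl | hv
      · exact absurd hwz hvz
      · exact h3 v hv hvz
    · obtain ⟨i, hi⟩ := Function.ne_iff.1 hwz
      refine ⟨(X i - C (w i)) * f, ?_, ?_, fun v hv hvz => ?_⟩
      · rw [Finset.card_insert_of_notMem hw]
        refine (totalDegree_mul _ _).trans ?_
        have : (X i - C (w i) : MvPolynomial (Fin 2) F).totalDegree ≤ 1 :=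
          (totalDegree_sub_C_le _ _).trans (by simp)
        omega
      · simp only [map_mul, map_sub, eval_X, eval_C]
        exact mul_ne_zero (sub_ne_zero.2 (Ne.symm hi)) h2
      · rcases Finset.mem_insert.1 hv with rfl | hv
        · simp
        · simp [h3 v hv hvz]

/-- Bézout's bound for the number of common zeros of two coprime plane curves. -/
theorem card_common_zeros_le {F : Type*} [Field F] {g h : MvPolynomial (Fin 2) F} (hg : g ≠ 0)
    (hh : h ≠ 0) (hgh : ∀ u v, g * u = h * v → g ∣ v) (Z : Finset (Fin 2 → F))
    (hZg : ∀ z ∈ Z, eval z g = 0) (hZh : ∀ z ∈ Z, eval z h = 0) :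
    Z.card ≤ g.totalDegree * h.totalDegree := by
  set m := g.totalDegree with hm
  set n := h.totalDegree with hn
  set s := Z.card with hs
  let V : ℕ → Submodule F (MvPolynomial (Fin 2) F) := restrictTotalDegree (Fin 2) F
  have hV : ∀ D f, f ∈ V D ↔ f.totalDegree ≤ D := fun D f => mem_restrictTotalDegree _ _ _
  have hfin : ∀ D, Module.finrank F (V D) = (D + 1) * (D + 2) / 2 :=
    finrank_restrictTotalDegree_fin_two F
  let D := m + n + s
  let ev : MvPolynomial (Fin 2) F →ₗ[F] (Z → F) :=
    { toFun := fun f z => eval z.1 f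
      map_add' := fun f f' => by ext; simp
      map_smul' := fun c f => by ext; simp [smul_eval] }
  let evD : V D →ₗ[F] (Z → F) := ev.comp (V D).subtype
  have hsurj : Function.Surjective evD := by
    rw [← LinearMap.range_eq_top, eq_top_iff]
    intro φ _
    have : φ = ∑ z, φ z • (Pi.single z (1 : F) : Z → F) := by
      ext w
      simp [Finset.sum_apply, Pi.single_apply]
    rw [this]
    refine Submodule.sum_mem _ fun z _ => Submodule.smul_mem _ _ ?_
    obtain ⟨f, h1, h2, h3⟩ := exists_separating Z z.1
    refine ⟨(eval z.1 f)⁻¹ • ⟨f, (hV _ _).2 (h1.trans (by omega))⟩, ?_⟩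
    ext w
    simp only [map_smul, Pi.smul_apply, smul_eq_mul]
    change (eval z.1 f)⁻¹ * eval w.1 f = _
    by_cases hwz : w = z
    · subst hwz
      simp [h2]
    · rw [h3 w.1 w.2 (fun h => hwz (Subtype.ext h)), Pi.single_eq_of_ne hwz, mul_zero]
  have hrn := LinearMap.finrank_range_add_finrank_ker evD
  rw [LinearMap.range_eq_top.2 hsurj, finrank_top, Module.finrank_fintype_fun_eq_card,
    Fintype.card_coe, hfin] at hrn
  have himg : ∀ (f : MvPolynomial (Fin 2) F) (_ : f ≠ 0) (E : ℕ),
      Module.finrank F ((V E).map (LinearMap.mulLeft F f)) = (E + 1) * (E + 2) / 2 := by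
    intro f hf E
    rw [LinearEquiv.finrank_eq (Submodule.equivMapOfInjective (LinearMap.mulLeft F f)
      (fun a b hab => mul_left_cancel₀ hf hab) (V E)).symm, hfin]
  let S := (V (n + s)).map (LinearMap.mulLeft F g)
  let T := (V (m + s)).map (LinearMap.mulLeft F h)
  have hsup := Submodule.finrank_sup_add_finrank_inf_eq S T
  rw [himg g hg, himg h hh] at hsup
  have hinf : Module.finrank F (S ⊓ T : Submodule F _) ≤ (s + 1) * (s + 2) / 2 := by
    rw [← himg (g * h) (mul_ne_zero hg hh)]
    refine Submodule.finrank_mono ?_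
    rintro f ⟨⟨u, hu, rfl⟩, ⟨v, hv, huv⟩⟩
    simp only [LinearMap.mulLeft_apply] at huv
    obtain ⟨c, rfl⟩ := hgh u v huv.symm
    have huc : u = h * c := by
      apply mul_left_cancel₀ hg
      rw [← huv]; ring
    refine ⟨c, ?_, ?_⟩
    · rw [SetLike.mem_coe, hV]
      by_cases hc : c = 0
      · simp [hc]
      have := (hV _ _).1 hu
      rw [huc, totalDegree_mul_of_isDomain hh hc] at this
      omega
    · simp only [LinearMap.mulLeft_apply, huc]
      ring
  have hker : Module.finrank F (S ⊔ T : Submodule F _) ≤ Module.finrank F (LinearMap.ker evD) := by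
    rw [LinearEquiv.finrank_eq (Submodule.equivMapOfInjective (V D).subtype
      (Submodule.subtype_injective _) (LinearMap.ker evD))]
    refine Submodule.finrank_mono (sup_le ?_ ?_)
    · rintro _ ⟨u, hu, rfl⟩
      refine ⟨⟨g * u, (hV _ _).2 ((totalDegree_mul _ _).trans ?_)⟩, ?_, rfl⟩
      · have := (hV _ _).1 hu
        omega
      · ext z
        change eval z.1 (g * u) = 0
        rw [map_mul, hZg z.1 z.2, zero_mul]
    · rintro _ ⟨u, hu, rfl⟩
      refine ⟨⟨h * u, (hV _ _).2 ((totalDegree_mul _ _).trans ?_)⟩, ?_, rfl⟩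
      · have := (hV _ _).1 hu
        omega
      · ext z
        change eval z.1 (h * u) = 0
        rw [map_mul, hZh z.1 z.2, zero_mul]
  have tri : ∀ t : ℕ, (t + 1) * (t + 2) / 2 * 2 = (t + 1) * (t + 2) := fun t =>
    Nat.div_mul_cancel (Nat.even_mul_succ_self (t + 1)).two_dvd
  have t1 := tri D
  have t2 := tri (n + s)
  have t3 := tri (m + s)
  have t4 := tri s
  have hD : D = m + n + s := rfl
  rw [hD] at t1
  have hrn' : s + Module.finrank F (LinearMap.ker evD) = (m + n + s + 1) * (m + n + s + 2) / 2 := hrn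
  nlinarith

end MvPolynomial

/-- Regard a polynomial in `x, y, z` as a polynomial in `y, z` over `K(x)`. -/
noncomputable def toPlane (K : Type*) [Field K] : MvPolynomial (Fin 3) K →ₐ[K]
    MvPolynomial (Fin 2) (FractionRing (Polynomial K)) :=
  MvPolynomial.aeval ![MvPolynomial.C (algebraMap (Polynomial K) _ Polynomial.X), MvPolynomial.X 0,
    MvPolynomial.X 1]

section Plane
open MvPolynomial
variable {K : Type*} [Field K]

theorem toPlane_injective : Function.Injective (toPlane K) := by
  let i0 : MvPolynomial (Fin 3) K →ₐ[K] MvPolynomial (Fin 2) (Polynomial K) :=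
    aeval ![C Polynomial.X, X 0, X 1]
  let j : MvPolynomial (Fin 2) (Polynomial K) →+* MvPolynomial (Fin 3) K :=
    eval₂Hom (Polynomial.aeval (R := K) (X 0 : MvPolynomial (Fin 3) K)).toRingHom ![X 1, X 2]
  have h1 : ∀ f, toPlane K f = map (algebraMap (Polynomial K) (FractionRing (Polynomial K)))
      (i0 f) := by
    intro f
    induction f using MvPolynomial.induction_on with
    | C a =>
      rw [← algebraMap_eq, AlgHom.commutes, AlgHom.commutes,
        IsScalarTower.algebraMap_apply K (Polynomial K) (MvPolynomial (Fin 2) (Polynomial K)),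
        algebraMap_eq, map_C, ← algebraMap_eq]
      rw [IsScalarTower.algebraMap_apply K (FractionRing (Polynomial K)),
        IsScalarTower.algebraMap_apply K (Polynomial K)]
    | add p q hp hq => simp [hp, hq]
    | mul_X p i hp =>
      rw [map_mul, map_mul, map_mul, hp]
      congr 1
      fin_cases i <;> simp [toPlane, i0]
  have h2 : ∀ f, j (i0 f) = f := by
    intro f
    induction f using MvPolynomial.induction_on with
    | C a =>
      rw [← algebraMap_eq, AlgHom.commutes,
        IsScalarTower.algebraMap_apply K (Polynomial K) (MvPolynomial (Fin 2) (Polynomial K))]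
      simp [j, algebraMap_eq]
    | add p q hp hq => simp [hp, hq]
    | mul_X p i hp =>
      rw [map_mul, map_mul, hp]
      congr 1
      fin_cases i <;> simp [j, i0]
  intro f f' hff
  rw [h1, h1] at hff
  have := map_injective _ (IsFractionRing.injective (Polynomial K) (FractionRing (Polynomial K)))
    hff
  rw [← h2 f, ← h2 f', this]

theorem toPlane_aeval_X (d : Polynomial K) :
    toPlane K (Polynomial.aeval (X 0) d) = C (algebraMap _ _ d) := by
  induction d using Polynomial.induction_on' with
  | add p q hp hq => simp [hp, hq]
  | monomial n a =>
    rw [Polynomial.aeval_monomial, ← Polynomial.C_mul_X_pow_eq_monomial]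
    simp only [map_mul, map_pow, AlgHom.commutes]
    have : algebraMap K (MvPolynomial (Fin 2) (FractionRing (Polynomial K))) a =
        C (algebraMap _ _ (Polynomial.C a)) := by
      rw [← Polynomial.algebraMap_eq,
        ← IsScalarTower.algebraMap_apply K (Polynomial K) (FractionRing (Polynomial K)),
        ← algebraMap_eq, ← IsScalarTower.algebraMap_apply]
    rw [this]
    congr 1
    simp [toPlane]

theorem exists_toPlane_eq (u : MvPolynomial (Fin 2) (FractionRing (Polynomial K))) :
    ∃ d : Polynomial K, d ≠ 0 ∧ ∃ U, toPlane K U = C (algebraMap _ _ d) * u := by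
  induction u using MvPolynomial.induction_on with
  | C a =>
    obtain ⟨n, d, hd, rfl⟩ := IsFractionRing.div_surjective (A := Polynomial K) a
    have hd0 := nonZeroDivisors.ne_zero hd
    refine ⟨d, hd0, Polynomial.aeval (X 0) n, ?_⟩
    rw [toPlane_aeval_X, ← C_mul, mul_div_cancel₀]
    simpa using hd0
  | add p q hp hq =>
    obtain ⟨d, hd, U, hU⟩ := hp
    obtain ⟨e, he, V, hV⟩ := hq
    refine ⟨d * e, mul_ne_zero hd he,
      Polynomial.aeval (X 0) e * U + Polynomial.aeval (X 0) d * V, ?_⟩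
    simp only [map_add, map_mul, toPlane_aeval_X, hU, hV]
    ring
  | mul_X p i hp =>
    obtain ⟨d, hd, U, hU⟩ := hp
    refine ⟨d, hd, U * X (i.succ), ?_⟩
    rw [map_mul, hU, mul_assoc]
    congr 2
    fin_cases i <;> simp [toPlane]

theorem totalDegree_toPlane_le (f : MvPolynomial (Fin 3) K) :
    (toPlane K f).totalDegree ≤ weightedTotalDegree ![0, 1, 1] f := by
  rw [toPlane, aeval_def, eval₂_eq]
  refine totalDegree_finsetSum_le fun d hd => ?_
  refine le_trans ?_ (le_weightedTotalDegree _ hd)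
  refine (totalDegree_mul _ _).trans ?_
  rw [IsScalarTower.algebraMap_apply K (FractionRing (Polynomial K)), algebraMap_eq, totalDegree_C,
    zero_add]
  refine (totalDegree_finsetProd _ _).trans ?_
  rw [Finsupp.weight_apply, Finsupp.sum]
  refine Finset.sum_le_sum fun i _ => (totalDegree_pow _ _).trans ?_
  rw [smul_eq_mul]
  refine Nat.mul_le_mul_left _ ?_
  fin_cases i <;> simp

/-- A prime `G` and a polynomial not divisible by it share at most `δ(G) δ(H)` common sections. -/
theorem card_common_sections_le {G H : MvPolynomial (Fin 3) K} (hG : Prime G) (hH : ¬ G ∣ H)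
    (W : Finset (Polynomial K × Polynomial K))
    (hWG : ∀ w ∈ W, aeval ![Polynomial.X, w.1, w.2] G = 0)
    (hWH : ∀ w ∈ W, aeval ![Polynomial.X, w.1, w.2] H = 0) :
    W.card ≤ weightedTotalDegree ![0, 1, 1] G * weightedTotalDegree ![0, 1, 1] H := by
  have hH0 : H ≠ 0 := fun h => hH (h ▸ dvd_zero G)
  have key : ∀ f (w : Polynomial K × Polynomial K),
      eval ![algebraMap _ (FractionRing (Polynomial K)) w.1, algebraMap _ _ w.2] (toPlane K f) =
        algebraMap _ _ (aeval ![Polynomial.X, w.1, w.2] f) := by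
    intro f w
    induction f using MvPolynomial.induction_on with
    | C a =>
      rw [← algebraMap_eq, AlgHom.commutes, AlgHom.commutes,
        IsScalarTower.algebraMap_apply K (FractionRing (Polynomial K)), algebraMap_eq, eval_C,
        ← IsScalarTower.algebraMap_apply]
    | add p q hp hq => simp [hp, hq]
    | mul_X p i hp =>
      simp only [map_mul, hp]
      congr 1
      fin_cases i <;> simp [toPlane]
  let φ : Polynomial K × Polynomial K → Fin 2 → FractionRing (Polynomial K) :=
    fun w => ![algebraMap _ _ w.1, algebraMap _ _ w.2]
  have hφ : Function.Injective φ := by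
    intro a b hab
    have i0 := congrFun hab 0
    have i1 := congrFun hab 1
    have inj := IsFractionRing.injective (Polynomial K) (FractionRing (Polynomial K))
    exact Prod.ext (inj i0) (inj i1)
  rw [← Finset.card_image_of_injective W hφ]
  refine (card_common_zeros_le (g := toPlane K G) (h := toPlane K H) ?_ ?_ ?_ _ ?_ ?_).trans
    (Nat.mul_le_mul (totalDegree_toPlane_le _) (totalDegree_toPlane_le _))
  · exact (map_ne_zero_iff _ toPlane_injective).2 hG.ne_zero
  · exact (map_ne_zero_iff _ toPlane_injective).2 hH0
  · intro u v huv
    obtain ⟨d, hd, U, hU⟩ := exists_toPlane_eq u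
    obtain ⟨e, he, V, hV⟩ := exists_toPlane_eq v
    have h1 : G * (Polynomial.aeval (X 0) e * U) = H * (Polynomial.aeval (X 0) d * V) := by
      apply toPlane_injective
      simp only [map_mul, toPlane_aeval_X, hU, hV]
      linear_combination (C (algebraMap _ _ d) * C (algebraMap _ _ e)) * huv
    obtain ⟨c, hc⟩ := (hG.dvd_or_dvd ⟨_, h1.symm⟩).resolve_left hH
    have h2 := congrArg (toPlane K) hc
    simp only [map_mul, toPlane_aeval_X, hV] at h2
    have hu : IsUnit (C (algebraMap _ (FractionRing (Polynomial K)) d) *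
        C (algebraMap _ _ e) : MvPolynomial (Fin 2) (FractionRing (Polynomial K))) := by
      rw [← C_mul]
      refine IsUnit.map C (IsUnit.mk0 _ ?_)
      simpa using ⟨hd, he⟩
    refine (hu.dvd_mul_left).1 ⟨_, (mul_assoc _ _ _).trans h2⟩
  · intro z hz
    obtain ⟨w, hw, rfl⟩ := Finset.mem_image.1 hz
    change eval ![_, _] _ = 0
    rw [key, hWG w hw, map_zero]
  · intro z hz
    obtain ⟨w, hw, rfl⟩ := Finset.mem_image.1 hz
    change eval ![_, _] _ = 0
    rw [key, hWH w hw, map_zero]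

end Plane

section Sections
open MvPolynomial
variable {K : Type*} [Field K]

/-- Restriction to the line `y = c, z = m x + n`. -/
noncomputable def secX (P : K × K × K) : MvPolynomial (Fin 3) K →ₐ[K] Polynomial K :=
  aeval ![Polynomial.X, Polynomial.C P.1,
    Polynomial.C P.2.1 * Polynomial.X + Polynomial.C P.2.2]

/-- Restriction to the line `x = c, z = m y + n`. -/
noncomputable def secY (Q : K × K × K) : MvPolynomial (Fin 3) K →ₐ[K] Polynomial K :=
  aeval ![Polynomial.C Q.1, Polynomial.X,
    Polynomial.C Q.2.1 * Polynomial.X + Polynomial.C Q.2.2]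

/-- Exchange of the variables `x` and `y`. -/
noncomputable def swapXY : MvPolynomial (Fin 3) K →ₐ[K] MvPolynomial (Fin 3) K :=
  rename (Equiv.swap 0 1)

theorem swapXY_swapXY (G : MvPolynomial (Fin 3) K) : swapXY (swapXY G) = G := by
  rw [swapXY, rename_rename]
  have : (⇑(Equiv.swap (0 : Fin 3) 1) ∘ ⇑(Equiv.swap (0 : Fin 3) 1)) = id := by
    funext i; simp
  rw [this, rename_id_apply]

theorem secX_swapXY (P : K × K × K) (G : MvPolynomial (Fin 3) K) :
    secX P (swapXY G) = secY P G := by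
  rw [swapXY, secX, aeval_rename, secY]
  congr 2
  funext i
  fin_cases i <;> simp [Equiv.swap_apply_of_ne_of_ne]

theorem secY_swapXY (P : K × K × K) (G : MvPolynomial (Fin 3) K) :
    secY P (swapXY G) = secX P G := by
  rw [← secX_swapXY, swapXY_swapXY]

theorem pderiv_swapXY_two (G : MvPolynomial (Fin 3) K) :
    pderiv 2 (swapXY G) = swapXY (pderiv 2 G) :=
  pderiv_rename (Equiv.injective (Equiv.swap (0 : Fin 3) 1)) 2 G

theorem pderiv_swapXY_one (G : MvPolynomial (Fin 3) K) :
    pderiv 1 (swapXY G) = swapXY (pderiv 0 G) := by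
  have := pderiv_rename (Equiv.injective (Equiv.swap (0 : Fin 3) 1)) 0 G
  rwa [Equiv.swap_apply_left] at this

theorem weightedTotalDegree_swapXY (a b c : ℕ) (G : MvPolynomial (Fin 3) K) :
    weightedTotalDegree ![a, b, c] (swapXY G) = weightedTotalDegree ![b, a, c] G := by
  rw [swapXY, weightedTotalDegree_rename_of_injective (Equiv.injective _)]
  congr 1
  funext i
  fin_cases i <;> simp [Equiv.swap_apply_of_ne_of_ne]

theorem swapXY_prime {G : MvPolynomial (Fin 3) K} (hG : Prime G) : Prime (swapXY G) :=
  (MulEquiv.prime_iff (renameEquiv K (Equiv.swap (0 : Fin 3) 1))).2 hG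

theorem swapXY_dvd_iff {G H : MvPolynomial (Fin 3) K} : swapXY G ∣ swapXY H ↔ G ∣ H :=
  map_dvd_iff (renameEquiv K (Equiv.swap (0 : Fin 3) 1))

/-- The second fundamental form of the level surfaces of `G` in directions with `x_j` constant,
`j` being the remaining index. -/
noncomputable def lineForm (i : Fin 3) (G : MvPolynomial (Fin 3) K) : MvPolynomial (Fin 3) K :=
  pderiv i (pderiv i G) * pderiv 2 G ^ 2 - 2 * pderiv 2 (pderiv i G) * pderiv i G * pderiv 2 G +
    pderiv 2 (pderiv 2 G) * pderiv i G ^ 2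

theorem lineForm_one_swapXY (G : MvPolynomial (Fin 3) K) :
    lineForm 1 (swapXY G) = swapXY (lineForm 0 G) := by
  simp only [lineForm, pderiv_swapXY_one, pderiv_swapXY_two, map_add, map_sub, map_mul, map_pow,
    map_ofNat]

theorem weightedTotalDegree_lineForm_le (w : Fin 3 → ℕ) (i : Fin 3) (G : MvPolynomial (Fin 3) K) :
    weightedTotalDegree w (lineForm i G) ≤ 3 * weightedTotalDegree w G := by
  have h := fun j (f : MvPolynomial (Fin 3) K) => weightedTotalDegree_pderiv_le' w j f
  have hm := fun f g : MvPolynomial (Fin 3) K => weightedTotalDegree_mul_le' w f g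
  have h2 : weightedTotalDegree w (2 : MvPolynomial (Fin 3) K) = 0 := by
    rw [← natDegree_gradeHom, map_ofNat, Polynomial.natDegree_ofNat]
  have hi := h i G
  have h22 := h 2 G
  have a1 := h i (pderiv i G)
  have a2 := h 2 (pderiv i G)
  have a3 := h 2 (pderiv 2 G)
  refine (weightedTotalDegree_add_le_max w _ _).trans (max_le
    ((weightedTotalDegree_sub_le_max w _ _).trans (max_le ?_ ?_)) ?_)
  · have b1 := hm (pderiv i (pderiv i G)) (pderiv 2 G ^ 2)
    have b2 := hm (pderiv 2 G) (pderiv 2 G)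
    rw [← sq] at b2
    omega
  · have b1 := hm (2 * pderiv 2 (pderiv i G) * pderiv i G) (pderiv 2 G)
    have b2 := hm (2 * pderiv 2 (pderiv i G)) (pderiv i G)
    have b3 := hm 2 (pderiv 2 (pderiv i G))
    omega
  · have b1 := hm (pderiv 2 (pderiv 2 G)) (pderiv i G ^ 2)
    have b2 := hm (pderiv i G) (pderiv i G)
    rw [← sq] at b2
    omega

theorem natDegree_secX_le (P : K × K × K) (G : MvPolynomial (Fin 3) K) :
    (secX P G).natDegree ≤ weightedTotalDegree ![1, 0, 1] G := by
  refine natDegree_aeval_le _ _ _ fun i => ?_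
  fin_cases i
  · simp
  · simp
  · exact Polynomial.natDegree_linear_le

theorem natDegree_secY_le (P : K × K × K) (G : MvPolynomial (Fin 3) K) :
    (secY P G).natDegree ≤ weightedTotalDegree ![0, 1, 1] G := by
  rw [← secX_swapXY, ← weightedTotalDegree_swapXY]
  exact natDegree_secX_le _ _

theorem pderiv_pderiv_swap (i j : Fin 3) (G : MvPolynomial (Fin 3) K) :
    pderiv i (pderiv j G) = pderiv j (pderiv i G) := by
  have : ⁅(pderiv i : Derivation K (MvPolynomial (Fin 3) K) (MvPolynomial (Fin 3) K)),
      (pderiv j : Derivation K (MvPolynomial (Fin 3) K) (MvPolynomial (Fin 3) K))⁆ = 0 := by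
    refine derivation_ext fun k => ?_
    simp [Derivation.commutator_apply, pderiv_X, Pi.single_apply, apply_ite]
  have h := congrArg (fun D => D G) this
  simpa [Derivation.commutator_apply, sub_eq_zero] using h

theorem derivative_secY (Q : K × K × K) (G : MvPolynomial (Fin 3) K) :
    Polynomial.derivative (secY Q G) =
      secY Q (pderiv 1 G) + Polynomial.C Q.2.1 * secY Q (pderiv 2 G) := by
  induction G using MvPolynomial.induction_on with
  | C a =>
    rw [← algebraMap_eq, AlgHom.commutes]
    simp [Polynomial.algebraMap_eq, algebraMap_eq]
  | add p q hp hq =>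
    simp only [map_add, hp, hq]; ring
  | mul_X p i hp =>
    rw [map_mul, Polynomial.derivative_mul, hp]
    simp only [Derivation.leibniz, map_add, smul_eq_mul, map_mul]
    fin_cases i <;> simp [secY, pderiv_X] <;> ring

theorem secY_lineForm_eq_zero {Q : K × K × K} {G : MvPolynomial (Fin 3) K} (h : secY Q G = 0) :
    secY Q (lineForm 1 G) = 0 := by
  have h1 := derivative_secY Q G
  have h2 := derivative_secY Q (pderiv 1 G)
  have h3 := derivative_secY Q (pderiv 2 G)
  have h4 : Polynomial.derivative (secY Q (pderiv 1 G) + Polynomial.C Q.2.1 * secY Q (pderiv 2 G)) = 0 := by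
    rw [← h1, h]; simp
  have hcomm : pderiv 1 (pderiv 2 G) = pderiv 2 (pderiv 1 G) := pderiv_pderiv_swap 1 2 G
  rw [h, Polynomial.derivative_zero] at h1
  rw [Polynomial.derivative_add, Polynomial.derivative_C_mul, h2, h3, hcomm] at h4
  simp only [lineForm, map_add, map_sub, map_mul, map_pow, map_ofNat]
  have h5 : secY Q (pderiv 1 G) = - (Polynomial.C Q.2.1 * secY Q (pderiv 2 G)) := by
    linear_combination -h1
  rw [h5]
  linear_combination (secY Q (pderiv 2 G)) ^ 2 * h4

theorem secX_lineForm_eq_zero {P : K × K × K} {G : MvPolynomial (Fin 3) K} (h : secX P G = 0) :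
    secX P (lineForm 0 G) = 0 := by
  rw [← secY_swapXY] at h
  rw [← secY_swapXY, ← lineForm_one_swapXY]
  exact secY_lineForm_eq_zero h

/-- The flow of the field `G_z ∂_y - G_y ∂_z` to first order. -/
noncomputable def flow (G : MvPolynomial (Fin 3) K) :
    MvPolynomial (Fin 3) K →ₐ[K] Polynomial (MvPolynomial (Fin 3) K) :=
  aeval ![Polynomial.C (X 0), Polynomial.C (X 1) + Polynomial.C (pderiv 2 G) * Polynomial.X,
    Polynomial.C (X 2) - Polynomial.C (pderiv 1 G) * Polynomial.X]

/-- The field `G_z ∂_y - G_y ∂_z`. -/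
noncomputable def flowField (G : MvPolynomial (Fin 3) K) :
    Derivation K (MvPolynomial (Fin 3) K) (MvPolynomial (Fin 3) K) :=
  pderiv 2 G • pderiv 1 - pderiv 1 G • pderiv 2

theorem flowField_apply (G f : MvPolynomial (Fin 3) K) :
    flowField G f = pderiv 2 G * pderiv 1 f - pderiv 1 G * pderiv 2 f := rfl

theorem dvd_flow_recursion {G : MvPolynomial (Fin 3) K} (hH : G ∣ lineForm 1 G)
    (h : MvPolynomial (Fin 3) K) (n : ℕ) :
    G ∣ pderiv 2 G * flowField G ((flow G h).coeff n) -
      (n + 1) * pderiv 2 G * (flow G h).coeff (n + 1) -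
      n * flowField G (pderiv 2 G) * (flow G h).coeff n := by
  have step : ∀ (c : Polynomial (MvPolynomial (Fin 3) K)) (a b : MvPolynomial (Fin 3) K),
      pderiv 2 G * (flowField G a - b) = 0 →
      G ∣ pderiv 2 G * flowField G b - flowField G (pderiv 2 G) * b →
      (∀ n : ℕ, G ∣ pderiv 2 G * flowField G (c.coeff n) -
        (n + 1) * pderiv 2 G * c.coeff (n + 1) - n * flowField G (pderiv 2 G) * c.coeff n) →
      ∀ n : ℕ, G ∣ pderiv 2 G * flowField G ((c * (Polynomial.C a + Polynomial.C b * Polynomial.X)).coeff n) -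
        (n + 1) * pderiv 2 G * (c * (Polynomial.C a + Polynomial.C b * Polynomial.X)).coeff (n + 1) -
        n * flowField G (pderiv 2 G) * (c * (Polynomial.C a + Polynomial.C b * Polynomial.X)).coeff n := by
    intro c a b hab hb hc n
    have e : c * (Polynomial.C a + Polynomial.C b * Polynomial.X) =
      c * Polynomial.C a + (c * Polynomial.C b) * Polynomial.X := by ring
    rw [e]
    rcases n with _ | n
    · simp only [Polynomial.coeff_add, Polynomial.coeff_mul_C, Polynomial.coeff_mul_X,
        Polynomial.coeff_mul_X_zero, Derivation.leibniz, map_add, smul_eq_mul]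
      have h0 := (hc 0).mul_left a
      convert h0 using 1
      simp only [Nat.cast_zero, map_zero]
      linear_combination c.coeff 0 * hab
    · simp only [Polynomial.coeff_add, Polynomial.coeff_mul_C, Polynomial.coeff_mul_X,
        Derivation.leibniz, map_add, smul_eq_mul]
      have h0 := (((hc (n + 1)).mul_left a).add ((hc n).mul_left b)).add (hb.mul_left (c.coeff n))
      convert h0 using 1
      push_cast
      linear_combination c.coeff (n + 1) * hab
  induction h using MvPolynomial.induction_on generalizing n with
  | C a =>
    rw [← algebraMap_eq, AlgHom.commutes, IsScalarTower.algebraMap_apply K (MvPolynomial (Fin 3) K),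
      Polynomial.algebraMap_eq, Polynomial.coeff_C, Polynomial.coeff_C_succ]
    rcases n with _ | n <;> simp
  | add p q hp hq =>
    convert (hp n).add (hq n) using 1
    simp only [map_add, Polynomial.coeff_add]
    ring
  | mul_X p i hp =>
    rw [map_mul]
    have hcomm : pderiv 1 (pderiv 2 G) = pderiv 2 (pderiv 1 G) := pderiv_pderiv_swap 1 2 G
    have f0 : flow G (X 0) = Polynomial.C (X 0) + Polynomial.C 0 * Polynomial.X := by simp [flow]
    have f1 : flow G (X 1) = Polynomial.C (X 1) + Polynomial.C (pderiv 2 G) * Polynomial.X := by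
      simp [flow]
    have f2 : flow G (X 2) = Polynomial.C (X 2) + Polynomial.C (-pderiv 1 G) * Polynomial.X := by
      simp [flow]; ring
    fin_cases i
    · change G ∣ _ * flowField G ((_ * flow G (X 0)).coeff n) - _ * (_ * flow G (X 0)).coeff _ -
        _ * (_ * flow G (X 0)).coeff n
      rw [f0]
      exact step _ _ _ (by simp [flowField_apply, pderiv_X]) (by simp) hp n
    · change G ∣ _ * flowField G ((_ * flow G (X 1)).coeff n) - _ * (_ * flow G (X 1)).coeff _ -
        _ * (_ * flow G (X 1)).coeff n
      rw [f1]
      refine step _ _ _ (by simp [flowField_apply, pderiv_X]) ?_ hp n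
      rw [mul_comm, sub_self]
      exact dvd_zero _
    · change G ∣ _ * flowField G ((_ * flow G (X 2)).coeff n) - _ * (_ * flow G (X 2)).coeff _ -
        _ * (_ * flow G (X 2)).coeff n
      rw [f2]
      refine step _ _ _ (by simp [flowField_apply, pderiv_X]) ?_ hp n
      convert hH.neg_right using 1
      simp only [flowField_apply, map_neg, hcomm, lineForm]
      ring

theorem C_dvd_flow_self {G : MvPolynomial (Fin 3) K} (hG : Prime G) (hz : ¬ G ∣ pderiv 2 G)
    (hH : G ∣ lineForm 1 G)
    (hp : ∀ n : ℕ, 0 < n → n ≤ weightedTotalDegree ![0, 1, 1] G → (n : K) ≠ 0) :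
    Polynomial.C G ∣ flow G G := by
  rw [Polynomial.C_dvd_iff_dvd_coeff]
  have hdeg : (flow G G).natDegree ≤ weightedTotalDegree ![0, 1, 1] G := by
    refine natDegree_aeval_le _ _ _ fun i => ?_
    fin_cases i
    · simp
    · simp only [Fin.mk_one, Matrix.cons_val_one, Matrix.cons_val_zero]
      rw [add_comm]
      exact Polynomial.natDegree_linear_le
    · change (Polynomial.C (X 2) - Polynomial.C (pderiv 1 G) * Polynomial.X).natDegree ≤ 1
      have := Polynomial.natDegree_linear_le (a := - pderiv 1 G) (b := (X 2 : MvPolynomial (Fin 3) K))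
      convert this using 2
      simp; ring
  intro n
  induction n with
  | zero =>
    have : ∀ f, (flow G f).coeff 0 = f := by
      intro f
      rw [Polynomial.coeff_zero_eq_eval_zero]
      induction f using MvPolynomial.induction_on with
      | C a =>
        rw [← algebraMap_eq, AlgHom.commutes,
          IsScalarTower.algebraMap_apply K (MvPolynomial (Fin 3) K), Polynomial.algebraMap_eq,
          Polynomial.eval_C]
      | add p q hp hq => simp [hp, hq]
      | mul_X p i hp =>
        rw [map_mul, Polynomial.eval_mul, hp]
        congr 1
        fin_cases i <;> simp [flow]
    rw [this]
  | succ n ih =>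
    by_cases hn : n + 1 ≤ weightedTotalDegree ![0, 1, 1] G
    · have hr := dvd_flow_recursion hH G n
      obtain ⟨u, hu⟩ := ih
      have hΘ : G ∣ flowField G ((flow G G).coeff n) := by
        rw [hu, Derivation.leibniz]
        refine dvd_add (Dvd.intro _ rfl) ?_
        rw [flowField_apply]
        simp [mul_comm]
      have h1 : G ∣ (n + 1) * pderiv 2 G * (flow G G).coeff (n + 1) := by
        have h2 : G ∣ n * flowField G (pderiv 2 G) * (flow G G).coeff n := by
          rw [hu]
          exact ⟨n * flowField G (pderiv 2 G) * u, by ring⟩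
        have h3 := ((hΘ.mul_left (pderiv 2 G)).sub hr).sub h2
        convert h3 using 1
        ring
      rcases hG.dvd_or_dvd h1 with h | h
      · rcases hG.dvd_or_dvd h with h | h
        · exfalso
          refine hG.not_isUnit (isUnit_of_dvd_unit h ?_)
          have : ((n : MvPolynomial (Fin 3) K) + 1) = C ((n + 1 : ℕ) : K) := by simp
          rw [this]
          exact (IsUnit.mk0 _ (hp _ n.succ_pos hn)).map C
        · exact absurd h hz
      · exact h
    · rw [Polynomial.coeff_eq_zero_of_natDegree_lt (by omega)]
      exact dvd_zero _

end Sections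

section Ruled
open MvPolynomial
variable {K : Type*} [Field K]

theorem dvd_of_forall_common_section {G H : MvPolynomial (Fin 3) K} (hG : Prime G)
    (w : ℕ → Polynomial K × Polynomial K) (hw : Function.Injective w)
    (h1 : ∀ i, aeval ![Polynomial.X, (w i).1, (w i).2] G = 0)
    (h2 : ∀ i, aeval ![Polynomial.X, (w i).1, (w i).2] H = 0) : G ∣ H := by
  by_contra hH
  have := card_common_sections_le hG hH ((Finset.range (weightedTotalDegree ![0, 1, 1] G *
    weightedTotalDegree ![0, 1, 1] H + 1)).image w)
    (fun v hv => by obtain ⟨i, -, rfl⟩ := Finset.mem_image.1 hv; exact h1 i)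
    (fun v hv => by obtain ⟨i, -, rfl⟩ := Finset.mem_image.1 hv; exact h2 i)
  rw [Finset.card_image_of_injective _ hw, Finset.card_range] at this
  omega

theorem weightedTotalDegree_aeval_X_zero (w : Fin 3 → ℕ) (hw : w 0 = 0) (g : Polynomial K) :
    weightedTotalDegree w (Polynomial.aeval (X 0 : MvPolynomial (Fin 3) K) g) = 0 := by
  rw [← natDegree_gradeHom, ← Polynomial.aeval_algHom_apply]
  have : gradeHom w (X 0 : MvPolynomial (Fin 3) K) = Polynomial.C (X 0) := by
    simp [gradeHom, hw]
  rw [this]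
  have : Polynomial.aeval (Polynomial.C (X 0 : MvPolynomial (Fin 3) K)) g =
      Polynomial.C (Polynomial.aeval (X 0) g) := by
    have := Polynomial.aeval_algHom_apply
      (IsScalarTower.toAlgHom K (MvPolynomial (Fin 3) K) (Polynomial (MvPolynomial (Fin 3) K)))
      (X 0) g
    simpa [Polynomial.algebraMap_eq] using this
  rw [this, Polynomial.natDegree_C]

theorem weightedTotalDegree_X' (w : Fin 3 → ℕ) (i : Fin 3) :
    weightedTotalDegree w (X i : MvPolynomial (Fin 3) K) = w i := by
  rw [← natDegree_gradeHom]
  simp [gradeHom, Polynomial.natDegree_C_mul (X_ne_zero i)]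

theorem weightedTotalDegree_C' (w : Fin 3 → ℕ) (a : K) :
    weightedTotalDegree w (C a : MvPolynomial (Fin 3) K) = 0 := by
  rw [← natDegree_gradeHom, ← algebraMap_eq, AlgHom.commutes,
    IsScalarTower.algebraMap_apply K (MvPolynomial (Fin 3) K), Polynomial.algebraMap_eq,
    Polynomial.natDegree_C]

theorem weightedTotalDegree_le_one_of_ruled {G : MvPolynomial (Fin 3) K} (hG : Prime G)
    (hz : ¬ G ∣ pderiv 2 G) (hH : G ∣ lineForm 1 G)
    (hp : ∀ n : ℕ, 0 < n → n ≤ weightedTotalDegree ![0, 1, 1] G → (n : K) ≠ 0)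
    {P : K × K × K} (hP : secX P G = 0) (hPz : secX P (pderiv 2 G) ≠ 0) :
    weightedTotalDegree ![0, 1, 1] G ≤ 1 := by
  set g := secX P (pderiv 2 G) with hg
  set h := secX P (pderiv 1 G) with hh
  let w : ℕ → Polynomial K × Polynomial K := fun i =>
    (Polynomial.C P.1 + g * Polynomial.X ^ i,
      Polynomial.C P.2.1 * Polynomial.X + Polynomial.C P.2.2 - h * Polynomial.X ^ i)
  have hw : Function.Injective w := by
    intro i j hij
    have h1 := congrArg Prod.fst hij
    have h2 := mul_left_cancel₀ hPz (add_left_cancel h1)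
    have h3 := congrArg Polynomial.natDegree h2
    simpa using h3
  have hfl : ∀ (i : ℕ) (f : MvPolynomial (Fin 3) K), aeval ![Polynomial.X, (w i).1, (w i).2] f =
      Polynomial.eval₂ (secX P).toRingHom (Polynomial.X ^ i) (flow G f) := by
    intro i f
    induction f using MvPolynomial.induction_on with
    | C a =>
      rw [← algebraMap_eq, AlgHom.commutes, AlgHom.commutes,
        IsScalarTower.algebraMap_apply K (MvPolynomial (Fin 3) K)
          (Polynomial (MvPolynomial (Fin 3) K)),
        Polynomial.algebraMap_eq (R := MvPolynomial (Fin 3) K), Polynomial.eval₂_C]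
      exact ((secX P).commutes a).symm
    | add p q hp hq => simp [hp, hq, Polynomial.eval₂_add]
    | mul_X p j hp =>
      rw [map_mul, map_mul, Polynomial.eval₂_mul, hp]
      congr 1
      have e0 : secX P (X 0) = Polynomial.X := by simp [secX]
      have e1 : secX P (X 1) = Polynomial.C P.1 := by simp [secX]
      have e2 : secX P (X 2) = Polynomial.C P.2.1 * Polynomial.X + Polynomial.C P.2.2 := by
        simp [secX]
      fin_cases j <;>
      simp [flow, Polynomial.eval₂_add, Polynomial.eval₂_sub, Polynomial.eval₂_mul, e0, e1, e2, w,
        ← hg, ← hh]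
  have h0 : ∀ i, aeval ![Polynomial.X, (w i).1, (w i).2] G = 0 := by
    intro i
    obtain ⟨u, hu⟩ := C_dvd_flow_self hG hz hH hp
    rw [hfl, hu, Polynomial.eval₂_mul, Polynomial.eval₂_C]
    change secX P G * _ = 0
    rw [hP, zero_mul]
  let L : MvPolynomial (Fin 3) K :=
    Polynomial.aeval (X 0) g * (X 2 - (C P.2.1 * X 0 + C P.2.2)) +
      Polynomial.aeval (X 0) h * (X 1 - C P.1)
  have hX : ∀ (v : Polynomial K × Polynomial K) (g : Polynomial K),
      aeval (R := K) ![Polynomial.X, v.1, v.2] (Polynomial.aeval (X 0 : MvPolynomial (Fin 3) K) g)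
        = g := by
    intro v g
    rw [← Polynomial.aeval_algHom_apply]
    simp
  have hC : ∀ (v : Polynomial K × Polynomial K) (a : K),
      aeval (R := K) ![Polynomial.X, v.1, v.2] (C a) = Polynomial.C a := by
    intro v a
    rw [← algebraMap_eq, AlgHom.commutes, Polynomial.algebraMap_eq]
  have hLv : ∀ v : Polynomial K × Polynomial K, aeval ![Polynomial.X, v.1, v.2] L =
      g * (v.2 - (Polynomial.C P.2.1 * Polynomial.X + Polynomial.C P.2.2)) +
        h * (v.1 - Polynomial.C P.1) := by
    intro v
    simp only [L, map_add, map_mul, map_sub, hX, hC]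
    simp
  have hdvd : G ∣ L := by
    refine dvd_of_forall_common_section hG w hw h0 fun i => ?_
    rw [hLv]
    simp only [w]
    ring
  have hL0 : L ≠ 0 := by
    intro hL
    have h1 := hLv (Polynomial.C P.1, Polynomial.C P.2.1 * Polynomial.X + Polynomial.C P.2.2 + 1)
    rw [hL, map_zero] at h1
    apply hPz
    simp only [sub_self, mul_zero, add_zero, add_sub_cancel_left, mul_one] at h1
    exact h1.symm
  refine (weightedTotalDegree_le_of_dvd _ hL0 hdvd).trans ?_
  refine (weightedTotalDegree_add_le_max _ _ _).trans (max_le ?_ ?_)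
  · refine (weightedTotalDegree_mul_le' _ _ _).trans ?_
    rw [weightedTotalDegree_aeval_X_zero _ rfl, zero_add]
    refine (weightedTotalDegree_sub_le_max _ _ _).trans (max_le ?_ ?_)
    · rw [weightedTotalDegree_X']; rfl
    · refine (weightedTotalDegree_add_le_max _ _ _).trans (max_le ?_ ?_)
      · refine (weightedTotalDegree_mul_le' _ _ _).trans ?_
        rw [weightedTotalDegree_C', weightedTotalDegree_X']
        simp
      · rw [weightedTotalDegree_C']; simp
  · refine (weightedTotalDegree_mul_le' _ _ _).trans ?_
    rw [weightedTotalDegree_aeval_X_zero _ rfl, zero_add]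
    refine (weightedTotalDegree_sub_le_max _ _ _).trans (max_le ?_ ?_)
    · rw [weightedTotalDegree_X']; rfl
    · rw [weightedTotalDegree_C']; simp

theorem weightedTotalDegree_le_one_of_ruled' {G : MvPolynomial (Fin 3) K} (hG : Prime G)
    (hz : ¬ G ∣ pderiv 2 G) (hH : G ∣ lineForm 0 G)
    (hp : ∀ n : ℕ, 0 < n → n ≤ weightedTotalDegree ![1, 0, 1] G → (n : K) ≠ 0)
    {Q : K × K × K} (hQ : secY Q G = 0) (hQz : secY Q (pderiv 2 G) ≠ 0) :
    weightedTotalDegree ![1, 0, 1] G ≤ 1 := by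
  rw [← weightedTotalDegree_swapXY] at hp ⊢
  rw [← secX_swapXY] at hQ hQz
  refine weightedTotalDegree_le_one_of_ruled (swapXY_prime hG) ?_ ?_ hp hQ ?_
  · rwa [pderiv_swapXY_two, swapXY_dvd_iff]
  · rwa [lineForm_one_swapXY, swapXY_dvd_iff]
  · rwa [pderiv_swapXY_two]

/-- A polynomial of degree at most one in both gradings is a bilinear form plus a linear term. -/
theorem exists_bilinear_form {G : MvPolynomial (Fin 3) K}
    (h1 : weightedTotalDegree ![1, 0, 1] G ≤ 1) (h2 : weightedTotalDegree ![0, 1, 1] G ≤ 1) :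
    ∃ c₀ c₁ c₂ c₃ c₄ : K, G = C c₀ + C c₁ * X 0 + C c₂ * X 1 + C c₃ * (X 0 * X 1) + C c₄ * X 2 := by
  rw [weightedTotalDegree_le_iff] at h1 h2
  let e : ℕ × ℕ × ℕ → (Fin 3 →₀ ℕ) := fun v => Finsupp.equivFunOnFinite.symm ![v.1, v.2.1, v.2.2]
  have he : Function.Injective e := by
    intro v v' hv
    have g := fun i => DFunLike.congr_fun hv i
    have g0 := g 0
    have g1 := g 1
    have g2 := g 2
    simp [e] at g0 g1 g2
    exact Prod.ext g0 (Prod.ext g1 g2)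
  let S : Finset (ℕ × ℕ × ℕ) := {(0, 0, 0), (1, 0, 0), (0, 1, 0), (1, 1, 0), (0, 0, 1)}
  have hG : G = ∑ v ∈ S, monomial (e v) (coeff (e v) G) := by
    rw [← Finset.sum_image (f := fun d => monomial d (coeff d G)) (fun a _ b _ h => he h)]
    conv_lhs => rw [G.as_sum]
    refine Finset.sum_subset ?_ fun d _ hd => ?_
    · intro d hd
      have hd' := mem_support_iff.1 hd
      have a1 := h1 d hd'
      have a2 := h2 d hd'
      rw [Finsupp.weight_apply, Finsupp.sum_fintype _ _ (by simp)] at a1 a2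
      simp [Fin.sum_univ_three] at a1 a2
      rw [Finset.mem_image]
      refine ⟨(d 0, d 1, d 2), ?_, ?_⟩
      · simp only [S, Finset.mem_insert, Finset.mem_singleton, Prod.mk.injEq]
        omega
      · ext i
        fin_cases i <;> simp [e]
    · rw [notMem_support_iff.1 hd, map_zero]
  have hm : ∀ v a, monomial (e v) a = (C a * (X 0 ^ v.1 * X 1 ^ v.2.1 * X 2 ^ v.2.2) : MvPolynomial (Fin 3) K) := by
    intro v a
    rw [monomial_eq, Finsupp.prod_fintype _ _ (by simp), Fin.prod_univ_three]
    simp [e]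
  refine ⟨coeff (e (0, 0, 0)) G, coeff (e (1, 0, 0)) G, coeff (e (0, 1, 0)) G,
    coeff (e (1, 1, 0)) G, coeff (e (0, 0, 1)) G, ?_⟩
  conv_lhs => rw [hG]
  simp [S, hm]
  ring

theorem secY_eq_zero_of_bilinear {G : MvPolynomial (Fin 3) K}
    (h1 : weightedTotalDegree ![1, 0, 1] G ≤ 1) (h2 : weightedTotalDegree ![0, 1, 1] G ≤ 1)
    (hz : pderiv 2 G ≠ 0) :
    ∃ α β γ δ : K, ∀ Q : K × K × K, secY Q G = 0 →
      Q.2.1 = γ + δ * Q.1 ∧ Q.2.2 = α + β * Q.1 := by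
  obtain ⟨c₀, c₁, c₂, c₃, c₄, rfl⟩ := exists_bilinear_form h1 h2
  have hc : c₄ ≠ 0 := by
    rintro rfl
    apply hz
    simp [pderiv_X]
  refine ⟨-c₀ / c₄, -c₁ / c₄, -c₂ / c₄, -c₃ / c₄, fun Q hQ => ?_⟩
  have hC : ∀ a : K, secY Q (C a) = Polynomial.C a := by
    intro a
    rw [← algebraMap_eq, AlgHom.commutes, Polynomial.algebraMap_eq]
  have e0 : secY Q (X 0) = Polynomial.C Q.1 := by simp [secY]
  have e1 : secY Q (X 1) = Polynomial.X := by simp [secY]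
  have e2 : secY Q (X 2) = Polynomial.C Q.2.1 * Polynomial.X + Polynomial.C Q.2.2 := by
    simp [secY]
  simp only [map_add, map_mul, hC, e0, e1, e2] at hQ
  have q0 := congrArg (Polynomial.eval 0) hQ
  have q1 := congrArg (Polynomial.eval 1) hQ
  simp at q0 q1
  constructor
  · field_simp
    linear_combination q1 - q0
  · field_simp
    linear_combination q0

/-- A prime polynomial in `x, y` does not vanish on lines of both families. -/
theorem not_secX_secY_of_dvd_pderiv {G : MvPolynomial (Fin 3) K} (hG : Prime G)
    (hz : G ∣ pderiv 2 G)
    (hp : ∀ n : ℕ, 0 < n → n ≤ weightedTotalDegree ![0, 1, 1] G → (n : K) ≠ 0)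
    {P Q : K × K × K} (hP : secX P G = 0) (hQ : secY Q G = 0) : False := by
  have hz0 : pderiv 2 G = 0 := by
    rcases weightedTotalDegree_pderiv_le ![0, 0, 1] 2 G with h | h
    · by_contra h0
      have := weightedTotalDegree_le_of_dvd ![0, 0, 1] h0 hz
      simp at h
      omega
    · exact h
  have hvar : 2 ∉ G.vars := by
    intro hv
    obtain ⟨d, hd, hd2⟩ := (mem_vars_iff_mem_support _).1 hv
    have h0 : d 2 ≠ 0 := Finsupp.mem_support_iff.1 hd2
    have h1 := congrArg (coeff (d - Finsupp.single 2 1)) hz0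
    rw [coeff_pderiv, coeff_zero] at h1
    have h2 : d - Finsupp.single 2 1 + Finsupp.single 2 1 = d := by
      ext i
      by_cases hi : i = 2
      · subst hi; simp; omega
      · simp [Ne.symm hi]
    rw [h2] at h1
    rcases mul_eq_zero.1 h1 with h | h
    · exact mem_support_iff.1 hd h
    · have h3 : (((d - Finsupp.single 2 1 : Fin 3 →₀ ℕ) 2 : ℕ) : K) + 1 = (d 2 : ℕ) := by
        rw [← Nat.cast_add_one]
        congr 1
        simp; omega
      rw [h3] at h
      refine hp (d 2) (by omega) ?_ h
      have h4 := le_weightedTotalDegree ![0, 1, 1] hd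
      rw [Finsupp.weight_apply, Finsupp.sum_fintype _ _ (by simp)] at h4
      simp [Fin.sum_univ_three] at h4
      omega
  have key : ∀ {G : MvPolynomial (Fin 3) K}, Prime G → 2 ∉ G.vars → ∀ {P : K × K × K},
      secX P G = 0 → G ∣ X 1 - C P.1 := by
    intro G hG hvar P hP
    refine dvd_of_forall_common_section hG
      (fun i => (Polynomial.C P.1, Polynomial.X ^ i)) (fun i j hij => ?_) (fun i => ?_) fun i => ?_
    · have := congrArg Polynomial.natDegree (congrArg Prod.snd hij)
      simpa using this
    · rw [← hP]
      refine hom_congr_vars (f₁ := (aeval _ : MvPolynomial (Fin 3) K →ₐ[K] Polynomial K).toRingHom)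
        (f₂ := (secX P).toRingHom) ?_ ?_ rfl
      · ext a
        simp
      · intro j hj _
        fin_cases j
        · simp [secX]
        · simp [secX]
        · exact absurd hj hvar
    · simp only [map_sub, aeval_X, ← algebraMap_eq, AlgHom.commutes]
      simp [Polynomial.algebraMap_eq]
  have d1 := key hG hvar hP
  have d2 : swapXY G ∣ swapXY (X 0 - C Q.1) := by
    have hv : 2 ∉ (swapXY G).vars := by
      intro h
      obtain ⟨i, hi, hi2⟩ := Finset.mem_image.1 (vars_rename _ _ h)
      fin_cases i
      · simp at hi2
      · simp at hi2
      · exact hvar hi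
    have := key (swapXY_prime hG) hv (P := Q) (by rwa [secX_swapXY])
    simpa [swapXY] using this
  rw [swapXY_dvd_iff] at d2
  have n1 : (X 1 - C P.1 : MvPolynomial (Fin 3) K) ≠ 0 := by
    intro h
    have := congrArg (eval (fun _ => P.1 + 1)) h
    simp at this
  have n2 : (X 0 - C Q.1 : MvPolynomial (Fin 3) K) ≠ 0 := by
    intro h
    have := congrArg (eval (fun _ => Q.1 + 1)) h
    simp at this
  have w1 : weightedTotalDegree ![1, 0, 0] G ≤ 0 := by
    refine (weightedTotalDegree_le_of_dvd _ n1 d1).trans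
      ((weightedTotalDegree_sub_le_max _ _ _).trans (max_le ?_ ?_))
    · rw [weightedTotalDegree_X']; rfl
    · rw [weightedTotalDegree_C']
  have w2 : weightedTotalDegree ![0, 1, 1] G ≤ 0 := by
    refine (weightedTotalDegree_le_of_dvd _ n2 d2).trans
      ((weightedTotalDegree_sub_le_max _ _ _).trans (max_le ?_ ?_))
    · rw [weightedTotalDegree_X']; rfl
    · rw [weightedTotalDegree_C']
  rw [weightedTotalDegree_le_iff] at w1 w2
  have hGC : G = C (coeff 0 G) := by
    ext d
    rw [coeff_C]
    split_ifs with h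
    · rw [h]
    · by_contra hd
      apply h
      have a1 := w1 d hd
      have a2 := w2 d hd
      rw [Finsupp.weight_apply, Finsupp.sum_fintype _ _ (by simp)] at a1 a2
      simp [Fin.sum_univ_three] at a1 a2
      ext i
      fin_cases i
      · simpa using a1.symm
      · simpa using a2.1.symm
      · simpa using a2.2.symm
  have hc : coeff 0 G ≠ 0 := by
    intro h
    rw [h, map_zero] at hGC
    exact hG.ne_zero hGC
  apply hG.not_isUnit
  rw [hGC]
  exact (IsUnit.mk0 _ hc).map C

end Ruled

section Incidence
open MvPolynomial
variable {K : Type*} [Field K]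

/-- Incidence of a line `y = c, z = m x + n` with a line `x = c', z = m' y + n'`. -/
def Meets {R : Type*} [CommRing R] (P Q : R × R × R) : Prop :=
  P.2.1 * Q.1 + P.2.2 = Q.2.1 * P.1 + Q.2.2

theorem Meets.symm {R : Type*} [CommRing R] {P Q : R × R × R} (h : Meets P Q) : Meets Q P :=
  Eq.symm h

/-- The first coordinate determines the second. -/
def GoodPosition {R : Type*} (S : Finset (R × R × R)) : Prop :=
  ∀ u ∈ S, ∀ v ∈ S, u.1 = v.1 → u.2.1 = v.2.1

/-- No line transversal to the first coordinate contains more than `k` elements. -/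
def LineBound {R : Type*} [CommRing R] (S : Finset (R × R × R)) (k : ℕ) : Prop :=
  ∀ α β γ δ : R, (S.filter fun Q => Q.2.1 = γ + δ * Q.1 ∧ Q.2.2 = α + β * Q.1).card ≤ k

theorem eval_secX_eq_eval_secY {P Q : K × K × K} (h : Meets P Q) (f : MvPolynomial (Fin 3) K) :
    (secX P f).eval Q.1 = (secY Q f).eval P.1 := by
  induction f using MvPolynomial.induction_on with
  | C a =>
    rw [← algebraMap_eq, AlgHom.commutes, AlgHom.commutes]
    simp [Polynomial.algebraMap_eq]
  | add p q hp hq => simp [hp, hq]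
  | mul_X p i hp =>
    rw [map_mul, map_mul, Polynomial.eval_mul, Polynomial.eval_mul, hp]
    congr 1
    fin_cases i <;> simp [secX, secY]
    exact h

theorem card_le_of_secX_ne_zero {S : Finset (K × K × K)} (hS : GoodPosition S) {P : K × K × K}
    (hP : ∀ Q ∈ S, Meets P Q) {f : MvPolynomial (Fin 3) K} (hf : ∀ Q ∈ S, secY Q f = 0)
    (h0 : secX P f ≠ 0) : S.card ≤ weightedTotalDegree ![1, 0, 1] f := by
  have hinj : Set.InjOn (fun Q : K × K × K => Q.1) S := by
    intro u hu v hv huv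
    have h1 := hS u hu v hv huv
    have h2 := hP u hu
    have h3 := hP v hv
    simp only [Meets] at h2 h3
    simp only at huv
    refine Prod.ext huv (Prod.ext h1 ?_)
    rw [h1, huv] at h2
    linear_combination h3 - h2
  rw [← Finset.card_image_of_injOn hinj]
  refine le_trans ?_ ((Polynomial.card_roots' (secX P f)).trans (natDegree_secX_le _ _))
  refine le_trans (Finset.card_le_card ?_) (Multiset.toFinset_card_le _)
  intro x hx
  obtain ⟨Q, hQ, rfl⟩ := Finset.mem_image.1 hx
  rw [Multiset.mem_toFinset, Polynomial.mem_roots h0, Polynomial.IsRoot,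
    eval_secX_eq_eval_secY (hP Q hQ), hf Q hQ, Polynomial.eval_zero]

/-- A polynomial of small degree vanishing on a given set of lines. -/
theorem exists_vanishing (Q : Finset (K × K × K)) (a b : ℕ)
    (hab : Q.card * (2 * b + 1) < (a + 1) * (b + 1) ^ 2) :
    ∃ G : MvPolynomial (Fin 3) K, G ≠ 0 ∧ weightedTotalDegree ![1, 0, 1] G ≤ a + b ∧
      weightedTotalDegree ![0, 1, 1] G ≤ 2 * b ∧ ∀ q ∈ Q, secY q G = 0 := by
  let s : Set (Fin 3 →₀ ℕ) := {d | d 0 ≤ a ∧ d 1 ≤ b ∧ d 2 ≤ b}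
  have es : s ≃ Fin (a + 1) × Fin (b + 1) × Fin (b + 1) :=
    { toFun := fun d => (⟨d.1 0, Nat.lt_succ_of_le d.2.1⟩, ⟨d.1 1, Nat.lt_succ_of_le d.2.2.1⟩,
        ⟨d.1 2, Nat.lt_succ_of_le d.2.2.2⟩)
      invFun := fun v => ⟨Finsupp.equivFunOnFinite.symm ![v.1.1, v.2.1.1, v.2.2.1],
        by simpa using Nat.le_of_lt_succ v.1.2, by simpa using Nat.le_of_lt_succ v.2.1.2,
        by simpa using Nat.le_of_lt_succ v.2.2.2⟩
      left_inv := fun d => by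
        apply Subtype.ext
        ext i
        fin_cases i <;> simp
      right_inv := fun v => by simp }
  have : Finite s := Finite.of_equiv _ es.symm
  have hfr : Module.finrank K (restrictSupport K s) = (a + 1) * (b + 1) ^ 2 := by
    rw [Module.finrank_eq_nat_card_basis (basisRestrictSupport K s), Nat.card_congr es]
    simp
    ring
  have : Module.Finite K (restrictSupport K s) := Module.Finite.of_basis (basisRestrictSupport K s)
  let ev : restrictSupport K s →ₗ[K] (Q × Fin (2 * b + 1) → K) :=
    { toFun := fun G z => (secY z.1.1 G.1).coeff z.2.1
      map_add' := fun f f' => by ext; simp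
      map_smul' := fun c f => by ext; simp }
  have hker : LinearMap.ker ev ≠ ⊥ := by
    apply LinearMap.ker_ne_bot_of_finrank_lt
    rw [Module.finrank_fintype_fun_eq_card, Fintype.card_prod, Fintype.card_coe, Fintype.card_fin,
      hfr]
    exact hab
  obtain ⟨G, hG, hG0⟩ := Submodule.exists_mem_ne_zero_of_ne_bot hker
  have hd : ∀ d, coeff d G.1 ≠ 0 → d 0 ≤ a ∧ d 1 ≤ b ∧ d 2 ≤ b := fun d hd =>
    (mem_restrictSupport_iff K).1 G.2 (Finset.mem_coe.2 (mem_support_iff.2 hd))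
  have hw2 : weightedTotalDegree ![0, 1, 1] G.1 ≤ 2 * b := by
    rw [weightedTotalDegree_le_iff]
    intro d hdc
    have := hd d hdc
    rw [Finsupp.weight_apply, Finsupp.sum_fintype _ _ (by simp)]
    simp [Fin.sum_univ_three]
    omega
  refine ⟨G.1, fun h => hG0 (Subtype.ext h), ?_, hw2, fun q hq => ?_⟩
  · rw [weightedTotalDegree_le_iff]
    intro d hdc
    have := hd d hdc
    rw [Finsupp.weight_apply, Finsupp.sum_fintype _ _ (by simp)]
    simp [Fin.sum_univ_three]
    omega
  · ext i
    rw [Polynomial.coeff_zero]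
    by_cases hi : i < 2 * b + 1
    · exact congrFun (LinearMap.mem_ker.1 hG) (⟨q, hq⟩, ⟨i, hi⟩)
    · refine Polynomial.coeff_eq_zero_of_natDegree_lt ?_
      have := natDegree_secY_le q G.1
      omega

theorem exists_prime_factors {G : MvPolynomial (Fin 3) K} (hG : G ≠ 0) :
    ∃ T : Finset (MvPolynomial (Fin 3) K), (∀ g ∈ T, Prime g) ∧
      (∀ g ∈ T, ∀ g' ∈ T, g ≠ g' → ¬ g ∣ g') ∧
      (∀ w : Fin 3 → ℕ, ∑ g ∈ T, weightedTotalDegree w g ≤ weightedTotalDegree w G) ∧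
      ∀ φ : MvPolynomial (Fin 3) K →ₐ[K] Polynomial K, φ G = 0 → ∃ g ∈ T, φ g = 0 := by
  induction G using UniqueFactorizationMonoid.induction_on_prime with
  | h₁ => exact absurd rfl hG
  | h₂ u hu =>
    exact ⟨∅, by simp, by simp, by simp, fun φ h => absurd h (hu.map φ).ne_zero⟩
  | h₃ a q ha hq ih =>
    obtain ⟨T, h1, h2, h3, h4⟩ := ih ha
    by_cases hqT : ∃ g ∈ T, q ∣ g
    · obtain ⟨g, hg, hqg⟩ := hqT
      have hass := (hq.dvd_prime_iff_associated (h1 g hg)).1 hqg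
      refine ⟨T, h1, h2, fun w => ?_, fun φ h => ?_⟩
      · rw [weightedTotalDegree_mul_of_ne_zero w hq.ne_zero ha]
        exact (h3 w).trans (Nat.le_add_left _ _)
      · rw [map_mul] at h
        rcases mul_eq_zero.1 h with h | h
        · refine ⟨g, hg, ?_⟩
          obtain ⟨c, rfl⟩ := hqg
          rw [map_mul, h, zero_mul]
        · exact h4 φ h
    · push Not at hqT
      have hq0 : q ∉ T := fun h => hqT q h dvd_rfl
      refine ⟨insert q T, ?_, ?_, fun w => ?_, fun φ h => ?_⟩
      · intro g hg
        rcases Finset.mem_insert.1 hg with rfl | hg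
        · exact hq
        · exact h1 g hg
      · intro g hg g' hg' hne
        rcases Finset.mem_insert.1 hg with rfl | hgT
        · rcases Finset.mem_insert.1 hg' with rfl | hgT'
          · exact absurd rfl hne
          · exact hqT g' hgT'
        · rcases Finset.mem_insert.1 hg' with rfl | hgT'
          · intro hd
            exact hqT g hgT ((h1 g hgT).dvd_prime_iff_associated hq |>.1 hd).symm.dvd
          · exact h2 g hgT g' hgT' hne
      · rw [Finset.sum_insert hq0, weightedTotalDegree_mul_of_ne_zero w hq.ne_zero ha]
        exact Nat.add_le_add_left (h3 w) _
      · rw [map_mul] at h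
        rcases mul_eq_zero.1 h with h | h
        · exact ⟨q, Finset.mem_insert_self _ _, h⟩
        · obtain ⟨g, hg, hφ⟩ := h4 φ h
          exact ⟨g, Finset.mem_insert_of_mem hg, hφ⟩

theorem card_filter_secX_le {g h : MvPolynomial (Fin 3) K} (hg : Prime g) (hgh : ¬ g ∣ h)
    (P : Finset (K × K × K)) :
    (P.filter fun u => secX u g = 0 ∧ secX u h = 0).card ≤
      weightedTotalDegree ![0, 1, 1] g * weightedTotalDegree ![0, 1, 1] h := by
  let φ : K × K × K → Polynomial K × Polynomial K := fun u =>
    (Polynomial.C u.1, Polynomial.C u.2.1 * Polynomial.X + Polynomial.C u.2.2)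
  have hφ : Function.Injective φ := by
    intro u v huv
    have h1 := congrArg Prod.fst huv
    have h2 := congrArg Prod.snd huv
    have h3 := congrArg (fun f => Polynomial.coeff f 0) h2
    have h4 := congrArg (fun f => Polynomial.coeff f 1) h2
    simp [φ] at h1 h3 h4
    exact Prod.ext h1 (Prod.ext h4 h3)
  rw [← Finset.card_image_of_injective _ hφ]
  refine card_common_sections_le hg hgh _ ?_ ?_
  · intro v hv
    obtain ⟨u, hu, rfl⟩ := Finset.mem_image.1 hv
    exact (Finset.mem_filter.1 hu).2.1
  · intro v hv
    obtain ⟨u, hu, rfl⟩ := Finset.mem_image.1 hv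
    exact (Finset.mem_filter.1 hu).2.2

theorem card_hits_le {g : MvPolynomial (Fin 3) K} (hg : Prime g)
    (hp1 : ∀ n : ℕ, 0 < n → n ≤ weightedTotalDegree ![1, 0, 1] g → (n : K) ≠ 0)
    (hp2 : ∀ n : ℕ, 0 < n → n ≤ weightedTotalDegree ![0, 1, 1] g → (n : K) ≠ 0)
    {S : Finset (K × K × K)} (hS : GoodPosition S) {k : ℕ} (hk : LineBound S k) {u : K × K × K}
    (hu : ∀ q ∈ S, Meets u q) (hSg : ∀ q ∈ S, secY q g = 0)
    (hbad : ∀ h, h = lineForm 1 g ∨ h = lineForm 0 g ∨ h = pderiv 2 g → secX u h = 0 → g ∣ h)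
    (hug : secX u g = 0) : S.card ≤ 3 * weightedTotalDegree ![1, 0, 1] g + k := by
  by_cases h1 : g ∣ lineForm 1 g
  swap
  · have := card_le_of_secX_ne_zero hS hu (fun q hq => secY_lineForm_eq_zero (hSg q hq))
      (fun h => h1 (hbad _ (Or.inl rfl) h))
    have := weightedTotalDegree_lineForm_le ![1, 0, 1] 1 g
    omega
  by_cases hz : g ∣ pderiv 2 g
  · have : S = ∅ := by
      rw [Finset.eq_empty_iff_forall_notMem]
      exact fun q hq => not_secX_secY_of_dvd_pderiv hg hz hp2 hug (hSg q hq)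
    simp [this]
  have huz : secX u (pderiv 2 g) ≠ 0 := fun h => hz (hbad _ (Or.inr (Or.inr rfl)) h)
  have h0 : g ∣ lineForm 0 g := hbad _ (Or.inr (Or.inl rfl)) (secX_lineForm_eq_zero hug)
  have hd2 := weightedTotalDegree_le_one_of_ruled hg hz h1 hp2 hug huz
  by_cases hq : ∃ q ∈ S, secY q (pderiv 2 g) ≠ 0
  · obtain ⟨q, hqS, hqz⟩ := hq
    have hd1 := weightedTotalDegree_le_one_of_ruled' hg hz h0 hp1 (hSg q hqS) hqz
    obtain ⟨α, β, γ, δ, hl⟩ := secY_eq_zero_of_bilinear hd1 hd2 (fun h => hz (h ▸ dvd_zero g))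
    have := hk α β γ δ
    rw [Finset.filter_true_of_mem (fun q hq => hl q (hSg q hq))] at this
    omega
  · push Not at hq
    have := card_le_of_secX_ne_zero hS hu hq huz
    have := weightedTotalDegree_pderiv_le' ![1, 0, 1] 2 g
    omega

theorem GoodPosition.mono {R : Type*} {S T : Finset (R × R × R)} (h : GoodPosition T) (hST : S ⊆ T) :
    GoodPosition S := fun u hu v hv => h u (hST hu) v (hST hv)

theorem LineBound.mono {R : Type*} [CommRing R] {S T : Finset (R × R × R)} {k : ℕ} (h : LineBound T k) (hST : S ⊆ T) :
    LineBound S k := fun α β γ δ =>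
  (Finset.card_le_card (Finset.filter_subset_filter _ hST)).trans (h α β γ δ)

/-- All but `|Q| / 2` lines have few incidences with `Q`. -/
theorem exists_few_rich {Q : Finset (K × K × K)} (hQ : GoodPosition Q) {k : ℕ} (hk : LineBound Q k)
    {r : ℕ} (hr : r = Nat.sqrt Q.card)
    (hp : ∀ n : ℕ, 0 < n → n ≤ 17 * (r + 1) → (n : K) ≠ 0) (P : Finset (K × K × K)) :
    ∃ B ⊆ P, 2 * B.card ≤ Q.card ∧
      ∀ u ∈ P \ B, (Q.filter fun q => Meets u q).card ≤ 51 * (r + 1) + k := by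
  have hr1 : r * r ≤ Q.card := hr ▸ Nat.sqrt_le Q.card
  have hr2 : Q.card < (r + 1) * (r + 1) := hr ▸ Nat.lt_succ_sqrt Q.card
  obtain ⟨b, hb⟩ : ∃ b, b = r / 8 := ⟨_, rfl⟩
  have hb1 : r + 1 ≤ 8 * (b + 1) := by omega
  have hb2 : 8 * b ≤ r := by omega
  obtain ⟨G, hG0, hG1, hG2, hGQ⟩ := exists_vanishing Q (16 * r + 15) b (by
    have e1 : Q.card * (2 * b + 1) < (r + 1) * (r + 1) * (2 * b + 1) :=
      Nat.mul_lt_mul_of_pos_right hr2 (by omega)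
    have e2 : (r + 1) * (b + 1) * (r + 1) ≤ (r + 1) * (b + 1) * (8 * (b + 1)) :=
      Nat.mul_le_mul_left _ hb1
    nlinarith [Nat.zero_le (r * r)])
  obtain ⟨T, hT1, hT2, hT3, hT4⟩ := exists_prime_factors hG0
  set d1 : MvPolynomial (Fin 3) K → ℕ := weightedTotalDegree ![1, 0, 1] with hd1
  set d2 : MvPolynomial (Fin 3) K → ℕ := weightedTotalDegree ![0, 1, 1] with hd2
  have hs1 : ∑ g ∈ T, d1 g ≤ 17 * (r + 1) := (hT3 _).trans (hG1.trans (by omega))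
  have hs2 : ∑ g ∈ T, d2 g ≤ 2 * b := (hT3 _).trans hG2
  have hg1 : ∀ g ∈ T, d1 g ≤ 17 * (r + 1) := fun g hg =>
    (Finset.single_le_sum (fun _ _ => Nat.zero_le _) hg).trans hs1
  have hg2 : ∀ g ∈ T, d2 g ≤ 17 * (r + 1) := fun g hg =>
    ((Finset.single_le_sum (fun _ _ => Nat.zero_le _) hg).trans hs2).trans (by omega)
  let Z : MvPolynomial (Fin 3) K → MvPolynomial (Fin 3) K → Finset (K × K × K) := fun g h =>
    if g ∣ h then ∅ else P.filter fun u => secX u g = 0 ∧ secX u h = 0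
  have hZ : ∀ g ∈ T, ∀ h, (Z g h).card ≤ d2 g * d2 h := by
    intro g hg h
    simp only [Z]
    split_ifs with hgh
    · simp
    · exact card_filter_secX_le (hT1 g hg) hgh P
  have hZP : ∀ g h, Z g h ⊆ P := by
    intro g h
    simp only [Z]
    split_ifs
    · simp
    · exact Finset.filter_subset _ _
  let F : MvPolynomial (Fin 3) K → Finset (K × K × K) := fun g =>
    (T.biUnion fun g' => Z g g') ∪ (Z g (lineForm 1 g) ∪ (Z g (lineForm 0 g) ∪ Z g (pderiv 2 g)))
  refine ⟨T.biUnion F, ?_, ?_, ?_⟩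
  · refine Finset.biUnion_subset.2 fun g _ => Finset.union_subset
      (Finset.biUnion_subset.2 fun g' _ => hZP _ _) (Finset.union_subset (hZP _ _)
      (Finset.union_subset (hZP _ _) (hZP _ _)))
  · have hF : ∀ g ∈ T, (F g).card ≤ d2 g * (8 * (2 * b)) := by
      intro g hg
      have a0 : (T.biUnion fun g' => Z g g').card ≤ d2 g * (2 * b) := by
        refine Finset.card_biUnion_le.trans ((Finset.sum_le_sum fun g' _ => hZ g hg g').trans ?_)
        rw [← Finset.mul_sum]
        exact Nat.mul_le_mul_left _ hs2
      have a1 := hZ g hg (lineForm 1 g)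
      have a2 := hZ g hg (lineForm 0 g)
      have a3 := hZ g hg (pderiv 2 g)
      have b1 : d2 (lineForm 1 g) ≤ 3 * d2 g := weightedTotalDegree_lineForm_le _ _ _
      have b2 : d2 (lineForm 0 g) ≤ 3 * d2 g := weightedTotalDegree_lineForm_le _ _ _
      have b3 : d2 (pderiv 2 g) ≤ d2 g := weightedTotalDegree_pderiv_le' _ _ _
      have c : d2 g ≤ 2 * b := (Finset.single_le_sum (fun _ _ => Nat.zero_le _) hg).trans hs2
      have e0 := Finset.card_union_le (T.biUnion fun g' => Z g g')
        (Z g (lineForm 1 g) ∪ (Z g (lineForm 0 g) ∪ Z g (pderiv 2 g)))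
      have e1 := Finset.card_union_le (Z g (lineForm 1 g)) (Z g (lineForm 0 g) ∪ Z g (pderiv 2 g))
      have e2 := Finset.card_union_le (Z g (lineForm 0 g)) (Z g (pderiv 2 g))
      have f1 := Nat.mul_le_mul_left (d2 g) (b1.trans (Nat.mul_le_mul_left 3 c))
      have f2 := Nat.mul_le_mul_left (d2 g) (b2.trans (Nat.mul_le_mul_left 3 c))
      have f3 := Nat.mul_le_mul_left (d2 g) (b3.trans c)
      simp only [F]
      nlinarith
    have h1 : (T.biUnion F).card ≤ (2 * b) * (8 * (2 * b)) := by
      refine Finset.card_biUnion_le.trans ((Finset.sum_le_sum hF).trans ?_)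
      rw [← Finset.sum_mul]
      exact Nat.mul_le_mul_right _ hs2
    nlinarith
  · intro u hu
    obtain ⟨huP, huB⟩ := Finset.mem_sdiff.1 hu
    have hnb : ∀ g ∈ T, u ∉ F g := fun g hg h => huB (Finset.mem_biUnion.2 ⟨g, hg, h⟩)
    have hZu : ∀ g h, secX u g = 0 → secX u h = 0 → u ∉ Z g h → g ∣ h := by
      intro g h h1 h2 h3
      by_contra h4
      simp only [Z, if_neg h4] at h3
      exact h3 (Finset.mem_filter.2 ⟨huP, h1, h2⟩)
    let H : MvPolynomial (Fin 3) K → Finset (K × K × K) := fun g =>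
      (Q.filter fun q => Meets u q).filter fun q => secY q g = 0
    have hHQ : ∀ g, H g ⊆ Q := fun g =>
      (Finset.filter_subset _ _).trans (Finset.filter_subset _ _)
    have hcov : (Q.filter fun q => Meets u q) ⊆ T.biUnion H := by
      intro q hq
      obtain ⟨g, hg, hqg⟩ := hT4 _ (hGQ q (Finset.mem_filter.1 hq).1)
      exact Finset.mem_biUnion.2 ⟨g, hg, Finset.mem_filter.2 ⟨hq, hqg⟩⟩
    have hHc : ∀ g ∈ T, (H g).card ≤ 3 * d1 g + if secX u g = 0 then k else 0 := by
      intro g hg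
      have hm : ∀ q ∈ H g, Meets u q := fun q hq =>
        (Finset.mem_filter.1 (Finset.mem_filter.1 hq).1).2
      have h0 : ∀ q ∈ H g, secY q g = 0 := fun q hq => (Finset.mem_filter.1 hq).2
      split_ifs with hug
      · refine card_hits_le (hT1 g hg) (fun n h1 h2 => hp n h1 (h2.trans (hg1 g hg)))
          (fun n h1 h2 => hp n h1 (h2.trans (hg2 g hg))) (hQ.mono (hHQ g)) (hk.mono (hHQ g)) hm h0
          ?_ hug
        intro h hh h0
        refine hZu g h hug h0 fun hz => hnb g hg ?_
        simp only [F, Finset.mem_union]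
        rcases hh with rfl | rfl | rfl
        · exact Or.inr (Or.inl hz)
        · exact Or.inr (Or.inr (Or.inl hz))
        · exact Or.inr (Or.inr (Or.inr hz))
      · have := card_le_of_secX_ne_zero (hQ.mono (hHQ g)) hm h0 hug
        simp only [hd1]
        omega
    have hone : ∑ g ∈ T, (if secX u g = 0 then k else 0) ≤ k := by
      rw [← Finset.sum_filter, Finset.sum_const, smul_eq_mul]
      refine (Nat.mul_le_mul_right k (Finset.card_le_one.2 ?_)).trans (one_mul k).le
      intro g hg g' hg'
      obtain ⟨hg, hg0⟩ := Finset.mem_filter.1 hg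
      obtain ⟨hg', hg0'⟩ := Finset.mem_filter.1 hg'
      by_contra hne
      refine hT2 g hg g' hg' hne (hZu g g' hg0 hg0' fun hz => hnb g hg ?_)
      exact Finset.mem_union_left _ (Finset.mem_biUnion.2 ⟨g', hg', hz⟩)
    refine (Finset.card_le_card hcov).trans (Finset.card_biUnion_le.trans
      ((Finset.sum_le_sum hHc).trans ?_))
    rw [Finset.sum_add_distrib, ← Finset.mul_sum]
    omega

end Incidence

section Incidence
variable {K : Type*} [Field K]

/-- Number of incidences between two families of lines. -/
noncomputable def incCount {R : Type*} [CommRing R] (P Q : Finset (R × R × R)) : ℕ :=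
  ((P ×ˢ Q).filter fun z => Meets z.1 z.2).card

theorem incCount_eq_sum {R : Type*} [CommRing R] (P Q : Finset (R × R × R)) :
    incCount P Q = ∑ u ∈ P, (Q.filter fun q => Meets u q).card := by
  rw [incCount, Finset.card_filter, Finset.sum_product]
  exact Finset.sum_congr rfl fun u _ => (Finset.card_filter _ _).symm

theorem incCount_comm {R : Type*} [CommRing R] (P Q : Finset (R × R × R)) :
    incCount P Q = incCount Q P := by
  rw [incCount, incCount]
  refine Finset.card_bij' (fun z _ => (z.2, z.1)) (fun z _ => (z.2, z.1)) ?_ ?_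
    (fun _ _ => rfl) (fun _ _ => rfl) <;>
  · intro z hz
    simp only [Finset.mem_filter, Finset.mem_product] at hz ⊢
    exact ⟨⟨hz.1.2, hz.1.1⟩, hz.2.symm⟩

theorem incCount_sdiff {R : Type*} [CommRing R] {B P : Finset (R × R × R)} (hB : B ⊆ P)
    (Q : Finset (R × R × R)) : incCount P Q = incCount (P \ B) Q + incCount B Q := by
  rw [incCount_eq_sum, incCount_eq_sum, incCount_eq_sum, Finset.sum_sdiff hB]

theorem incCount_le_of_goodPosition (n : ℕ) : ∀ {P Q : Finset (K × K × K)} {k : ℕ},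
    GoodPosition P → GoodPosition Q → LineBound P k → LineBound Q k → P.card ≤ n → Q.card ≤ n →
    (∀ m : ℕ, 0 < m → m ≤ 17 * (Nat.sqrt n + 1) → (m : K) ≠ 0) →
    incCount P Q ≤ 4 * n * (51 * (Nat.sqrt n + 1) + k) := by
  induction n using Nat.strong_induction_on with
  | _ n ih =>
  intro P Q k hP hQ hkP hkQ hPn hQn hp
  rcases Nat.eq_zero_or_pos n with rfl | hn
  · have : P = ∅ := Finset.card_eq_zero.1 (by omega)
    simp [incCount, this]
  have hfew : ∀ P Q : Finset (K × K × K), GoodPosition Q → LineBound Q k → P.card ≤ n →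
      Q.card ≤ n → ∃ B ⊆ P, 2 * B.card ≤ Q.card ∧
        incCount (P \ B) Q ≤ n * (51 * (Nat.sqrt n + 1) + k) := by
    intro P Q hQ hkQ hPn hQn
    have hs := Nat.sqrt_le_sqrt hQn
    obtain ⟨B, hBP, hB, hB'⟩ := exists_few_rich hQ hkQ rfl
      (fun m h1 h2 => hp m h1 (h2.trans (by omega))) P
    refine ⟨B, hBP, hB, ?_⟩
    rw [incCount_eq_sum]
    refine (Finset.sum_le_card_nsmul _ _ _ hB').trans ?_
    rw [smul_eq_mul]
    exact Nat.mul_le_mul ((Finset.card_le_card Finset.sdiff_subset).trans hPn) (by omega)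
  obtain ⟨B, hBP, hB, hI⟩ := hfew P Q hQ hkQ hPn hQn
  obtain ⟨B', hBQ, hB', hI'⟩ := hfew Q B (hP.mono hBP) (hkP.mono hBP) hQn (by omega)
  have hs : Nat.sqrt (n / 2) ≤ Nat.sqrt n := Nat.sqrt_le_sqrt (Nat.div_le_self n 2)
  have h := ih (n / 2) (by omega) (hP.mono hBP) (hQ.mono hBQ) (hkP.mono hBP) (hkQ.mono hBQ)
    (by omega) (by omega) (fun m h1 h2 => hp m h1 (h2.trans (by omega)))
  rw [incCount_sdiff hBP, incCount_comm B Q, incCount_sdiff hBQ, incCount_comm B' B]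
  have h2 : 4 * (n / 2) * (51 * (Nat.sqrt (n / 2) + 1) + k) ≤
      2 * n * (51 * (Nat.sqrt n + 1) + k) := Nat.mul_le_mul (by omega) (by omega)
  linarith

end Incidence

section Transfer

/-- Every affine line of the three-dimensional space contains at most `k` elements. -/
def AffineLineBound {F : Type*} [Field F] (S : Finset (F × F × F)) (k : ℕ) : Prop :=
  ∀ u v : F × F × F, v ≠ 0 → ∀ T ⊆ S, (∀ x ∈ T, ∃ s : F, x = u + s • v) → T.card ≤ k

variable {F : Type*} [Field F]

/-- A generic shear, which preserves incidences. -/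
noncomputable def genericShear (u : F × F × F) : RatFunc F × RatFunc F × RatFunc F :=
  (RatFunc.C u.1 + RatFunc.X * RatFunc.C u.2.1, RatFunc.C u.2.1, RatFunc.C u.2.2)

theorem RatFunc.C_add_X_mul_C_eq_zero {a b : F}
    (h : RatFunc.C a + RatFunc.X * RatFunc.C b = 0) : a = 0 ∧ b = 0 := by
  have h' : algebraMap (Polynomial F) (RatFunc F)
      (Polynomial.C a + Polynomial.X * Polynomial.C b) = 0 := by
    rw [map_add, map_mul, RatFunc.algebraMap_C, RatFunc.algebraMap_C, RatFunc.algebraMap_X]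
    exact h
  rw [map_eq_zero_iff _ (RatFunc.algebraMap_injective F)] at h'
  have h0 := congrArg (fun f => Polynomial.coeff f 0) h'
  have h1 := congrArg (fun f => Polynomial.coeff f 1) h'
  simp at h0 h1
  exact ⟨h0, h1⟩

theorem genericShear_injective : Function.Injective (genericShear (F := F)) := by
  intro u v h
  have h2 : u.2.1 = v.2.1 := RatFunc.C_injective (congrArg (fun z => z.2.1) h)
  have h3 : u.2.2 = v.2.2 := RatFunc.C_injective (congrArg (fun z => z.2.2) h)
  have h1 := congrArg (fun z => z.1) h
  simp only [genericShear, h2] at h1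
  exact Prod.ext (RatFunc.C_injective (add_right_cancel h1)) (Prod.ext h2 h3)

theorem meets_genericShear {u v : F × F × F} :
    Meets (genericShear u) (genericShear v) ↔ Meets u v := by
  simp only [Meets, genericShear]
  rw [← (RatFunc.C_injective (K := F)).eq_iff (a := u.2.1 * v.1 + u.2.2)]
  simp only [map_add, map_mul]
  constructor <;> intro h <;> linear_combination h

theorem incCount_image_genericShear (P Q : Finset (F × F × F)) :
    incCount (P.image genericShear) (Q.image genericShear) = incCount P Q := by
  rw [incCount_eq_sum, incCount_eq_sum, Finset.sum_image genericShear_injective.injOn]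
  refine Finset.sum_congr rfl fun u _ => ?_
  rw [Finset.filter_image, Finset.card_image_of_injective _ genericShear_injective]
  simp only [meets_genericShear]

theorem goodPosition_image_genericShear (P : Finset (F × F × F)) :
    GoodPosition (P.image genericShear) := by
  intro u hu v hv h
  obtain ⟨u, -, rfl⟩ := Finset.mem_image.1 hu
  obtain ⟨v, -, rfl⟩ := Finset.mem_image.1 hv
  have := RatFunc.C_add_X_mul_C_eq_zero (a := u.1 - v.1) (b := u.2.1 - v.2.1) (by
    simp only [genericShear] at h
    simp only [map_sub]
    linear_combination h)
  simp [genericShear, sub_eq_zero.1 this.2]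

theorem AffineLineBound.lineBound {P : Finset (F × F × F)} {k : ℕ} (h : AffineLineBound P k) :
    LineBound (P.image genericShear) k := by
  intro α β γ δ
  rw [Finset.filter_image, Finset.card_image_of_injective _ genericShear_injective]
  set S := P.filter fun a => (genericShear a).2.1 = γ + δ * (genericShear a).1 ∧
    (genericShear a).2.2 = α + β * (genericShear a).1 with hS
  have hSm : ∀ a ∈ S, a ∈ P ∧ RatFunc.C a.2.1 = γ + δ * (RatFunc.C a.1 + RatFunc.X * RatFunc.C a.2.1)
      ∧ RatFunc.C a.2.2 = α + β * (RatFunc.C a.1 + RatFunc.X * RatFunc.C a.2.1) :=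
    fun a ha => Finset.mem_filter.1 ha
  rcases S.eq_empty_or_nonempty with h0 | ⟨u, hu⟩
  · simp [h0]
  by_cases h1 : ∃ v ∈ S, v ≠ u
  · obtain ⟨v, hv, hvu⟩ := h1
    refine h u (v - u) (sub_ne_zero.2 hvu) S (Finset.filter_subset _ _) fun w hw => ?_
    obtain ⟨-, hw1, hw2⟩ := hSm w hw
    obtain ⟨-, hv1, hv2⟩ := hSm v hv
    obtain ⟨-, hu1, hu2⟩ := hSm u hu
    have e1 := RatFunc.C_add_X_mul_C_eq_zero
      (a := (w.2.1 - u.2.1) * (v.1 - u.1) - (v.2.1 - u.2.1) * (w.1 - u.1)) (b := 0) (by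
        simp only [map_sub, map_mul, map_zero]
        linear_combination (RatFunc.C v.1 + RatFunc.X * RatFunc.C v.2.1 -
          (RatFunc.C u.1 + RatFunc.X * RatFunc.C u.2.1)) * (hw1 - hu1) -
          (RatFunc.C w.1 + RatFunc.X * RatFunc.C w.2.1 -
          (RatFunc.C u.1 + RatFunc.X * RatFunc.C u.2.1)) * (hv1 - hu1))
    have e2 := RatFunc.C_add_X_mul_C_eq_zero
      (a := (w.2.2 - u.2.2) * (v.1 - u.1) - (v.2.2 - u.2.2) * (w.1 - u.1))
      (b := (w.2.2 - u.2.2) * (v.2.1 - u.2.1) - (v.2.2 - u.2.2) * (w.2.1 - u.2.1)) (by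
        simp only [map_sub, map_mul]
        linear_combination (RatFunc.C v.1 + RatFunc.X * RatFunc.C v.2.1 -
          (RatFunc.C u.1 + RatFunc.X * RatFunc.C u.2.1)) * (hw2 - hu2) -
          (RatFunc.C w.1 + RatFunc.X * RatFunc.C w.2.1 -
          (RatFunc.C u.1 + RatFunc.X * RatFunc.C u.2.1)) * (hv2 - hu2))
    by_cases hc : v.1 - u.1 = 0
    · by_cases hm : v.2.1 - u.2.1 = 0
      · exfalso
        rw [sub_eq_zero] at hc hm
        rw [hc, hm, ← hu2] at hv2
        exact hvu (Prod.ext hc (Prod.ext hm (RatFunc.C_injective hv2)))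
      · refine ⟨(w.2.1 - u.2.1) / (v.2.1 - u.2.1), ?_⟩
        refine Prod.ext ?_ (Prod.ext ?_ ?_)
        · simp only [Prod.fst_add, Prod.smul_fst, Prod.fst_sub, smul_eq_mul, hc]
          have := e1.1
          rw [hc, mul_zero, zero_sub, neg_eq_zero] at this
          have := (mul_eq_zero.1 this).resolve_left hm
          linear_combination this
        · simp only [Prod.fst_add, Prod.smul_fst, Prod.fst_sub, Prod.snd_add, Prod.smul_snd,
            Prod.snd_sub, smul_eq_mul]
          field_simp
          ring
        · simp only [Prod.snd_add, Prod.smul_snd, Prod.snd_sub, smul_eq_mul]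
          field_simp
          linear_combination e2.2
    · refine ⟨(w.1 - u.1) / (v.1 - u.1), ?_⟩
      refine Prod.ext ?_ (Prod.ext ?_ ?_)
      · simp only [Prod.fst_add, Prod.smul_fst, Prod.fst_sub, smul_eq_mul]
        field_simp
        ring
      · simp only [Prod.fst_add, Prod.smul_fst, Prod.fst_sub, Prod.snd_add, Prod.smul_snd,
          Prod.snd_sub, smul_eq_mul]
        field_simp
        linear_combination e1.1
      · simp only [Prod.snd_add, Prod.smul_snd, Prod.snd_sub, smul_eq_mul]
        field_simp
        linear_combination e2.1
  · push Not at h1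
    exact h u (1, 0, 0) (by simp) S (Finset.filter_subset _ _) fun w hw => ⟨0, by simp [h1 w hw]⟩

end Transfer

section PointPlane
variable {p : ℕ} [Fact p.Prime]

theorem card_meets_eq (u : ZMod p × ZMod p × ZMod p) :
    (Finset.univ.filter fun q => Meets u q).card = p ^ 2 := by
  rw [show p ^ 2 = (Finset.univ : Finset (ZMod p × ZMod p)).card by
    simp [ZMod.card, sq]]
  refine Finset.card_bij' (fun q _ => (q.1, q.2.1))
    (fun z _ => (z.1, z.2, u.2.1 * z.1 + u.2.2 - z.2 * u.1)) (by simp) ?_ ?_ (by simp)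
  · intro z _
    rw [Finset.mem_filter, Meets]
    exact ⟨Finset.mem_univ _, by ring⟩
  · intro q hq
    have := (Finset.mem_filter.1 hq).2
    simp only [Meets] at this
    refine Prod.ext rfl (Prod.ext rfl ?_)
    simp only
    linear_combination this

theorem card_meets_meets_le {u v : ZMod p × ZMod p × ZMod p} (huv : u ≠ v) :
    (Finset.univ.filter fun q => Meets u q ∧ Meets v q).card ≤ p := by
  have hp : p = (Finset.univ : Finset (ZMod p)).card := by simp [ZMod.card]
  by_cases hm : u.2.1 = v.2.1
  · by_cases hc : u.1 = v.1
    · rw [Finset.filter_false_of_mem]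
      · simp
      · rintro q - ⟨h1, h2⟩
        simp only [Meets] at h1 h2
        refine huv (Prod.ext hc (Prod.ext hm ?_))
        rw [hm, hc] at h1
        linear_combination h1 - h2
    · conv_rhs => rw [hp]
      refine Finset.card_le_card_of_injOn (fun q => q.1) (by simp) ?_
      intro q hq q' hq' h
      replace hq := (Finset.mem_filter.1 (Finset.mem_coe.1 hq)).2
      replace hq' := (Finset.mem_filter.1 (Finset.mem_coe.1 hq')).2
      simp only [Meets] at hq hq'
      simp only at h
      have h1 : q.2.1 = q'.2.1 := by
        apply mul_right_cancel₀ (sub_ne_zero.2 hc)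
        rw [h] at hq
        linear_combination hq.2 - hq.1 - hq'.2 + hq'.1
      refine Prod.ext h (Prod.ext h1 ?_)
      rw [h, h1] at hq
      linear_combination hq'.1 - hq.1
  · conv_rhs => rw [hp]
    refine Finset.card_le_card_of_injOn (fun q => q.2.1) (by simp) ?_
    intro q hq q' hq' h
    replace hq := (Finset.mem_filter.1 (Finset.mem_coe.1 hq)).2
    replace hq' := (Finset.mem_filter.1 (Finset.mem_coe.1 hq')).2
    simp only [Meets] at hq hq'
    simp only at h
    have h1 : q.1 = q'.1 := by
      apply mul_left_cancel₀ (sub_ne_zero.2 hm)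
      rw [h] at hq
      linear_combination hq.1 - hq.2 - hq'.1 + hq'.2
    refine Prod.ext h1 (Prod.ext h ?_)
    rw [h, h1] at hq
    linear_combination hq'.1 - hq.1

theorem incCount_sub_sq_le (P Q : Finset (ZMod p × ZMod p × ZMod p)) :
    ((incCount P Q : ℝ) - P.card * Q.card / p) ^ 2 ≤ P.card * Q.card * p ^ 2 := by
  have hp0 : (0 : ℝ) < p := by exact_mod_cast (Fact.out : p.Prime).pos
  let i : ZMod p × ZMod p × ZMod p → ℝ := fun q => ∑ u ∈ P, if Meets u q then 1 else 0
  have hI : (incCount P Q : ℝ) = ∑ q ∈ Q, i q := by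
    rw [incCount_eq_sum, Finset.sum_comm]
    push_cast
    exact Finset.sum_congr rfl fun u _ => by rw [Finset.card_filter]; push_cast; rfl
  have hsum : ∑ q, i q = P.card * p ^ 2 := by
    rw [Finset.sum_comm]
    have : ∀ u ∈ P, ∑ q, (if Meets u q then (1 : ℝ) else 0) = p ^ 2 := by
      intro u _
      rw [← Nat.cast_pow, ← card_meets_eq u, Finset.card_filter]
      push_cast; rfl
    rw [Finset.sum_congr rfl this, Finset.sum_const, nsmul_eq_mul]
  have hsq : ∑ q, i q ^ 2 ≤ P.card * p ^ 2 + P.card ^ 2 * p := by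
    have e : ∀ q, i q ^ 2 = ∑ u ∈ P, ∑ v ∈ P, if Meets u q ∧ Meets v q then (1 : ℝ) else 0 := by
      intro q
      rw [sq, Finset.sum_mul_sum]
      refine Finset.sum_congr rfl fun u _ => Finset.sum_congr rfl fun v _ => ?_
      by_cases h1 : Meets u q <;> by_cases h2 : Meets v q <;> simp [h1, h2]
    rw [Finset.sum_congr rfl fun q _ => e q, Finset.sum_comm]
    have : ∀ u ∈ P, ∑ q, ∑ v ∈ P, (if Meets u q ∧ Meets v q then (1 : ℝ) else 0) ≤
        p ^ 2 + P.card * p := by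
      intro u hu
      rw [Finset.sum_comm]
      have h : ∀ v ∈ P, ∑ q, (if Meets u q ∧ Meets v q then (1 : ℝ) else 0) ≤
          (if v = u then (p : ℝ) ^ 2 else 0) + p := by
        intro v _
        rw [show ∑ q, (if Meets u q ∧ Meets v q then (1 : ℝ) else 0) =
          ((Finset.univ.filter fun q => Meets u q ∧ Meets v q).card : ℝ) by
            rw [Finset.card_filter]; push_cast; rfl]
        split_ifs with h
        · subst h
          simp only [and_self]
          rw [card_meets_eq]
          push_cast
          linarith
        · have := card_meets_meets_le (Ne.symm h)
          rw [zero_add]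
          exact_mod_cast this
      refine (Finset.sum_le_sum h).trans ?_
      rw [Finset.sum_add_distrib, Finset.sum_ite_eq' P u, if_pos hu, Finset.sum_const,
        nsmul_eq_mul]
    refine (Finset.sum_le_sum this).trans ?_
    rw [Finset.sum_const, nsmul_eq_mul]
    exact le_of_eq (by ring)
  have hvar : ∑ q, (i q - P.card / p) ^ 2 ≤ P.card * p ^ 2 := by
    have e : ∀ q, (i q - P.card / p) ^ 2 = i q ^ 2 - 2 * (P.card / p) * i q + (P.card / p) ^ 2 :=
      fun q => by ring
    rw [Finset.sum_congr rfl fun q _ => e q, Finset.sum_add_distrib, Finset.sum_sub_distrib,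
      ← Finset.mul_sum, hsum, Finset.sum_const, nsmul_eq_mul]
    have hc : ((Finset.univ : Finset (ZMod p × ZMod p × ZMod p)).card : ℝ) = p ^ 3 := by
      simp [ZMod.card]; ring
    rw [hc]
    have : (p : ℝ) ^ 3 * ((P.card : ℝ) / p) ^ 2 = P.card ^ 2 * p := by field_simp
    rw [this]
    have : 2 * ((P.card : ℝ) / p) * (P.card * p ^ 2) = 2 * (P.card ^ 2 * p) := by field_simp
    rw [this]
    linarith
  have hd : (incCount P Q : ℝ) - P.card * Q.card / p = ∑ q ∈ Q, (i q - P.card / p) := by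
    rw [Finset.sum_sub_distrib, ← hI, Finset.sum_const, nsmul_eq_mul]
    ring
  rw [hd]
  refine sq_sum_le_card_mul_sum_sq.trans ?_
  have : ∑ q ∈ Q, (i q - P.card / p) ^ 2 ≤ P.card * p ^ 2 :=
    (Finset.sum_le_sum_of_subset_of_nonneg (Finset.subset_univ Q)
      fun _ _ _ => sq_nonneg _).trans hvar
  nlinarith [mul_le_mul_of_nonneg_left this (Nat.cast_nonneg (α := ℝ) Q.card)]

/-- Point-plane incidence bound. -/
theorem incCount_le {P Q : Finset (ZMod p × ZMod p × ZMod p)} {k N : ℕ} (hkP : AffineLineBound P k)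
    (hkQ : AffineLineBound Q k) (hP : P.card ≤ N) (hQ : Q.card ≤ N) :
    (incCount P Q : ℝ) ≤ P.card * Q.card / p + 408 * (N * √N + k * N) := by
  have hp0 : (0 : ℝ) < p := by exact_mod_cast (Fact.out : p.Prime).pos
  rcases Nat.eq_zero_or_pos N with rfl | hN
  · have : P = ∅ := Finset.card_eq_zero.1 (by omega)
    simp [incCount, this]
  have hN1 : (1 : ℝ) ≤ N := by exact_mod_cast hN
  have hs : (Nat.sqrt N : ℝ) ≤ √N := Real.nat_sqrt_le_real_sqrt
  have hs1 : 1 ≤ √(N : ℝ) := Real.one_le_sqrt.2 hN1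
  have hk0 : (0 : ℝ) ≤ k := Nat.cast_nonneg k
  by_cases hp : 17 * (Nat.sqrt N + 1) < p
  · have := incCount_le_of_goodPosition N (goodPosition_image_genericShear P)
      (goodPosition_image_genericShear Q) hkP.lineBound hkQ.lineBound
      (Finset.card_image_le.trans hP) (Finset.card_image_le.trans hQ) (fun m h1 h2 h3 => by
        have : CharP (RatFunc (ZMod p)) p :=
          charP_of_injective_algebraMap (algebraMap (ZMod p) (RatFunc (ZMod p))).injective p
        have := Nat.le_of_dvd h1 ((CharP.cast_eq_zero_iff (RatFunc (ZMod p)) p m).1 h3)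
        omega)
    rw [incCount_image_genericShear] at this
    have h' : (incCount P Q : ℝ) ≤ 4 * N * (51 * (Nat.sqrt N + 1) + k) := by exact_mod_cast this
    have h0 : (0 : ℝ) ≤ P.card * Q.card / p := by positivity
    have h2 : (4 : ℝ) * N * (51 * (Nat.sqrt N + 1) + k) ≤ 4 * N * (51 * (√N + √N) + k) := by
      gcongr
    nlinarith [mul_nonneg hk0 (Nat.cast_nonneg (α := ℝ) N)]
  · have hpN : (p : ℝ) ≤ 34 * √N := by
      have : (p : ℝ) ≤ 17 * (Nat.sqrt N + 1) := by exact_mod_cast not_lt.1 hp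
      linarith
    have h1 := incCount_sub_sq_le P Q
    have h2 : (P.card : ℝ) * Q.card * p ^ 2 ≤ (N * (34 * √N)) ^ 2 := by
      have e1 : (P.card : ℝ) ≤ N := by exact_mod_cast hP
      have e2 : (Q.card : ℝ) ≤ N := by exact_mod_cast hQ
      calc (P.card : ℝ) * Q.card * p ^ 2 ≤ N * N * (34 * √N) ^ 2 := by gcongr
        _ = _ := by ring
    have h3 := abs_le_of_sq_le_sq (h1.trans h2) (by positivity)
    have h4 := (abs_le.1 h3).2
    have h5 : 0 ≤ (k : ℝ) * N := by positivity
    have h6 : 0 ≤ (N : ℝ) * √N := by positivity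
    nlinarith

end PointPlane

section LineFamilies
variable {p : ℕ} [Fact p.Prime]

/-- At most `m` lines of the family have a given slope. -/
def SlopeBound (L : Finset (ZMod p × ZMod p)) (m : ℕ) : Prop :=
  ∀ a, ∀ T ⊆ L, (∀ l ∈ T, l.1 = a) → T.card ≤ m

/-- At most `M` lines of the family pass through a given point. -/
def PencilBound (L : Finset (ZMod p × ZMod p)) (M : ℕ) : Prop :=
  ∀ x y, ∀ T ⊆ L, (∀ l ∈ T, l.1 * x + l.2 = y) → T.card ≤ M

theorem card_collinear_le {L : Finset (ZMod p × ZMod p)} {m M : ℕ} (hm : SlopeBound L m)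
    (hM : PencilBound L M) (u v : ZMod p × ZMod p) {T : Finset (ZMod p × ZMod p)} (hTL : T ⊆ L)
    (hT : ∀ l ∈ T, ∃ s : ZMod p, l = u + s • v) : T.card ≤ m + M := by
  by_cases h : v.1 = 0
  · refine (hm u.1 T hTL fun l hl => ?_).trans (Nat.le_add_right m M)
    obtain ⟨s, rfl⟩ := hT l hl
    simp [h]
  · refine (hM (-v.2 / v.1) (u.1 * (-v.2 / v.1) + u.2) T hTL fun l hl => ?_).trans
      (Nat.le_add_left M m)
    obtain ⟨s, rfl⟩ := hT l hl
    simp only [Prod.fst_add, Prod.smul_fst, Prod.snd_add, Prod.smul_snd, smul_eq_mul]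
    field_simp
    ring

theorem affineLineBound_product (A : Finset (ZMod p)) {L : Finset (ZMod p × ZMod p)} {m M : ℕ}
    (hm : SlopeBound L m) (hM : PencilBound L M) :
    AffineLineBound (A ×ˢ L) (A.card + (m + M)) := by
  intro u v _ T hTL hT
  by_cases h : v.2 = 0
  · refine le_trans (Finset.card_le_card_of_injOn (t := A) (fun x => x.1) ?_ ?_)
      (Nat.le_add_right _ _)
    · intro x hx
      exact (Finset.mem_product.1 (hTL hx)).1
    · intro x hx y hy hxy
      obtain ⟨s, rfl⟩ := hT x hx
      obtain ⟨t, rfl⟩ := hT y hy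
      exact Prod.ext hxy (by simp [h])
  · have hinj : Set.InjOn (fun x : ZMod p × ZMod p × ZMod p => x.2) T := by
      intro x hx y hy hxy
      obtain ⟨s, rfl⟩ := hT x hx
      obtain ⟨t, rfl⟩ := hT y hy
      have : s • v.2 = t • v.2 := add_left_cancel (a := u.2) hxy
      rw [smul_left_injective (ZMod p) h this]
    rw [← Finset.card_image_of_injOn hinj]
    refine (card_collinear_le hm hM u.2 v.2 ?_ ?_).trans (Nat.le_add_left _ _)
    · intro l hl
      obtain ⟨x, hx, rfl⟩ := Finset.mem_image.1 hl
      exact (Finset.mem_product.1 (hTL hx)).2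
    · intro l hl
      obtain ⟨x, hx, rfl⟩ := Finset.mem_image.1 hl
      obtain ⟨s, rfl⟩ := hT x hx
      exact ⟨s, rfl⟩

/-- Number of points of `A × A` on a line. -/
noncomputable def hits (A : Finset (ZMod p)) (l : ZMod p × ZMod p) : ℕ := (A.filter fun x => l.1 * x + l.2 ∈ A).card

theorem hits_le (A : Finset (ZMod p)) (l : ZMod p × ZMod p) : hits A l ≤ A.card := Finset.card_filter_le _ _

theorem sum_card_filter_le (A T : Finset (ZMod p)) (S : Finset (ZMod p × ZMod p))
    (h : ∀ l ∈ S, ∀ l' ∈ S, ∀ x ∈ T, l.1 * x + l.2 = l'.1 * x + l'.2 → l = l') :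
    ∑ l ∈ S, (T.filter fun x => l.1 * x + l.2 ∈ A).card ≤ T.card * A.card := by
  simp only [Finset.card_filter]
  rw [Finset.sum_comm]
  refine (Finset.sum_le_card_nsmul _ _ A.card fun x hx => ?_).trans (le_of_eq (by simp))
  rw [← Finset.card_filter]
  refine Finset.card_le_card_of_injOn (fun l => l.1 * x + l.2) ?_ ?_
  · intro l hl
    exact (Finset.mem_filter.1 hl).2
  · intro l hl l' hl' hll
    exact h l (Finset.mem_filter.1 (Finset.mem_coe.1 hl)).1 l'
      (Finset.mem_filter.1 (Finset.mem_coe.1 hl')).1 x hx hll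

theorem card_parallel_mul_le {A : Finset (ZMod p)} {S : Finset (ZMod p × ZMod p)} {ρ : ℝ} {a : ZMod p}
    (hS : ∀ l ∈ S, l.1 = a ∧ ρ ≤ hits A l) : S.card * ρ ≤ (A.card : ℝ) ^ 2 := by
  have h := sum_card_filter_le A A S (fun l hl l' hl' x _ hx => by
    have e : l.1 = l'.1 := (hS l hl).1.trans (hS l' hl').1.symm
    rw [e] at hx
    exact Prod.ext e (add_left_cancel hx))
  calc S.card * ρ = ∑ l ∈ S, ρ := by rw [Finset.sum_const, nsmul_eq_mul]
    _ ≤ ∑ l ∈ S, (hits A l : ℝ) := Finset.sum_le_sum fun l hl => (hS l hl).2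
    _ ≤ (A.card : ℝ) ^ 2 := by
      rw [sq]
      exact_mod_cast h

theorem card_concurrent_mul_le {A : Finset (ZMod p)} {S : Finset (ZMod p × ZMod p)} {ρ : ℝ} (hρ : 2 ≤ ρ) {x y : ZMod p}
    (hS : ∀ l ∈ S, l.1 * x + l.2 = y ∧ ρ ≤ hits A l) : S.card * ρ ≤ 2 * (A.card : ℝ) ^ 2 := by
  have h := sum_card_filter_le A (A.erase x) S (fun l hl l' hl' z hz hzz => by
    have e := (hS l hl).1.trans (hS l' hl').1.symm
    have hzx : z - x ≠ 0 := sub_ne_zero.2 (Finset.ne_of_mem_erase hz)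
    have e1 : l.1 = l'.1 := mul_right_cancel₀ hzx (by linear_combination hzz - e)
    rw [e1] at e
    exact Prod.ext e1 (add_left_cancel e))
  have h2 : ∀ l ∈ S, ρ / 2 ≤ (((A.erase x).filter fun x => l.1 * x + l.2 ∈ A).card : ℝ) := by
    intro l hl
    have h3 : hits A l ≤ ((A.erase x).filter fun x => l.1 * x + l.2 ∈ A).card + 1 := by
      rw [Finset.filter_erase]
      have := Finset.pred_card_le_card_erase (s := A.filter fun x => l.1 * x + l.2 ∈ A) (a := x)
      rw [hits]
      omega
    have h4 : (hits A l : ℝ) ≤ (((A.erase x).filter fun x => l.1 * x + l.2 ∈ A).card : ℝ) + 1 := by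
      exact_mod_cast h3
    linarith [(hS l hl).2]
  have h5 : S.card * (ρ / 2) ≤ (A.card : ℝ) ^ 2 := by
    calc S.card * (ρ / 2) = ∑ l ∈ S, ρ / 2 := by rw [Finset.sum_const, nsmul_eq_mul]
      _ ≤ ∑ l ∈ S, (((A.erase x).filter fun x => l.1 * x + l.2 ∈ A).card : ℝ) :=
        Finset.sum_le_sum h2
      _ ≤ ((A.erase x).card : ℝ) * A.card := by exact_mod_cast h
      _ ≤ (A.card : ℝ) ^ 2 := by
        rw [sq]
        gcongr
        exact Finset.erase_subset _ _
  linarith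

end LineFamilies

section Correlation
variable {p : ℕ} [Fact p.Prime]

/-- Correlation of the balanced function with its composition with an affine map. -/
noncomputable def corr (A : Finset (ZMod p)) (l : ZMod p × ZMod p) : ℝ :=
  ∑ x, balanced A x * balanced A (l.1 * x + l.2)

/-- Lines with large correlation. -/
noncomputable def richLines (A : Finset (ZMod p)) (ρ : ℝ) : Finset (ZMod p × ZMod p) :=
  Finset.univ.filter fun l => l.1 ≠ 0 ∧ ρ ≤ corr A l

theorem mem_richLines {A : Finset (ZMod p)} {ρ : ℝ} {l : ZMod p × ZMod p} :
    l ∈ richLines A ρ ↔ l.1 ≠ 0 ∧ ρ ≤ corr A l := by simp [richLines]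

theorem prime_cast_pos : (0 : ℝ) < p := by exact_mod_cast (Fact.out : p.Prime).pos

theorem sum_balanced (A : Finset (ZMod p)) : ∑ x, balanced A x = 0 := by
  have := prime_cast_pos (p := p)
  simp only [balanced, Finset.sum_sub_distrib, Finset.sum_ite_mem, Finset.univ_inter,
    Finset.sum_const, Finset.card_univ, ZMod.card, nsmul_eq_mul]
  field_simp
  ring

theorem sum_affine {l : ZMod p × ZMod p} (hl : l.1 ≠ 0) (φ : ZMod p → ℝ) :
    ∑ x, φ (l.1 * x + l.2) = ∑ x, φ x :=
  Fintype.sum_bijective (fun x => l.1 * x + l.2)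
    (Finite.injective_iff_bijective.1 fun _ _ h =>
      mul_left_cancel₀ hl (add_right_cancel h)) _ _ fun _ => rfl

theorem corr_eq {A : Finset (ZMod p)} {l : ZMod p × ZMod p} (hl : l.1 ≠ 0) :
    corr A l = hits A l - (A.card : ℝ) ^ 2 / p := by
  have h1 : corr A l = ∑ x, (if x ∈ A then (1 : ℝ) else 0) * balanced A (l.1 * x + l.2) -
      (A.card : ℝ) / p * ∑ x, balanced A (l.1 * x + l.2) := by
    rw [Finset.mul_sum, ← Finset.sum_sub_distrib]
    exact Finset.sum_congr rfl fun x _ => by rw [balanced]; ring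
  rw [h1, sum_affine hl, sum_balanced, mul_zero, sub_zero]
  simp only [ite_mul, one_mul, zero_mul, Finset.sum_ite_mem, Finset.univ_inter]
  simp only [balanced, Finset.sum_sub_distrib, Finset.sum_const, nsmul_eq_mul]
  rw [hits, Finset.card_filter]
  push_cast
  ring

theorem corr_le_hits {A : Finset (ZMod p)} {l : ZMod p × ZMod p} (hl : l.1 ≠ 0) :
    corr A l ≤ hits A l := by
  rw [corr_eq hl]
  have : 0 ≤ (A.card : ℝ) ^ 2 / p := by positivity
  linarith

theorem corr_le_card {A : Finset (ZMod p)} {l : ZMod p × ZMod p} (hl : l.1 ≠ 0) :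
    corr A l ≤ A.card := (corr_le_hits hl).trans (by exact_mod_cast hits_le A l)

theorem sum_sq_balanced_le (A : Finset (ZMod p)) : ∑ x, balanced A x ^ 2 ≤ A.card := by
  have h := corr_le_card (A := A) (l := ((1 : ZMod p), 0)) one_ne_zero
  simp only [corr, one_mul, add_zero] at h
  simpa only [sq] using h

theorem card_richLines_sq_mul_le (A : Finset (ZMod p)) {ρ : ℝ} (hρ : 0 ≤ ρ)
    (L : Finset (ZMod p × ZMod p)) (hL : L ⊆ richLines A ρ) :
    (L.card * ρ) ^ 2 ≤ A.card * (incCount (A ×ˢ L) (A ×ˢ L) -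
      ((A ×ˢ L).card : ℝ) * (A ×ˢ L).card / p) := by
  have hp := prime_cast_pos (p := p)
  let ν : ZMod p → ℝ := fun y => ∑ z ∈ A ×ˢ L, if z.2.1 * z.1 + z.2.2 = y then 1 else 0
  have hν : ∑ y, ν y = (A ×ˢ L).card := by
    rw [Finset.sum_comm]
    simp
  have hν2 : ∑ y, ν y ^ 2 = incCount (A ×ˢ L) (A ×ˢ L) := by
    rw [incCount_eq_sum]
    simp only [ν, sq, Finset.sum_mul_sum]
    rw [Finset.sum_comm]
    push_cast
    have h1 : ∀ z ∈ A ×ˢ L, ∑ y, ∑ w ∈ A ×ˢ L, (if z.2.1 * z.1 + z.2.2 = y then (1 : ℝ) else 0) *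
        (if w.2.1 * w.1 + w.2.2 = y then 1 else 0) =
        ∑ w ∈ A ×ˢ L, if z.2.1 * z.1 + z.2.2 = w.2.1 * w.1 + w.2.2 then 1 else 0 := by
      intro z _
      rw [Finset.sum_comm]
      refine Finset.sum_congr rfl fun w _ => ?_
      simp [eq_comm]
    rw [Finset.sum_congr rfl h1]
    simp only [Finset.card_filter]
    push_cast
    simp only [Finset.sum_product, Meets]
    rw [Finset.sum_comm]
    have h2 : ∀ y ∈ L, ∑ x ∈ A, ∑ x' ∈ A, ∑ y' ∈ L,
        (if y.1 * x + y.2 = y'.1 * x' + y'.2 then (1 : ℝ) else 0) =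
        ∑ x' ∈ A, ∑ x ∈ A, ∑ y' ∈ L,
        (if y.1 * x + y.2 = y'.1 * x' + y'.2 then (1 : ℝ) else 0) :=
      fun y _ => Finset.sum_comm
    rw [Finset.sum_congr rfl h2, Finset.sum_comm]
    refine Finset.sum_congr rfl fun _ _ => Finset.sum_congr rfl fun _ _ =>
      Finset.sum_congr rfl fun _ _ => Finset.sum_congr rfl fun _ _ => 
        (ite_congr rfl (fun _ => rfl) fun _ => rfl).symm
  have hle : L.card * ρ ≤ ∑ y ∈ A, (ν y - (A ×ˢ L).card / p) := by
    have h1 : ∑ y ∈ A, ν y = ∑ l ∈ L, (hits A l : ℝ) := by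
      simp only [ν]
      rw [Finset.sum_comm, Finset.sum_product_right]
      refine Finset.sum_congr rfl fun l _ => ?_
      rw [hits, Finset.card_filter]
      push_cast
      refine Finset.sum_congr rfl fun x _ => ?_
      simp
    rw [Finset.sum_sub_distrib, h1, Finset.sum_const, nsmul_eq_mul, Finset.card_product]
    have h2 : ∑ l ∈ L, ρ ≤ ∑ l ∈ L, ((hits A l : ℝ) - (A.card : ℝ) ^ 2 / p) := by
      refine Finset.sum_le_sum fun l hl => ?_
      obtain ⟨h3, h4⟩ := mem_richLines.1 (hL hl)
      rwa [← corr_eq h3]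
    rw [Finset.sum_const, Finset.sum_sub_distrib, Finset.sum_const, nsmul_eq_mul,
      nsmul_eq_mul] at h2
    push_cast
    refine h2.trans (le_of_eq ?_)
    ring
  have h0 : 0 ≤ L.card * ρ := by positivity
  calc (L.card * ρ) ^ 2 ≤ (∑ y ∈ A, (ν y - (A ×ˢ L).card / p)) ^ 2 := by gcongr
    _ ≤ A.card * ∑ y ∈ A, (ν y - (A ×ˢ L).card / p) ^ 2 := sq_sum_le_card_mul_sum_sq
    _ ≤ A.card * ∑ y, (ν y - (A ×ˢ L).card / p) ^ 2 := by
      gcongr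
      exact Finset.subset_univ A
    _ = _ := by
      congr 1
      have e : ∀ y, (ν y - (A ×ˢ L).card / p) ^ 2 =
          ν y ^ 2 - 2 * ((A ×ˢ L).card / p) * ν y + ((A ×ˢ L).card / p : ℝ) ^ 2 :=
        fun y => by ring
      rw [Finset.sum_congr rfl fun y _ => e y, Finset.sum_add_distrib, Finset.sum_sub_distrib,
        ← Finset.mul_sum, hν, hν2, Finset.sum_const, Finset.card_univ, ZMod.card, nsmul_eq_mul]
      field_simp
      ring

end Correlation

section RichLines
variable {p : ℕ} [Fact p.Prime]

theorem card_filter_le_floor {ι : Type*} {S : Finset ι} {ρ x : ℝ} (hρ : 0 < ρ)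
    (h : S.card * ρ ≤ x) : S.card ≤ ⌊x / ρ⌋₊ :=
  Nat.le_floor ((le_div_iff₀ hρ).2 h)

/-- The number of lines with large correlation. -/
theorem card_richLines_mul_pow_le (A : Finset (ZMod p)) {ρ : ℝ} (hρ : 2 ≤ ρ) :
    (richLines A ρ).card * ρ ^ 4 ≤ 10 ^ 6 * (A.card : ℝ) ^ 5 := by
  have hρ0 : 0 < ρ := by linarith
  set L := richLines A ρ with hLdef
  set n : ℝ := (A.card : ℝ) with hn
  have hn0 : 0 ≤ n := Nat.cast_nonneg _
  rcases L.eq_empty_or_nonempty with h0 | ⟨l₀, hl₀⟩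
  · rw [h0]
    simp only [Finset.card_empty, Nat.cast_zero, zero_mul]
    positivity
  have hρn : ρ ≤ n := by
    obtain ⟨h1, h2⟩ := mem_richLines.1 hl₀
    exact h2.trans (corr_le_card h1)
  have hLpos : (0 : ℝ) < L.card := by exact_mod_cast Finset.card_pos.2 ⟨l₀, hl₀⟩
  have hhits : ∀ l ∈ L, ρ ≤ hits A l := fun l hl => by
    obtain ⟨h1, h2⟩ := mem_richLines.1 hl
    exact h2.trans (corr_le_hits h1)
  have hm : SlopeBound L ⌊n ^ 2 / ρ⌋₊ := fun a T hTL hT =>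
    card_filter_le_floor hρ0 (card_parallel_mul_le fun l hl => ⟨hT l hl, hhits l (hTL hl)⟩)
  have hM : PencilBound L ⌊2 * n ^ 2 / ρ⌋₊ := fun x y T hTL hT =>
    card_filter_le_floor hρ0 (card_concurrent_mul_le hρ fun l hl => ⟨hT l hl, hhits l (hTL hl)⟩)
  set k := A.card + (⌊n ^ 2 / ρ⌋₊ + ⌊2 * n ^ 2 / ρ⌋₊) with hk
  have hkb := affineLineBound_product A hm hM
  have hkρ : k * ρ ^ 2 ≤ 4 * n ^ 3 := by
    have e1 : (⌊n ^ 2 / ρ⌋₊ : ℝ) * ρ ≤ n ^ 2 :=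
      (le_div_iff₀ hρ0).1 (Nat.floor_le (by positivity))
    have e2 : (⌊2 * n ^ 2 / ρ⌋₊ : ℝ) * ρ ≤ 2 * n ^ 2 :=
      (le_div_iff₀ hρ0).1 (Nat.floor_le (by positivity))
    have e3 : ρ * ρ ≤ n * n := mul_le_mul hρn hρn hρ0.le hn0
    have e4 := mul_le_mul_of_nonneg_left e3 hn0
    have e5 := mul_le_mul e1 hρn hρ0.le (by positivity)
    have e6 := mul_le_mul e2 hρn hρ0.le (by positivity)
    rw [hk]
    push_cast
    nlinarith
  have h1 := card_richLines_sq_mul_le A hρ0.le L (le_refl L)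
  have h2 := incCount_le hkb hkb le_rfl le_rfl
  set N := (A ×ˢ L).card with hN
  have hNr : (N : ℝ) = n * L.card := by rw [hN, Finset.card_product]; push_cast; rfl
  have hkr : (0 : ℝ) ≤ k := Nat.cast_nonneg k
  have hsN := Real.sqrt_nonneg (N : ℝ)
  have h3 : (L.card * ρ) ^ 2 ≤ n * (408 * (N * √N + k * N)) :=
    h1.trans (mul_le_mul_of_nonneg_left (by linarith) hn0)
  have h4 : L.card * ρ ^ 2 ≤ 408 * n ^ 2 * (√N + k) := by
    refine le_of_mul_le_mul_left ?_ hLpos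
    calc (L.card : ℝ) * (L.card * ρ ^ 2) = (L.card * ρ) ^ 2 := by ring
      _ ≤ _ := h3
      _ = n * (408 * (N * (√N + k))) := by ring
      _ = n * (408 * ((n * L.card) * (√N + k))) := by rw [← hNr]
      _ = _ := by ring
  have hn5 : 0 ≤ n ^ 5 := by positivity
  rcases le_total (k : ℝ) (√N) with h | h
  · have h5 : L.card * ρ ^ 2 ≤ 816 * n ^ 2 * √N := h4.trans (by nlinarith [sq_nonneg n])
    have h6 : (L.card * ρ ^ 2) ^ 2 ≤ (816 * n ^ 2 * √N) ^ 2 := by gcongr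
    rw [mul_pow (816 * n ^ 2), Real.sq_sqrt (Nat.cast_nonneg _), hNr] at h6
    refine le_of_mul_le_mul_left ?_ hLpos
    nlinarith [mul_nonneg hLpos.le hn5]
  · have h5 : L.card * ρ ^ 2 ≤ 816 * n ^ 2 * k := h4.trans (by nlinarith [sq_nonneg n])
    calc L.card * ρ ^ 4 = L.card * ρ ^ 2 * ρ ^ 2 := by ring
      _ ≤ 816 * n ^ 2 * k * ρ ^ 2 := by gcongr
      _ = 816 * n ^ 2 * (k * ρ ^ 2) := by ring
      _ ≤ 816 * n ^ 2 * (4 * n ^ 3) := by gcongr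
      _ ≤ _ := by nlinarith

end RichLines

section AffineEnergy
variable {p : ℕ} [Fact p.Prime]

/-- The affine map `l' ∘ l⁻¹`. -/
def affQuot (l l' : ZMod p × ZMod p) : ZMod p × ZMod p := (l'.1 / l.1, l'.2 - l'.1 / l.1 * l.2)

/-- Number of coincidences between quotients of elements of `L`. -/
noncomputable def quotEnergy (L : Finset (ZMod p × ZMod p)) : ℕ :=
  (((L ×ˢ L) ×ˢ L ×ˢ L).filter fun z => affQuot z.1.1 z.1.2 = affQuot z.2.1 z.2.2).card

/-- Pairs with a given product of slopes, as points of the three-dimensional space. -/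
noncomputable def slopeClass (L : Finset (ZMod p × ZMod p)) (s : ZMod p) : Finset (ZMod p × ZMod p × ZMod p) :=
  ((L ×ˢ L).filter fun z => z.1.1 * z.2.1 = s).image fun z => (z.1.1, z.1.2, z.1.1 * z.2.2)

theorem quotEnergy_le_sum {L : Finset (ZMod p × ZMod p)} (hL : ∀ l ∈ L, l.1 ≠ 0) :
    quotEnergy L ≤ ∑ s, incCount (slopeClass L s) (slopeClass L s) := by
  rw [quotEnergy, Finset.card_eq_sum_card_fiberwise (f := fun z => z.1.2.1 * z.2.1.1)
    (t := Finset.univ) (by simp)]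
  refine Finset.sum_le_sum fun s _ => ?_
  rw [incCount]
  refine Finset.card_le_card_of_injOn
    (fun z => ((z.1.2.1, z.1.2.2, z.1.2.1 * z.2.1.2), (z.1.1.1, z.1.1.2, z.1.1.1 * z.2.2.2))) ?_ ?_
  · intro z hz
    obtain ⟨hz, hs⟩ := Finset.mem_filter.1 (Finset.mem_coe.1 hz)
    obtain ⟨hz, hq⟩ := Finset.mem_filter.1 hz
    simp only [Finset.mem_product] at hz
    obtain ⟨⟨m1, m2⟩, m3, m4⟩ := hz
    have n1 := hL _ m1
    have n3 := hL _ m3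
    have q1 := congrArg Prod.fst hq
    have q2 := congrArg Prod.snd hq
    simp only [affQuot] at q1 q2
    have e1 : z.1.2.1 * z.2.1.1 = z.2.2.1 * z.1.1.1 := by
      field_simp at q1
      linear_combination q1
    rw [Finset.mem_coe, Finset.mem_filter, Finset.mem_product, slopeClass]
    refine ⟨⟨Finset.mem_image.2 ⟨(z.1.2, z.2.1), Finset.mem_filter.2
      ⟨Finset.mem_product.2 ⟨m2, m3⟩, hs⟩, rfl⟩, Finset.mem_image.2 ⟨(z.1.1, z.2.2),
      Finset.mem_filter.2 ⟨Finset.mem_product.2 ⟨m1, m4⟩, ?_⟩, rfl⟩⟩, ?_⟩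
    · rw [← hs, e1, mul_comm]
    · simp only [Meets]
      rw [← q1] at q2
      field_simp at q2
      linear_combination q2
  · intro z hz w hw hzw
    obtain ⟨hz, hs⟩ := Finset.mem_filter.1 (Finset.mem_coe.1 hz)
    obtain ⟨hz, hq⟩ := Finset.mem_filter.1 hz
    obtain ⟨hw, hs'⟩ := Finset.mem_filter.1 (Finset.mem_coe.1 hw)
    obtain ⟨hw, hq'⟩ := Finset.mem_filter.1 hw
    simp only [Finset.mem_product] at hz hw
    obtain ⟨⟨m1, m2⟩, m3, m4⟩ := hz
    have n1 := hL _ m1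
    have n2 := hL _ m2
    have n3 := hL _ m3
    have n3' := hL _ hw.2.1
    have q1 := congrArg Prod.fst hq
    have q1' := congrArg Prod.fst hq'
    simp only [affQuot] at q1 q1'
    simp only [Prod.mk.injEq] at hzw
    obtain ⟨⟨a1, a2, a3⟩, b1, b2, b3⟩ := hzw
    rw [← a1] at hs' a3 q1'
    rw [← b1] at b3 q1'
    have c1 : z.2.1.1 = w.2.1.1 := mul_left_cancel₀ n2 (hs.trans hs'.symm)
    have c2 : z.2.1.2 = w.2.1.2 := mul_left_cancel₀ n2 a3
    have c4 : z.2.2.2 = w.2.2.2 := mul_left_cancel₀ n1 b3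
    rw [← c1] at q1' n3'
    have c3 : z.2.2.1 = w.2.2.1 := by
      rw [q1] at q1'
      field_simp at q1'
      exact q1'
    exact Prod.ext (Prod.ext (Prod.ext b1 b2) (Prod.ext a1 a2))
      (Prod.ext (Prod.ext c1 c2) (Prod.ext c3 c4))

theorem card_filter_slope_le {L : Finset (ZMod p × ZMod p)} (hL : ∀ l ∈ L, l.1 ≠ 0) {m : ℕ}
    (hm : SlopeBound L m) (s : ZMod p) :
    ((L ×ˢ L).filter fun z => z.1.1 * z.2.1 = s).card ≤ m * L.card := by
  rw [Finset.card_filter, Finset.sum_product]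
  refine (Finset.sum_le_card_nsmul _ _ m fun l hl => ?_).trans (le_of_eq (by simp [mul_comm]))
  rw [← Finset.card_filter]
  refine hm (s / l.1) _ (Finset.filter_subset _ _) fun l' hl' => ?_
  rw [eq_div_iff (hL l hl), mul_comm]
  exact (Finset.mem_filter.1 hl').2

theorem affineLineBound_slopeClass {L : Finset (ZMod p × ZMod p)} (hL : ∀ l ∈ L, l.1 ≠ 0) {m M : ℕ}
    (hm : SlopeBound L m)
    (hM : PencilBound L M) (s : ZMod p) :
    AffineLineBound (slopeClass L s) (m + M) := by
  intro u v _ T hTL hT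
  by_cases h : (v.1, v.2.1) = 0
  · obtain ⟨h1, h2⟩ := Prod.mk_eq_zero.1 h
    refine le_trans (Finset.card_le_card (t := (L.filter fun l => l.1 = s / u.1).image
      fun l => (u.1, u.2.1, u.1 * l.2)) ?_) (Finset.card_image_le.trans ((hm (s / u.1) _
        (Finset.filter_subset _ _) fun l hl => (Finset.mem_filter.1 hl).2).trans
        (Nat.le_add_right _ _)))
    intro x hx
    obtain ⟨t, hxt⟩ := hT x hx
    obtain ⟨z, hz, rfl⟩ := Finset.mem_image.1 (hTL hx)
    obtain ⟨hz, hzs⟩ := Finset.mem_filter.1 hz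
    obtain ⟨hz1, hz2⟩ := Finset.mem_product.1 hz
    have e1 : z.1.1 = u.1 := by simpa [h1] using congrArg Prod.fst hxt
    have e2 : z.1.2 = u.2.1 := by simpa [h2] using congrArg (fun x => x.2.1) hxt
    refine Finset.mem_image.2 ⟨z.2, Finset.mem_filter.2 ⟨hz2, ?_⟩, by rw [e1, e2]⟩
    rw [← e1, eq_div_iff (hL _ hz1), mul_comm]
    exact hzs
  · have hinj : Set.InjOn (fun x : ZMod p × ZMod p × ZMod p => (x.1, x.2.1)) T := by
      intro x hx y hy hxy
      obtain ⟨t, rfl⟩ := hT x hx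
      obtain ⟨t', rfl⟩ := hT y hy
      have : t • (v.1, v.2.1) = t' • (v.1, v.2.1) := add_left_cancel (a := (u.1, u.2.1)) hxy
      rw [smul_left_injective (ZMod p) h this]
    rw [← Finset.card_image_of_injOn hinj]
    refine card_collinear_le hm hM (u.1, u.2.1) (v.1, v.2.1) ?_ ?_
    · intro l hl
      obtain ⟨x, hx, rfl⟩ := Finset.mem_image.1 hl
      obtain ⟨z, hz, rfl⟩ := Finset.mem_image.1 (hTL hx)
      exact (Finset.mem_product.1 (Finset.mem_filter.1 hz).1).1
    · intro l hl
      obtain ⟨x, hx, rfl⟩ := Finset.mem_image.1 hl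
      obtain ⟨t, hxt⟩ := hT x hx
      exact ⟨t, congrArg (fun x : ZMod p × ZMod p × ZMod p => (x.1, x.2.1)) hxt⟩

theorem quotEnergy_le {L : Finset (ZMod p × ZMod p)}
    (hL : ∀ l ∈ L, l.1 ≠ 0) {m M : ℕ} (hm : SlopeBound L m)
    (hM : PencilBound L M) :
    (quotEnergy L : ℝ) ≤ m * (L.card : ℝ) ^ 3 / p +
      408 * ((L.card : ℝ) ^ 2 * √(m * L.card) + (m + M) * (L.card : ℝ) ^ 2) := by
  have hp := prime_cast_pos (p := p)
  have h1 : ∀ s, ((slopeClass L s).card : ℝ) ≤ m * L.card := fun s => by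
    exact_mod_cast Finset.card_image_le.trans (card_filter_slope_le hL hm s)
  have h2 : ∑ s, ((slopeClass L s).card : ℝ) ≤ (L.card : ℝ) ^ 2 := by
    have : ∑ s, (slopeClass L s).card ≤ L.card ^ 2 := by
      refine (Finset.sum_le_sum fun s _ => Finset.card_image_le).trans ?_
      rw [← Finset.card_eq_sum_card_fiberwise (by simp), Finset.card_product, sq]
    exact_mod_cast this
  have h3 : ∀ s, (incCount (slopeClass L s) (slopeClass L s) : ℝ) ≤
      (m * L.card / p + 408 * (√(m * L.card) + (m + M))) * (slopeClass L s).card := by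
    intro s
    have hb := affineLineBound_slopeClass hL hm hM s
    have hs := incCount_le hb hb le_rfl le_rfl
    refine hs.trans ?_
    have e1 : √((slopeClass L s).card : ℝ) ≤ √(m * L.card) := Real.sqrt_le_sqrt (h1 s)
    push_cast
    calc ((slopeClass L s).card : ℝ) * (slopeClass L s).card / p +
        408 * ((slopeClass L s).card * √(slopeClass L s).card + (m + M) * (slopeClass L s).card)
        = ((slopeClass L s).card / p + 408 * (√(slopeClass L s).card + (m + M))) *
          (slopeClass L s).card := by ring
      _ ≤ _ := by
        gcongr
        exact h1 s
  have h4 : (quotEnergy L : ℝ) ≤ ∑ s, (incCount (slopeClass L s) (slopeClass L s) : ℝ) := by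
    exact_mod_cast quotEnergy_le_sum hL
  refine h4.trans ((Finset.sum_le_sum fun s _ => h3 s).trans ?_)
  rw [← Finset.mul_sum]
  refine (mul_le_mul_of_nonneg_left h2 (by positivity)).trans (le_of_eq ?_)
  ring

end AffineEnergy

section Energies
variable {p : ℕ} [Fact p.Prime]

theorem addEfun_eq_sum_sq (f : ZMod p → ℝ) :
    addEfun f = ∑ d, (∑ y, f y * f (y + d)) ^ 2 := by
  have h1 : addEfun f = ∑ y, ∑ d, ∑ w, f (y + d) * f y * f (w + d) * f w := by
    rw [addEfun, Finset.sum_comm]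
    refine Finset.sum_congr rfl fun y _ => ?_
    rw [← Equiv.sum_comp (Equiv.addLeft y)]
    refine Finset.sum_congr rfl fun d _ => ?_
    rw [Finset.sum_comm]
    refine Finset.sum_congr rfl fun w _ => ?_
    rw [Finset.sum_eq_single (w + d)]
    · simp
    · intro z _ hz
      refine if_neg fun h => hz ?_
      simp only [Equiv.coe_addLeft, add_sub_cancel_left] at h
      rw [h]
      ring
    · simp
  rw [h1, Finset.sum_comm]
  refine Finset.sum_congr rfl fun d _ => ?_
  rw [sq, Finset.sum_mul_sum]
  refine Finset.sum_congr rfl fun y _ => Finset.sum_congr rfl fun w _ => ?_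
  ring

theorem addEfun_nonneg (f : ZMod p → ℝ) : 0 ≤ addEfun f := by
  rw [addEfun_eq_sum_sq]
  positivity

theorem sum_mul_le_of_sum_sq_le {ι : Type*} [Fintype ι] (F G : ι → ℝ) {B : ℝ}
    (hF : ∑ i, F i ^ 2 ≤ B) (hG : ∑ i, G i ^ 2 ≤ B) : ∑ i, F i * G i ≤ B := by
  have h : ∑ i, F i * G i ≤ ∑ i, (F i ^ 2 / 2 + G i ^ 2 / 2) :=
    Finset.sum_le_sum fun i _ => by nlinarith [sq_nonneg (F i - G i)]
  rw [Finset.sum_add_distrib, ← Finset.sum_div, ← Finset.sum_div] at h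
  linarith

theorem sum_sq_parallel_le (f : ZMod p → ℝ) {a : ZMod p} (ha : a ≠ 0) :
    ∑ b, (∑ x, f x * f (a * x + b)) ^ 2 ≤ addEfun f := by
  have h1 : ∑ b, (∑ x, f x * f (a * x + b)) ^ 2 =
      ∑ d, (∑ y, f y * f (y + d)) * ∑ y, f y * f (y + a * d) := by
    have h2 : ∀ b, (∑ x, f x * f (a * x + b)) ^ 2 =
        ∑ x, ∑ d, f x * f (x + d) * (f (a * x + b) * f (a * x + b + a * d)) := by
      intro b
      rw [sq, Finset.sum_mul_sum]
      refine Finset.sum_congr rfl fun x _ => ?_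
      rw [← Equiv.sum_comp (Equiv.addLeft x)]
      refine Finset.sum_congr rfl fun d _ => ?_
      have : a * (x + d) + b = a * x + b + a * d := by ring
      simp only [Equiv.coe_addLeft, this]
      ring
    rw [Finset.sum_congr rfl fun b _ => h2 b, Finset.sum_comm]
    have h3 : ∀ x, ∑ b, ∑ d, f x * f (x + d) * (f (a * x + b) * f (a * x + b + a * d)) =
        ∑ d, f x * f (x + d) * ∑ y, f y * f (y + a * d) := by
      intro x
      rw [Finset.sum_comm]
      refine Finset.sum_congr rfl fun d _ => ?_
      rw [← Finset.mul_sum, ← Equiv.sum_comp (Equiv.addLeft (a * x)) fun y => f y * f (y + a * d)]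
      rfl
    rw [Finset.sum_congr rfl fun x _ => h3 x, Finset.sum_comm]
    exact Finset.sum_congr rfl fun d _ => (Finset.sum_mul _ _ _).symm
  rw [h1]
  refine sum_mul_le_of_sum_sq_le _ _ (addEfun_eq_sum_sq f).ge ?_
  rw [addEfun_eq_sum_sq]
  exact (Equiv.sum_comp (Equiv.mulLeft₀ a ha) fun d => (∑ y, f y * f (y + d)) ^ 2).le

/-- The function with its value at zero deleted. -/
def puncture (g : ZMod p → ℝ) : ZMod p → ℝ := fun x => if x = 0 then 0 else g x

theorem mulEfun_puncture_le (g : ZMod p → ℝ) : mulEfun (puncture g) ≤ mulEfun g := by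
  have h1 : mulEfun g = mulEfun (puncture g) +
      (∑ x, ∑ w, if x * w = 0 then g x * g w else 0) ^ 2 := by
    have h2 : (∑ x, ∑ w, if x * w = 0 then g x * g w else 0) ^ 2 =
        ∑ x, ∑ y, ∑ z, ∑ w, (if x * w = 0 then g x * g w else 0) *
          (if z * y = 0 then g z * g y else 0) := by
      rw [sq, Finset.sum_mul]
      refine Finset.sum_congr rfl fun x _ => ?_
      rw [Finset.mul_sum]
      rw [Finset.sum_comm]
      refine Finset.sum_congr rfl fun z _ => ?_
      rw [Finset.sum_mul_sum, Finset.sum_comm]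
    rw [h2, mulEfun, mulEfun]
    simp only [← Finset.sum_add_distrib]
    refine Finset.sum_congr rfl fun x _ => Finset.sum_congr rfl fun y _ =>
      Finset.sum_congr rfl fun z _ => Finset.sum_congr rfl fun w _ => ?_
    simp only [puncture]
    by_cases hx : x = 0 <;> by_cases hy : y = 0 <;> by_cases hz : z = 0 <;>
      by_cases hw : w = 0 <;> simp [hx, hy, hz, hw] <;> ring
  rw [h1]
  nlinarith [sq_nonneg (∑ x, ∑ w, if x * w = 0 then g x * g w else 0)]

theorem mulEfun_eq_sum_sq {g : ZMod p → ℝ} (hg : g 0 = 0) :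
    mulEfun g = ∑ r, (∑ y, g y * g (r * y)) ^ 2 := by
  have h1 : mulEfun g = ∑ y, ∑ r, ∑ w, g (r * y) * g y * g (r * w) * g w := by
    rw [mulEfun, Finset.sum_comm]
    refine Finset.sum_congr rfl fun y _ => ?_
    by_cases hy : y = 0
    · simp [hy, hg]
    rw [← Equiv.sum_comp (Equiv.mulRight₀ y hy)]
    refine Finset.sum_congr rfl fun r _ => ?_
    rw [Finset.sum_comm]
    refine Finset.sum_congr rfl fun w _ => ?_
    rw [Finset.sum_eq_single (r * w)]
    · rw [if_pos]
      · rfl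
      · simp only [Equiv.mulRight₀_apply]
        ring
    · intro z _ hz
      refine if_neg fun h => hz (mul_right_cancel₀ hy ?_)
      simp only [Equiv.mulRight₀_apply] at h
      rw [← h]
      ring
    · simp
  rw [h1, Finset.sum_comm]
  refine Finset.sum_congr rfl fun d _ => ?_
  rw [sq, Finset.sum_mul_sum]
  refine Finset.sum_congr rfl fun y _ => Finset.sum_congr rfl fun w _ => ?_
  ring

theorem sum_sq_concurrent_le {g h : ZMod p → ℝ} (hg : g 0 = 0) (hh : h 0 = 0) {B : ℝ}
    (hgB : mulEfun g ≤ B) (hhB : mulEfun h ≤ B) :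
    ∑ a, (∑ x, g x * h (a * x)) ^ 2 ≤ B := by
  have h1 : ∑ a, (∑ x, g x * h (a * x)) ^ 2 =
      ∑ r, (∑ y, g y * g (r * y)) * ∑ y, h y * h (r * y) := by
    have h2 : ∀ a, (∑ x, g x * h (a * x)) ^ 2 =
        ∑ x, ∑ r, g x * g (r * x) * (h (a * x) * h (r * (a * x))) := by
      intro a
      rw [sq, Finset.sum_mul_sum]
      refine Finset.sum_congr rfl fun x _ => ?_
      by_cases hx : x = 0
      · simp [hx, hg]
      rw [← Equiv.sum_comp (Equiv.mulRight₀ x hx)]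
      refine Finset.sum_congr rfl fun r _ => ?_
      have : a * (r * x) = r * (a * x) := by ring
      simp only [Equiv.mulRight₀_apply, this]
      ring
    rw [Finset.sum_congr rfl fun b _ => h2 b, Finset.sum_comm]
    have h3 : ∀ x, ∑ a, ∑ r, g x * g (r * x) * (h (a * x) * h (r * (a * x))) =
        ∑ r, g x * g (r * x) * ∑ y, h y * h (r * y) := by
      intro x
      by_cases hx : x = 0
      · simp [hx, hg]
      rw [Finset.sum_comm]
      refine Finset.sum_congr rfl fun r _ => ?_
      rw [← Finset.mul_sum, ← Equiv.sum_comp (Equiv.mulRight₀ x hx) fun y => h y * h (r * y)]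
      rfl
    rw [Finset.sum_congr rfl fun x _ => h3 x, Finset.sum_comm]
    exact Finset.sum_congr rfl fun d _ => (Finset.sum_mul _ _ _).symm
  rw [h1]
  exact sum_mul_le_of_sum_sq_le _ _ ((mulEfun_eq_sum_sq hg).ge.trans hgB)
    ((mulEfun_eq_sum_sq hh).ge.trans hhB)

theorem mulEfun_le_mulEbarFun (f : ZMod p → ℝ) (s : ZMod p) :
    mulEfun (puncture fun x => f (x + s)) ≤ mulEbarFun f :=
  (mulEfun_puncture_le _).trans
    (le_ciSup (f := fun s : ZMod p => mulEfun fun x => f (x + s)) (Set.finite_range _).bddAbove s)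

theorem mulEbarFun_nonneg (f : ZMod p → ℝ) : 0 ≤ mulEbarFun f := by
  refine le_trans ?_ (mulEfun_le_mulEbarFun f 0)
  rw [mulEfun_eq_sum_sq (by simp [puncture])]
  positivity

theorem abs_balanced_le (A : Finset (ZMod p)) (x : ZMod p) : |balanced A x| ≤ 1 := by
  have hp := prime_cast_pos (p := p)
  have h1 : (A.card : ℝ) / p ≤ 1 := by
    rw [div_le_one hp]
    exact_mod_cast (Finset.card_le_univ A).trans_eq (ZMod.card p)
  have h0 : 0 ≤ (A.card : ℝ) / p := by positivity
  rw [balanced, abs_le]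
  split_ifs <;> constructor <;> linarith

theorem card_richLines_slope_le (A : Finset (ZMod p)) {τ : ℝ} (hτ : 0 ≤ τ) (a : ZMod p)
    {T : Finset (ZMod p × ZMod p)} (hT : T ⊆ richLines A τ) (ha : ∀ l ∈ T, l.1 = a) :
    T.card * τ ^ 2 ≤ addEfun (balanced A) := by
  rcases T.eq_empty_or_nonempty with rfl | ⟨l₀, hl₀⟩
  · simpa using addEfun_nonneg _
  have ha0 : a ≠ 0 := ha l₀ hl₀ ▸ (mem_richLines.1 (hT hl₀)).1
  have hinj : Set.InjOn (fun l : ZMod p × ZMod p => l.2) T := fun l hl l' hl' h =>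
    Prod.ext ((ha l hl).trans (ha l' hl').symm) h
  calc T.card * τ ^ 2 = ∑ l ∈ T, τ ^ 2 := by rw [Finset.sum_const, nsmul_eq_mul]
    _ ≤ ∑ l ∈ T, (∑ x, balanced A x * balanced A (a * x + l.2)) ^ 2 := by
      refine Finset.sum_le_sum fun l hl => ?_
      have := (mem_richLines.1 (hT hl)).2
      rw [corr, ha l hl] at this
      gcongr
    _ = ∑ b ∈ T.image fun l => l.2, (∑ x, balanced A x * balanced A (a * x + b)) ^ 2 :=
      by rw [Finset.sum_image hinj]
    _ ≤ ∑ b, (∑ x, balanced A x * balanced A (a * x + b)) ^ 2 :=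
      Finset.sum_le_sum_of_subset_of_nonneg (Finset.subset_univ _) fun _ _ _ => sq_nonneg _
    _ ≤ _ := sum_sq_parallel_le _ ha0

theorem card_richLines_pencil_le (A : Finset (ZMod p)) {τ : ℝ} (hτ : 2 ≤ τ) (x y : ZMod p)
    {T : Finset (ZMod p × ZMod p)} (hT : T ⊆ richLines A τ) (hxy : ∀ l ∈ T, l.1 * x + l.2 = y) :
    T.card * τ ^ 2 ≤ 4 * mulEbarFun (balanced A) := by
  set g := puncture fun t => balanced A (t + x)
  set h := puncture fun t => balanced A (t + y)
  have hinj : Set.InjOn (fun l : ZMod p × ZMod p => l.1) T := fun l hl l' hl' e => by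
    have e1 : l.1 = l'.1 := e
    have e2 := (hxy l hl).trans (hxy l' hl').symm
    rw [e1] at e2
    exact Prod.ext e1 (add_left_cancel e2)
  have key : T.card * (τ / 2) ^ 2 ≤ mulEbarFun (balanced A) := by
    calc T.card * (τ / 2) ^ 2 = ∑ l ∈ T, (τ / 2) ^ 2 := by rw [Finset.sum_const, nsmul_eq_mul]
      _ ≤ ∑ l ∈ T, (∑ t, g t * h (l.1 * t)) ^ 2 := by
        refine Finset.sum_le_sum fun l hl => ?_
        obtain ⟨h0, h1⟩ := mem_richLines.1 (hT hl)
        have e1 : corr A l = ∑ t, balanced A (t + x) * balanced A (l.1 * t + y) := by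
          rw [corr, ← Equiv.sum_comp (Equiv.addRight x)]
          refine Finset.sum_congr rfl fun t _ => ?_
          rw [← hxy l hl]
          simp only [Equiv.coe_addRight]
          congr 2
          ring
        have e2 : ∑ t, balanced A (t + x) * balanced A (l.1 * t + y) =
            balanced A x * balanced A y + ∑ t, g t * h (l.1 * t) := by
          rw [← Finset.add_sum_erase _ _ (Finset.mem_univ (0 : ZMod p)),
            ← Finset.add_sum_erase _ (fun t => g t * h (l.1 * t)) (Finset.mem_univ (0 : ZMod p))]
          simp only [zero_add, mul_zero, g, h, puncture, if_true]
          congr 1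
          refine Finset.sum_congr rfl fun t ht => ?_
          have ht0 := Finset.ne_of_mem_erase ht
          rw [if_neg ht0, if_neg (mul_ne_zero h0 ht0)]
        have e3 : balanced A x * balanced A y ≤ 1 := by
          refine (le_abs_self _).trans ?_
          rw [abs_mul]
          exact mul_le_one₀ (abs_balanced_le A x) (abs_nonneg _) (abs_balanced_le A y)
        gcongr
        linarith
      _ = ∑ a ∈ T.image fun l => l.1, (∑ t, g t * h (a * t)) ^ 2 :=
        by rw [Finset.sum_image hinj]
      _ ≤ ∑ a, (∑ t, g t * h (a * t)) ^ 2 :=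
        Finset.sum_le_sum_of_subset_of_nonneg (Finset.subset_univ _) fun _ _ _ => sq_nonneg _
      _ ≤ _ := sum_sq_concurrent_le (by simp [g, puncture]) (by simp [h, puncture])
          (mulEfun_le_mulEbarFun _ x) (mulEfun_le_mulEbarFun _ y)
  nlinarith

end Energies

section Dyadic

theorem pow_le_dyadic_sum {e ρ : ℝ} (hρ : 0 < ρ) (k : ℕ) (he : ρ ≤ e) (J : ℕ)
    (hJ : e < 2 ^ J * ρ) :
    e ^ k ≤ ∑ j ∈ Finset.range J, if 2 ^ j * ρ ≤ e then (2 ^ (j + 1) * ρ) ^ k else 0 := by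
  induction J with
  | zero => simp at hJ; linarith
  | succ J ih =>
    rw [Finset.sum_range_succ]
    by_cases h : e < 2 ^ J * ρ
    · exact (ih h).trans (le_add_of_nonneg_right (by split_ifs <;> positivity))
    · rw [if_pos (not_lt.1 h)]
      refine (pow_le_pow_left₀ (hρ.le.trans he) hJ.le k).trans (le_add_of_nonneg_left ?_)
      exact Finset.sum_nonneg fun j _ => by split_ifs <;> positivity

theorem dyadic_sum_le {ι : Type*} (S : Finset ι) (e : ι → ℝ) {ρ₀ B : ℝ} (hρ₀ : 0 < ρ₀) (k J : ℕ)
    (hJ : ∀ i ∈ S, e i < 2 ^ J * ρ₀)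
    (hB : ∀ ρ, ρ₀ ≤ ρ → ρ ^ k * (S.filter fun i => ρ ≤ e i).card ≤ B) :
    ∑ i ∈ S.filter (fun i => ρ₀ ≤ e i), e i ^ k ≤ J * (2 ^ k * B) := by
  calc ∑ i ∈ S.filter (fun i => ρ₀ ≤ e i), e i ^ k
      ≤ ∑ i ∈ S.filter (fun i => ρ₀ ≤ e i),
          ∑ j ∈ Finset.range J, if 2 ^ j * ρ₀ ≤ e i then (2 ^ (j + 1) * ρ₀) ^ k else 0 :=
        Finset.sum_le_sum fun i hi => pow_le_dyadic_sum hρ₀ k (Finset.mem_filter.1 hi).2 J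
          (hJ i (Finset.mem_filter.1 hi).1)
    _ ≤ ∑ i ∈ S,
          ∑ j ∈ Finset.range J, if 2 ^ j * ρ₀ ≤ e i then (2 ^ (j + 1) * ρ₀) ^ k else 0 :=
        Finset.sum_le_sum_of_subset_of_nonneg (Finset.filter_subset _ _) fun i _ _ =>
          Finset.sum_nonneg fun j _ => by split_ifs <;> positivity
    _ = ∑ j ∈ Finset.range J, 2 ^ k *
          ((2 ^ j * ρ₀) ^ k * (S.filter fun i => 2 ^ j * ρ₀ ≤ e i).card) := by
        rw [Finset.sum_comm]
        refine Finset.sum_congr rfl fun j _ => ?_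
        rw [← Finset.sum_filter, Finset.sum_const, nsmul_eq_mul]
        ring
    _ ≤ ∑ j ∈ Finset.range J, 2 ^ k * B := by
        refine Finset.sum_le_sum fun j _ => ?_
        gcongr
        refine hB _ (le_mul_of_one_le_left hρ₀.le (one_le_pow₀ one_le_two))
    _ = J * (2 ^ k * B) := by simp

end Dyadic

section EnergyOfRichLines
variable {p : ℕ} [Fact p.Prime]

theorem affQuot_apply {l : ZMod p × ZMod p} (hl : l.1 ≠ 0) (l' : ZMod p × ZMod p) (x : ZMod p) :
    (affQuot l l').1 * (l.1 * x + l.2) + (affQuot l l').2 = l'.1 * x + l'.2 := by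
  simp only [affQuot]
  field_simp
  ring

theorem sum_mul_eq_corr (A : Finset (ZMod p)) {l : ZMod p × ZMod p} (hl : l.1 ≠ 0)
    (l' : ZMod p × ZMod p) :
    ∑ x, balanced A (l.1 * x + l.2) * balanced A (l'.1 * x + l'.2) = corr A (affQuot l l') := by
  rw [corr, ← sum_affine hl fun x =>
    balanced A x * balanced A ((affQuot l l').1 * x + (affQuot l l').2)]
  exact Finset.sum_congr rfl fun x _ => by rw [affQuot_apply hl]

theorem card_sq_mul_le_sum_corr (A : Finset (ZMod p)) {τ : ℝ} (hτ : 0 ≤ τ) :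
    ((richLines A τ).card * τ) ^ 2 ≤
      A.card * ∑ z ∈ richLines A τ ×ˢ richLines A τ, corr A (affQuot z.1 z.2) := by
  set L := richLines A τ
  have h1 : L.card * τ ≤ ∑ x, balanced A x * ∑ l ∈ L, balanced A (l.1 * x + l.2) := by
    calc L.card * τ = ∑ l ∈ L, τ := by rw [Finset.sum_const, nsmul_eq_mul]
      _ ≤ ∑ l ∈ L, corr A l := Finset.sum_le_sum fun l hl => (mem_richLines.1 hl).2
      _ = _ := by
        simp only [corr, Finset.mul_sum]
        rw [Finset.sum_comm]
  have h2 : ∑ x, (∑ l ∈ L, balanced A (l.1 * x + l.2)) ^ 2 =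
      ∑ z ∈ L ×ˢ L, corr A (affQuot z.1 z.2) := by
    simp only [sq, Finset.sum_mul_sum]
    rw [Finset.sum_comm, Finset.sum_product]
    refine Finset.sum_congr rfl fun l hl => ?_
    rw [Finset.sum_comm]
    exact Finset.sum_congr rfl fun l' _ => sum_mul_eq_corr A (mem_richLines.1 hl).1 l'
  calc (L.card * τ) ^ 2 ≤ (∑ x, balanced A x * ∑ l ∈ L, balanced A (l.1 * x + l.2)) ^ 2 := by
        gcongr
    _ ≤ (∑ x, balanced A x ^ 2) * ∑ x, (∑ l ∈ L, balanced A (l.1 * x + l.2)) ^ 2 :=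
        Finset.sum_mul_sq_le_sq_mul_sq _ _ _
    _ ≤ _ := by
        rw [h2.symm]
        gcongr
        exact sum_sq_balanced_le A

theorem card_affQuot_sq_le (L K : Finset (ZMod p × ZMod p)) :
    (((L ×ˢ L).filter fun z => affQuot z.1 z.2 ∈ K).card) ^ 2 ≤ K.card * quotEnergy L := by
  set R := (L ×ˢ L).filter fun z => affQuot z.1 z.2 ∈ K
  have h1 : R.card = ∑ k ∈ K, (R.filter fun z => affQuot z.1 z.2 = k).card :=
    Finset.card_eq_sum_card_fiberwise fun z hz => (Finset.mem_filter.1 hz).2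
  have h2 : ∑ k ∈ K, (R.filter fun z => affQuot z.1 z.2 = k).card ^ 2 ≤ quotEnergy L := by
    have h3 : ∀ k, (R.filter fun z => affQuot z.1 z.2 = k).card ^ 2 =
        ((R ×ˢ R).filter fun z => affQuot z.1.1 z.1.2 = k ∧ affQuot z.2.1 z.2.2 = k).card := by
      intro k
      rw [sq, ← Finset.card_product]
      congr 1
      ext z
      simp only [Finset.mem_product, Finset.mem_filter]
      tauto
    rw [Finset.sum_congr rfl fun k _ => h3 k, ← Finset.card_biUnion]
    · refine Finset.card_le_card fun z hz => ?_
      obtain ⟨k, _, hk⟩ := Finset.mem_biUnion.1 hz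
      obtain ⟨h4, h5, h6⟩ := Finset.mem_filter.1 hk
      obtain ⟨h7, h8⟩ := Finset.mem_product.1 h4
      exact Finset.mem_filter.2 ⟨Finset.mem_product.2
        ⟨(Finset.mem_filter.1 h7).1, (Finset.mem_filter.1 h8).1⟩, h5.trans h6.symm⟩
    · intro k _ k' _ hkk
      refine Finset.disjoint_left.2 fun z hz hz' => hkk ?_
      exact (Finset.mem_filter.1 hz).2.1.symm.trans (Finset.mem_filter.1 hz').2.1
  rw [h1]
  exact sq_sum_le_card_mul_sum_sq.trans (Nat.mul_le_mul_left _ h2)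

theorem card_affQuot_richLines_le (A : Finset (ZMod p)) {L : Finset (ZMod p × ZMod p)}
    (hL : ∀ l ∈ L, l.1 ≠ 0) {ρ : ℝ} (hρ : 2 ≤ ρ) :
    (ρ * ((L ×ˢ L).filter fun z => ρ ≤ corr A (affQuot z.1 z.2)).card) ^ 4 ≤
      10 ^ 6 * (A.card : ℝ) ^ 5 * ((L.card : ℝ) ^ 4 * quotEnergy L) := by
  have h0 : ((L ×ˢ L).filter fun z => ρ ≤ corr A (affQuot z.1 z.2)) ⊆
      (L ×ˢ L).filter fun z => affQuot z.1 z.2 ∈ richLines A ρ := by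
    intro z hz
    obtain ⟨h1, h2⟩ := Finset.mem_filter.1 hz
    obtain ⟨h3, h4⟩ := Finset.mem_product.1 h1
    exact Finset.mem_filter.2 ⟨h1, mem_richLines.2 ⟨div_ne_zero (hL _ h4) (hL _ h3), h2⟩⟩
  set R := (L ×ˢ L).filter fun z => ρ ≤ corr A (affQuot z.1 z.2)
  have h1 : ((R.card : ℕ) : ℝ) ^ 2 ≤ (richLines A ρ).card * quotEnergy L := by
    have := (Nat.pow_le_pow_left (Finset.card_le_card h0) 2).trans (card_affQuot_sq_le L _)
    exact_mod_cast this
  have h2 : (R.card : ℝ) ≤ (L.card : ℝ) ^ 2 := by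
    have := Finset.card_filter_le (L ×ˢ L) fun z => ρ ≤ corr A (affQuot z.1 z.2)
    rw [Finset.card_product, ← sq] at this
    exact_mod_cast this
  calc (ρ * R.card) ^ 4 = ρ ^ 4 * ((R.card : ℝ) ^ 2 * (R.card : ℝ) ^ 2) := by ring
    _ ≤ ρ ^ 4 * (((L.card : ℝ) ^ 2) ^ 2 * ((richLines A ρ).card * quotEnergy L)) := by gcongr
    _ = ((richLines A ρ).card * ρ ^ 4) * ((L.card : ℝ) ^ 4 * quotEnergy L) := by ring
    _ ≤ _ := mul_le_mul_of_nonneg_right (card_richLines_mul_pow_le A hρ) (by positivity)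

/-- Richness forces a large energy of the family of rich lines. -/
theorem card_pow_mul_le_quotEnergy (A : Finset (ZMod p)) (hA : A.Nonempty) {τ : ℝ}
    (hτ : 0 ≤ τ) (hτA : 16 * (A.card : ℝ) ≤ τ ^ 2) {J : ℕ} (hJ : A.card < 2 ^ J) :
    ((richLines A τ).card : ℝ) ^ 4 * τ ^ 8 ≤
      256 * 10 ^ 6 * (J : ℝ) ^ 4 * (A.card : ℝ) ^ 9 * quotEnergy (richLines A τ) := by
  have hn : (0 : ℝ) < A.card := by exact_mod_cast hA.card_pos
  set n : ℝ := (A.card : ℝ)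
  have h1 := card_sq_mul_le_sum_corr A hτ
  set L := richLines A τ
  have hL : ∀ l ∈ L, l.1 ≠ 0 := fun l hl => (mem_richLines.1 hl).1
  set Q : ℝ := (quotEnergy L : ℝ)
  have hQ : 0 ≤ Q := Nat.cast_nonneg _
  set ρ : ℝ := τ ^ 2 / (2 * n) with hρ
  have hρn : ρ * (2 * n) = τ ^ 2 := div_mul_cancel₀ _ (by positivity)
  have hρ8 : 8 ≤ ρ := by
    rw [hρ, le_div_iff₀ (by positivity)]
    linarith
  set B : ℝ := √√(10 ^ 6 * n ^ 5 * ((L.card : ℝ) ^ 4 * Q)) with hB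
  have hB4 : B ^ 4 = 10 ^ 6 * n ^ 5 * ((L.card : ℝ) ^ 4 * Q) := by
    have : B ^ 4 = (B ^ 2) ^ 2 := by ring
    rw [this, hB, Real.sq_sqrt (Real.sqrt_nonneg _), Real.sq_sqrt (by positivity)]
  have hB0 : 0 ≤ B := Real.sqrt_nonneg _
  have hlt : ∀ z ∈ L ×ˢ L, corr A (affQuot z.1 z.2) < 2 ^ J * ρ := by
    intro z hz
    obtain ⟨h3, h4⟩ := Finset.mem_product.1 hz
    have h5 : corr A (affQuot z.1 z.2) ≤ n := corr_le_card (div_ne_zero (hL _ h4) (hL _ h3))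
    have h6 : n < 2 ^ J := by
      have : ((A.card : ℕ) : ℝ) < ((2 ^ J : ℕ) : ℝ) := Nat.cast_lt.2 hJ
      rwa [Nat.cast_pow, Nat.cast_ofNat] at this
    have h7 : (0 : ℝ) < 2 ^ J := by positivity
    nlinarith
  have h2 := dyadic_sum_le (L ×ˢ L) (fun z => corr A (affQuot z.1 z.2)) (ρ₀ := ρ) (B := B)
    (by linarith) 1 J hlt (fun r hr => by
      rw [pow_one]
      refine le_of_pow_le_pow_left₀ (n := 4) (by norm_num) hB0 ?_
      rw [hB4]
      exact card_affQuot_richLines_le A hL (by linarith))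
  simp only [pow_one] at h2
  have h3 : ∑ z ∈ L ×ˢ L, corr A (affQuot z.1 z.2) ≤ J * (2 * B) + (L.card : ℝ) ^ 2 * ρ := by
    rw [← Finset.sum_filter_add_sum_filter_not (L ×ˢ L) fun z => ρ ≤ corr A (affQuot z.1 z.2)]
    refine add_le_add h2 ?_
    refine (Finset.sum_le_card_nsmul _ _ ρ fun z hz =>
      (not_le.1 (Finset.mem_filter.1 hz).2).le).trans ?_
    rw [nsmul_eq_mul]
    have := Finset.card_filter_le (L ×ˢ L) fun z => ¬ ρ ≤ corr A (affQuot z.1 z.2)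
    rw [Finset.card_product, ← sq] at this
    gcongr
    exact_mod_cast this
  have h4 : (L.card : ℝ) ^ 2 * τ ^ 2 ≤ 4 * n * J * B := by
    have h5 := h1.trans (mul_le_mul_of_nonneg_left h3 hn.le)
    have h6 : n * ((L.card : ℝ) ^ 2 * ρ) = (L.card : ℝ) ^ 2 * τ ^ 2 / 2 := by
      rw [← hρn]
      ring
    rw [mul_add, h6, mul_pow] at h5
    nlinarith
  rcases (Nat.cast_nonneg L.card : (0 : ℝ) ≤ L.card).eq_or_lt with h0 | h0
  · rw [← h0]
    simp only [ne_eq, OfNat.ofNat_ne_zero, not_false_eq_true, zero_pow, zero_mul]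
    positivity
  · have h5 : ((L.card : ℝ) ^ 2 * τ ^ 2) ^ 4 ≤ (4 * n * J * B) ^ 4 := by gcongr
    rw [mul_pow _ B, hB4] at h5
    have h6 : (L.card : ℝ) ^ 4 * ((L.card : ℝ) ^ 4 * τ ^ 8) ≤
        (L.card : ℝ) ^ 4 * (256 * 10 ^ 6 * (J : ℝ) ^ 4 * n ^ 9 * Q) := by
      calc (L.card : ℝ) ^ 4 * ((L.card : ℝ) ^ 4 * τ ^ 8) = ((L.card : ℝ) ^ 2 * τ ^ 2) ^ 4 := by
            ring
        _ ≤ _ := h5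
        _ = _ := by ring
    exact le_of_mul_le_mul_left h6 (by positivity)

end EnergyOfRichLines

section RichLineBound

theorem le_three_mul_max {x a b c : ℝ} (h : x ≤ a + b + c) :
    x ≤ 3 * a ∨ x ≤ 3 * b ∨ x ≤ 3 * c := by
  by_contra! h'
  linarith [h'.1, h'.2.1, h'.2.2]

/-- Numerical core of the bound for rich lines. -/
theorem rich_alternative {L τ n J Q m M E F p : ℝ} (hL : 0 < L) (hτ : 0 < τ) (hn : 0 < n)
    (hJ : 1 ≤ J) (hm : 0 ≤ m) (hM : 0 ≤ M) (hnp : n ≤ p) (hE : 0 ≤ E)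
    (hfour : L * τ ^ 4 ≤ 10 ^ 6 * n ^ 5)
    (height : L ^ 4 * τ ^ 8 ≤ 256 * 10 ^ 6 * J ^ 4 * n ^ 9 * Q)
    (hQ : Q ≤ m * L ^ 3 / p + 408 * (L ^ 2 * √(m * L) + (m + M) * L ^ 2))
    (hmL : m ≤ L) (hmE : m * τ ^ 2 ≤ E) (hMF : M * τ ^ 2 ≤ 4 * F) :
    (L * τ ^ 5) ^ 6 ≤ (10 ^ 7 * J ^ 2) ^ 6 * (n ^ 33 * E) ∨
      (L * τ ^ 5) ^ 2 ≤ (10 ^ 7 * J ^ 2) ^ 2 * (n ^ 9 * F) := by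
  set S := √(m * L)
  have hS0 : 0 ≤ S := Real.sqrt_nonneg _
  have hS : S ^ 2 = m * L := Real.sq_sqrt (by positivity)
  have hmS : m ≤ S := Real.le_sqrt_of_sq_le (by nlinarith)
  have hJ4 : J ^ 4 ≤ J ^ 12 := pow_le_pow_right₀ hJ (by norm_num)
  have hJ8 : J ^ 8 ≤ J ^ 12 := pow_le_pow_right₀ hJ (by norm_num)
  have hp : 0 < p := hn.trans_le hnp
  have hQ' : Q ≤ m * L ^ 3 / p + 816 * (L ^ 2 * S) + 408 * (M * L ^ 2) := by
    have : m * L ^ 2 ≤ S * L ^ 2 := by gcongr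
    linarith
  rcases le_three_mul_max hQ' with h | h | h
  · left
    have h1 : m * L ^ 3 / p ≤ m * L ^ 3 / n := by gcongr
    replace h : Q ≤ 3 * (m * L ^ 3 / n) := by linarith
    have h2 : L ^ 3 * (L * τ ^ 10) ≤ L ^ 3 * (256 * 10 ^ 6 * 3 * J ^ 4 * n ^ 8 * E) := by
      calc L ^ 3 * (L * τ ^ 10) = L ^ 4 * τ ^ 8 * τ ^ 2 := by ring
        _ ≤ 256 * 10 ^ 6 * J ^ 4 * n ^ 9 * (3 * (m * L ^ 3 / n)) * τ ^ 2 :=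
          mul_le_mul_of_nonneg_right (height.trans (by gcongr)) (by positivity)
        _ = L ^ 3 * (256 * 10 ^ 6 * 3 * J ^ 4 * n ^ 8 * (m * τ ^ 2)) := by field_simp
        _ ≤ _ := by gcongr
    have h3 := le_of_mul_le_mul_left h2 (by positivity)
    calc (L * τ ^ 5) ^ 6 = L * τ ^ 10 * (L * τ ^ 4) ^ 5 := by ring
      _ ≤ (256 * 10 ^ 6 * 3 * J ^ 4 * n ^ 8 * E) * (10 ^ 6 * n ^ 5) ^ 5 := by gcongr
      _ = 256 * 3 * 10 ^ 36 * J ^ 4 * (n ^ 33 * E) := by ring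
      _ ≤ 10 ^ 6 * 10 ^ 36 * J ^ 12 * (n ^ 33 * E) := by
        gcongr
        norm_num
      _ = _ := by ring
  · left
    have h2 : L ^ 2 * (L ^ 2 * τ ^ 8) ≤ L ^ 2 * (256 * 10 ^ 6 * 2448 * J ^ 4 * n ^ 9 * S) := by
      calc L ^ 2 * (L ^ 2 * τ ^ 8) = L ^ 4 * τ ^ 8 := by ring
        _ ≤ 256 * 10 ^ 6 * J ^ 4 * n ^ 9 * (3 * (816 * (L ^ 2 * S))) := height.trans (by gcongr)
        _ = _ := by ring
    have h3 := le_of_mul_le_mul_left h2 (by positivity)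
    have h4 : L * (L ^ 3 * τ ^ 18) ≤
        L * ((256 * 10 ^ 6 * 2448) ^ 2 * J ^ 8 * n ^ 18 * E) := by
      calc L * (L ^ 3 * τ ^ 18) = (L ^ 2 * τ ^ 8) ^ 2 * τ ^ 2 := by ring
        _ ≤ (256 * 10 ^ 6 * 2448 * J ^ 4 * n ^ 9 * S) ^ 2 * τ ^ 2 := by gcongr
        _ = (256 * 10 ^ 6 * 2448) ^ 2 * J ^ 8 * n ^ 18 * S ^ 2 * τ ^ 2 := by ring
        _ = L * ((256 * 10 ^ 6 * 2448) ^ 2 * J ^ 8 * n ^ 18 * (m * τ ^ 2)) := by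
          rw [hS]
          ring
        _ ≤ _ := by gcongr
    have h5 := le_of_mul_le_mul_left h4 hL
    calc (L * τ ^ 5) ^ 6 = L ^ 3 * τ ^ 18 * (L * τ ^ 4) ^ 3 := by ring
      _ ≤ ((256 * 10 ^ 6 * 2448) ^ 2 * J ^ 8 * n ^ 18 * E) * (10 ^ 6 * n ^ 5) ^ 3 := by gcongr
      _ = (256 * 10 ^ 6 * 2448) ^ 2 * 10 ^ 18 * J ^ 8 * (n ^ 33 * E) := by ring
      _ ≤ 10 ^ 6 * 10 ^ 36 * J ^ 12 * (n ^ 33 * E) := by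
        gcongr ?_ * ?_ * _
        norm_num
      _ = _ := by ring
  · right
    have hF : 0 ≤ F := by
      have : 0 ≤ M * τ ^ 2 := by positivity
      linarith
    have h2 : L ^ 2 * (L * τ ^ 5) ^ 2 ≤ L ^ 2 * (256 * 10 ^ 6 * 1224 * 4 * J ^ 4 * n ^ 9 * F) := by
      calc L ^ 2 * (L * τ ^ 5) ^ 2 = L ^ 4 * τ ^ 8 * τ ^ 2 := by ring
        _ ≤ 256 * 10 ^ 6 * J ^ 4 * n ^ 9 * (3 * (408 * (M * L ^ 2))) * τ ^ 2 :=
          mul_le_mul_of_nonneg_right (height.trans (by gcongr)) (by positivity)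
        _ = L ^ 2 * (256 * 10 ^ 6 * 1224 * J ^ 4 * n ^ 9 * (M * τ ^ 2)) := by ring
        _ ≤ L ^ 2 * (256 * 10 ^ 6 * 1224 * J ^ 4 * n ^ 9 * (4 * F)) := by gcongr
        _ = _ := by ring
    calc (L * τ ^ 5) ^ 2 ≤ 256 * 10 ^ 6 * 1224 * 4 * J ^ 4 * n ^ 9 * F :=
          le_of_mul_le_mul_left h2 (by positivity)
      _ = 256 * 10 ^ 6 * 1224 * 4 * (J ^ 4 * n ^ 9 * F) := by ring
      _ ≤ 10 ^ 14 * (J ^ 4 * n ^ 9 * F) := by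
        gcongr
        norm_num
      _ = _ := by ring

variable {p : ℕ} [Fact p.Prime]

theorem card_sq_le_addEfun {A : Finset (ZMod p)} (h : 2 * (A.card : ℝ) ≤ p) :
    (A.card : ℝ) ^ 2 / 4 ≤ addEfun (balanced A) := by
  have hp := prime_cast_pos (p := p)
  have h1 : ∑ x, balanced A x ^ 2 = A.card - (A.card : ℝ) ^ 2 / p := by
    have h2 := corr_eq (A := A) (l := ((1 : ZMod p), 0)) one_ne_zero
    simp only [corr, one_mul, add_zero, hits] at h2
    simpa only [sq, Finset.filter_mem_eq_inter, Finset.inter_self] using h2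
  have h3 : (A.card : ℝ) / 2 ≤ A.card - (A.card : ℝ) ^ 2 / p := by
    have h4 : (A.card : ℝ) ^ 2 / p ≤ A.card / 2 := by
      rw [div_le_div_iff₀ hp two_pos]
      have : (0 : ℝ) ≤ A.card := Nat.cast_nonneg _
      nlinarith
    linarith
  rw [addEfun_eq_sum_sq]
  calc (A.card : ℝ) ^ 2 / 4 = ((A.card : ℝ) / 2) ^ 2 := by ring
    _ ≤ (∑ x, balanced A x ^ 2) ^ 2 := by
      rw [h1]
      gcongr
    _ = (∑ y, balanced A y * balanced A (y + 0)) ^ 2 := by simp only [add_zero, sq]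
    _ ≤ _ := Finset.single_le_sum (f := fun d => (∑ y, balanced A y * balanced A (y + d)) ^ 2)
      (fun _ _ => sq_nonneg _) (Finset.mem_univ 0)

/-- The error terms of the collinear tuple estimate not involving the third moment. -/
noncomputable def errorTerm (A : Finset (ZMod p)) : ℝ :=
  (A.card : ℝ) ^ 7 / p + addEfun (balanced A) ^ (1 / 6 : ℝ) * (A.card : ℝ) ^ (11 / 2 : ℝ) +
    mulEbarFun (balanced A) ^ (1 / 2 : ℝ) * (A.card : ℝ) ^ (9 / 2 : ℝ)

theorem addTerm_pow (A : Finset (ZMod p)) :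
    (addEfun (balanced A) ^ (1 / 6 : ℝ) * (A.card : ℝ) ^ (11 / 2 : ℝ)) ^ 6 =
      (A.card : ℝ) ^ 33 * addEfun (balanced A) := by
  have hn : (0 : ℝ) ≤ A.card := Nat.cast_nonneg _
  rw [mul_pow, ← Real.rpow_mul_natCast (addEfun_nonneg _), ← Real.rpow_mul_natCast hn, mul_comm]
  norm_num

theorem mulTerm_pow (A : Finset (ZMod p)) :
    (mulEbarFun (balanced A) ^ (1 / 2 : ℝ) * (A.card : ℝ) ^ (9 / 2 : ℝ)) ^ 2 =
      (A.card : ℝ) ^ 9 * mulEbarFun (balanced A) := by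
  have hn : (0 : ℝ) ≤ A.card := Nat.cast_nonneg _
  rw [mul_pow, ← Real.rpow_mul_natCast (mulEbarFun_nonneg _), ← Real.rpow_mul_natCast hn, mul_comm]
  norm_num

theorem card_le_prime (A : Finset (ZMod p)) : (A.card : ℝ) ≤ p := by
  exact_mod_cast (Finset.card_le_univ A).trans_eq (ZMod.card p)

theorem rpow_card_le_errorTerm {A : Finset (ZMod p)} (hA : A.Nonempty) :
    (A.card : ℝ) ^ (11 / 2 : ℝ) ≤ 2 * errorTerm A := by
  have hp := prime_cast_pos (p := p)
  have hn : (1 : ℝ) ≤ A.card := by exact_mod_cast hA.card_pos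
  have hE := addEfun_nonneg (balanced A)
  have hF := mulEbarFun_nonneg (balanced A)
  have hX : 0 ≤ addEfun (balanced A) ^ (1 / 6 : ℝ) * (A.card : ℝ) ^ (11 / 2 : ℝ) := by positivity
  have hY : 0 ≤ mulEbarFun (balanced A) ^ (1 / 2 : ℝ) * (A.card : ℝ) ^ (9 / 2 : ℝ) := by
    positivity
  have hZ : 0 ≤ (A.card : ℝ) ^ 7 / p := by positivity
  by_cases h : 2 * (A.card : ℝ) ≤ p
  · have h1 := card_sq_le_addEfun h
    have h2 : (1 / 2 : ℝ) ≤ addEfun (balanced A) ^ (1 / 6 : ℝ) := by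
      have h3 : (1 / 2 : ℝ) ^ (6 : ℝ) ≤ addEfun (balanced A) := by
        norm_num
        nlinarith
      calc (1 / 2 : ℝ) = ((1 / 2 : ℝ) ^ (6 : ℝ)) ^ (1 / 6 : ℝ) := by
            rw [← Real.rpow_mul (by norm_num)]
            norm_num
        _ ≤ _ := Real.rpow_le_rpow (by positivity) h3 (by norm_num)
    have h4 : (0 : ℝ) ≤ (A.card : ℝ) ^ (11 / 2 : ℝ) := by positivity
    rw [errorTerm]
    nlinarith [mul_le_mul_of_nonneg_right h2 h4]
  · have h1 : (A.card : ℝ) ^ (11 / 2 : ℝ) ≤ (A.card : ℝ) ^ 6 := by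
      rw [← Real.rpow_natCast]
      exact Real.rpow_le_rpow_of_exponent_le hn (by norm_num)
    have h2 : (A.card : ℝ) ^ 6 ≤ 2 * ((A.card : ℝ) ^ 7 / p) := by
      rw [← mul_div_assoc, le_div_iff₀ hp]
      have : (0 : ℝ) ≤ (A.card : ℝ) ^ 6 := by positivity
      nlinarith
    rw [errorTerm]
    linarith

theorem errorTerm_nonneg (A : Finset (ZMod p)) : 0 ≤ errorTerm A := by
  have hE := addEfun_nonneg (balanced A)
  have hF := mulEbarFun_nonneg (balanced A)
  rw [errorTerm]
  positivity

/-- Fifth moment bound at a fixed level of richness. -/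
theorem pow_mul_card_richLines_le {A : Finset (ZMod p)} (hA : A.Nonempty) {J : ℕ}
    (hJ : A.card < 2 ^ J) {τ : ℝ} (hτ : 2 ≤ τ) :
    τ ^ 5 * (richLines A τ).card ≤ 10 ^ 7 * (J : ℝ) ^ 2 * errorTerm A := by
  have hp := prime_cast_pos (p := p)
  have hn : (0 : ℝ) < A.card := by exact_mod_cast hA.card_pos
  have hJ1 : (1 : ℝ) ≤ J := by
    have : J ≠ 0 := by
      rintro rfl
      have := hA.card_pos
      omega
    exact_mod_cast Nat.one_le_iff_ne_zero.2 this
  have hE := addEfun_nonneg (balanced A)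
  have hF := mulEbarFun_nonneg (balanced A)
  have hX : 0 ≤ addEfun (balanced A) ^ (1 / 6 : ℝ) * (A.card : ℝ) ^ (11 / 2 : ℝ) := by positivity
  have hY : 0 ≤ mulEbarFun (balanced A) ^ (1 / 2 : ℝ) * (A.card : ℝ) ^ (9 / 2 : ℝ) := by
    positivity
  have hZ : 0 ≤ (A.card : ℝ) ^ 7 / p := by positivity
  have hτ0 : 0 < τ := by linarith
  have hfour := card_richLines_mul_pow_le A hτ
  have hJ2 : (1 : ℝ) ≤ (J : ℝ) ^ 2 := one_le_pow₀ hJ1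
  rcases (Nat.cast_nonneg (richLines A τ).card : (0 : ℝ) ≤ (richLines A τ).card).eq_or_lt
    with hL0 | hL0
  · rw [← hL0, mul_zero]
    have := errorTerm_nonneg A
    positivity
  by_cases hτA : 16 * (A.card : ℝ) ≤ τ ^ 2
  · have height := card_pow_mul_le_quotEnergy A hA hτ0.le hτA hJ
    have hτ2 : 0 < τ ^ 2 := by positivity
    set m : ℕ := ⌊min (addEfun (balanced A) / τ ^ 2) (richLines A τ).card⌋₊
    set M : ℕ := ⌊4 * mulEbarFun (balanced A) / τ ^ 2⌋₊
    have hmin : (m : ℝ) ≤ min (addEfun (balanced A) / τ ^ 2) (richLines A τ).card :=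
      Nat.floor_le (le_min (by positivity) hL0.le)
    have hmL : SlopeBound (richLines A τ) m := fun a T hT ha =>
      Nat.le_floor (le_min ((le_div_iff₀ hτ2).2 (card_richLines_slope_le A hτ0.le a hT ha))
        (by exact_mod_cast Finset.card_le_card hT))
    have hML : PencilBound (richLines A τ) M := fun x y T hT hxy =>
      card_filter_le_floor hτ2 (card_richLines_pencil_le A hτ x y hT hxy)
    have hQ := quotEnergy_le (fun l hl => (mem_richLines.1 hl).1) hmL hML
    have hM : (M : ℝ) * τ ^ 2 ≤ 4 * mulEbarFun (balanced A) :=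
      (le_div_iff₀ hτ2).1 (Nat.floor_le (by positivity))
    have hm : (m : ℝ) * τ ^ 2 ≤ addEfun (balanced A) :=
      (le_div_iff₀ hτ2).1 (hmin.trans (min_le_left _ _))
    rw [mul_comm (τ ^ 5)]
    rcases rich_alternative hL0 hτ0 hn hJ1 (Nat.cast_nonneg m) (Nat.cast_nonneg M)
      (card_le_prime A) hE hfour height hQ (hmin.trans (min_le_right _ _)) hm hM with h | h
    · rw [← addTerm_pow, ← mul_pow] at h
      refine (le_of_pow_le_pow_left₀ (by norm_num) (by positivity) h).trans ?_
      gcongr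
      rw [errorTerm]
      linarith
    · rw [← mulTerm_pow, ← mul_pow] at h
      refine (le_of_pow_le_pow_left₀ (by norm_num) (by positivity) h).trans ?_
      gcongr
      rw [errorTerm]
      linarith
  · have h1 : τ ≤ 4 * √(A.card : ℝ) := by
      refine le_of_pow_le_pow_left₀ (n := 2) (by norm_num) (by positivity) ?_
      rw [mul_pow, Real.sq_sqrt hn.le]
      linarith
    have h2 : (A.card : ℝ) ^ 5 * √(A.card : ℝ) = (A.card : ℝ) ^ (11 / 2 : ℝ) := by
      rw [Real.sqrt_eq_rpow, ← Real.rpow_natCast, ← Real.rpow_add hn]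
      norm_num
    calc τ ^ 5 * (richLines A τ).card = (richLines A τ).card * τ ^ 4 * τ := by ring
      _ ≤ 10 ^ 6 * (A.card : ℝ) ^ 5 * (4 * √(A.card : ℝ)) := by gcongr
      _ = 4 * 10 ^ 6 * (A.card : ℝ) ^ (11 / 2 : ℝ) := by
        rw [← h2]
        ring
      _ ≤ 4 * 10 ^ 6 * (2 * errorTerm A) := by
        gcongr
        exact rpow_card_le_errorTerm hA
      _ ≤ _ := by nlinarith [errorTerm_nonneg A, mul_le_mul_of_nonneg_right hJ2 (errorTerm_nonneg A)]

end RichLineBound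

section Moments
variable {p : ℕ} [Fact p.Prime]

theorem iLine_inl (A : Finset (ZMod p)) (l : ZMod p × ZMod p) : iLine A A (.inl l) = hits A l := by
  rw [iLine, hits]
  refine Finset.card_bij (fun q _ => q.1) (fun q hq => ?_) (fun q hq q' hq' h => ?_)
    fun x hx => ?_
  · obtain ⟨h1, h2⟩ := Finset.mem_filter.1 hq
    have h3 : q.2 = l.1 * q.1 + l.2 := h2
    obtain ⟨h4, h5⟩ := Finset.mem_product.1 h1
    exact Finset.mem_filter.2 ⟨h4, h3 ▸ h5⟩
  · have h1 : q.2 = l.1 * q.1 + l.2 := (Finset.mem_filter.1 hq).2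
    have h2 : q'.2 = l.1 * q'.1 + l.2 := (Finset.mem_filter.1 hq').2
    have h3 : q.1 = q'.1 := h
    exact Prod.ext h3 (by rw [h1, h2, h3])
  · obtain ⟨h1, h2⟩ := Finset.mem_filter.1 hx
    exact ⟨(x, l.1 * x + l.2), Finset.mem_filter.2 ⟨Finset.mem_product.2 ⟨h1, h2⟩, rfl⟩, rfl⟩

theorem iLine_inr (A : Finset (ZMod p)) (c : ZMod p) :
    iLine A A (.inr c) = if c ∈ A then A.card else 0 := by
  rw [iLine]
  split_ifs with hc
  · refine Finset.card_bij (fun q _ => q.2) (fun q hq => ?_) (fun q hq q' hq' h => ?_)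
      fun x hx => ?_
    · exact (Finset.mem_product.1 (Finset.mem_filter.1 hq).1).2
    · have h1 : q.1 = c := (Finset.mem_filter.1 hq).2
      have h2 : q'.1 = c := (Finset.mem_filter.1 hq').2
      exact Prod.ext (h1.trans h2.symm) h
    · exact ⟨(c, x), Finset.mem_filter.2 ⟨Finset.mem_product.2 ⟨hc, hx⟩, rfl⟩, rfl⟩
  · rw [Finset.card_eq_zero, Finset.filter_eq_empty_iff]
    intro q hq hqc
    have h1 : q.1 = c := hqc
    exact hc (h1 ▸ (Finset.mem_product.1 hq).1)

theorem hits_zero_slope (A : Finset (ZMod p)) (b : ZMod p) :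
    hits A (0, b) = if b ∈ A then A.card else 0 := by
  simp only [hits, zero_mul, zero_add]
  split_ifs with h <;> simp [h]

theorem sum_slope_split (φ : ZMod p × ZMod p → ℝ) :
    ∑ l, φ l = ∑ l ∈ Finset.univ.filter (fun l : ZMod p × ZMod p => l.1 ≠ 0), φ l +
      ∑ b, φ (0, b) := by
  rw [← Finset.sum_filter_add_sum_filter_not Finset.univ fun l : ZMod p × ZMod p => l.1 ≠ 0]
  congr 1
  refine Finset.sum_bij' (fun l _ => l.2) (fun b _ => (0, b)) ?_ ?_ ?_ ?_ ?_
  · simp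
  · simp
  · rintro ⟨a, b⟩ h
    simp only [Finset.mem_filter, not_not] at h
    rw [← h.2]
  · simp
  · rintro ⟨a, b⟩ h
    simp only [Finset.mem_filter, not_not] at h
    rw [← h.2]

/-- Separating axis-parallel lines in sums over all lines with at least two points. -/
theorem sum_iLine_eq {A : Finset (ZMod p)} (hA : 2 ≤ A.card) (φ : ℕ → ℝ) :
    ∑ l ∈ Finset.univ.filter (fun l : (ZMod p × ZMod p) ⊕ ZMod p => 2 ≤ iLine A A l),
      φ (iLine A A l) =
    ∑ l ∈ Finset.univ.filter (fun l : ZMod p × ZMod p => l.1 ≠ 0),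
      (if 2 ≤ hits A l then φ (hits A l) else 0) + 2 * (A.card * φ A.card) := by
  have h1 : ∀ b, (if 2 ≤ (if b ∈ A then A.card else 0) then φ (if b ∈ A then A.card else 0)
      else 0) = if b ∈ A then φ A.card else 0 := by
    intro b
    by_cases hb : b ∈ A <;> simp [hb, hA]
  rw [Finset.sum_filter, Fintype.sum_sum_type, sum_slope_split]
  simp only [iLine_inl, iLine_inr, hits_zero_slope, h1, Finset.sum_ite_mem, Finset.univ_inter,
    Finset.sum_const, nsmul_eq_mul]
  ring

theorem sum_corr_parallel (A : Finset (ZMod p)) (a : ZMod p) : ∑ b, corr A (a, b) = 0 := by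
  simp only [corr]
  rw [Finset.sum_comm]
  refine Finset.sum_eq_zero fun x _ => ?_
  rw [← Finset.mul_sum]
  have := Equiv.sum_comp (Equiv.addLeft (a * x)) (balanced A)
  simp only [Equiv.coe_addLeft] at this
  rw [this, sum_balanced, mul_zero]

theorem corr_zero_slope (A : Finset (ZMod p)) (b : ZMod p) : corr A (0, b) = 0 := by
  simp only [corr, zero_mul, zero_add]
  rw [← Finset.sum_mul, sum_balanced, zero_mul]

theorem sum_corr (A : Finset (ZMod p)) :
    ∑ l ∈ Finset.univ.filter (fun l : ZMod p × ZMod p => l.1 ≠ 0), corr A l = 0 := by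
  have h := sum_slope_split (p := p) (corr A)
  simp only [corr_zero_slope, Finset.sum_const_zero, add_zero] at h
  rw [← h, Fintype.sum_prod_type]
  exact Finset.sum_eq_zero fun a _ => sum_corr_parallel A a

theorem sum_corr_sq_le (A : Finset (ZMod p)) :
    ∑ l ∈ Finset.univ.filter (fun l : ZMod p × ZMod p => l.1 ≠ 0), corr A l ^ 2 ≤
      p * (A.card : ℝ) ^ 2 := by
  have h1 : ∑ l : ZMod p × ZMod p, corr A l ^ 2 = p * (∑ x, balanced A x ^ 2) ^ 2 := by
    have h2 : ∀ l : ZMod p × ZMod p, corr A l ^ 2 = ∑ x, ∑ y, balanced A x * balanced A y *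
        (balanced A (l.1 * x + l.2) * balanced A (l.1 * y + l.2)) := by
      intro l
      rw [corr, sq, Finset.sum_mul_sum]
      exact Finset.sum_congr rfl fun x _ => Finset.sum_congr rfl fun y _ => by ring
    have h3 : ∀ x y, ∑ l : ZMod p × ZMod p,
        balanced A (l.1 * x + l.2) * balanced A (l.1 * y + l.2) =
        if x = y then p * ∑ x, balanced A x ^ 2 else 0 := by
      intro x y
      have h4 : ∀ a, ∑ b, balanced A (a * x + b) * balanced A (a * y + b) =
          ∑ t, balanced A t * balanced A ((y - x) * a + t) := by
        intro a
        rw [← Equiv.sum_comp (Equiv.addLeft (a * x))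
          fun t => balanced A t * balanced A ((y - x) * a + t)]
        refine Finset.sum_congr rfl fun b _ => ?_
        simp only [Equiv.coe_addLeft]
        congr 2
        ring
      rw [Fintype.sum_prod_type, Finset.sum_congr rfl fun a _ => h4 a]
      split_ifs with hxy
      · simp [hxy, sq, ZMod.card]
      · rw [Finset.sum_comm]
        refine Finset.sum_eq_zero fun t _ => ?_
        rw [← Finset.mul_sum, sum_affine (l := (y - x, t)) (sub_ne_zero.2 (Ne.symm hxy)),
          sum_balanced, mul_zero]
    rw [Finset.sum_congr rfl fun l _ => h2 l, Finset.sum_comm]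
    have h5 : ∀ x, ∑ l : ZMod p × ZMod p, ∑ y, balanced A x * balanced A y *
        (balanced A (l.1 * x + l.2) * balanced A (l.1 * y + l.2)) =
        balanced A x ^ 2 * (p * ∑ x, balanced A x ^ 2) := by
      intro x
      rw [Finset.sum_comm]
      simp only [← Finset.mul_sum, h3, mul_ite, mul_zero, Finset.sum_ite_eq, Finset.mem_univ,
        if_true, sq]
    rw [Finset.sum_congr rfl fun x _ => h5 x, ← Finset.sum_mul]
    ring
  have h6 := sum_slope_split (p := p) fun l => corr A l ^ 2
  simp only [corr_zero_slope] at h6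
  norm_num at h6
  rw [← h6, h1]
  have h7 : 0 ≤ ∑ x, balanced A x ^ 2 := by positivity
  gcongr
  exact sum_sq_balanced_le A

theorem sum_pow_five_corr_le {A : Finset (ZMod p)} (hA : A.Nonempty) {J : ℕ}
    (hJ : A.card < 2 ^ J) :
    ∑ l ∈ richLines A 2, corr A l ^ 5 ≤ 32 * 10 ^ 7 * (J : ℝ) ^ 3 * errorTerm A := by
  have h1 : ∀ ρ, (Finset.univ.filter fun l : ZMod p × ZMod p => l.1 ≠ 0).filter
      (fun l => ρ ≤ corr A l) = richLines A ρ := by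
    intro ρ
    ext l
    simp [mem_richLines]
  have h2 := dyadic_sum_le (Finset.univ.filter fun l : ZMod p × ZMod p => l.1 ≠ 0) (corr A)
    (ρ₀ := 2) (B := 10 ^ 7 * (J : ℝ) ^ 2 * errorTerm A) two_pos 5 J
    (fun l hl => by
      have h3 : ((A.card : ℕ) : ℝ) < ((2 ^ J : ℕ) : ℝ) := Nat.cast_lt.2 hJ
      rw [Nat.cast_pow, Nat.cast_ofNat] at h3
      have h4 := corr_le_card (A := A) (Finset.mem_filter.1 hl).2
      have h5 : (0 : ℝ) < 2 ^ J := by positivity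
      linarith)
    (fun ρ hρ => by
      rw [h1]
      exact pow_mul_card_richLines_le hA hJ hρ)
  rw [h1] at h2
  refine h2.trans (le_of_eq (by ring))

/-- The third moment of the balanced function over lines with at least two points. -/
noncomputable def thirdMoment (A : Finset (ZMod p)) : ℝ :=
  (∑ l ∈ Finset.univ.filter (fun l : (ZMod p × ZMod p) ⊕ ZMod p => 2 ≤ iLine A A l),
      (iLine A A l : ℝ) ^ 3) -
    (A.card : ℝ) ^ 2 / p *
      ∑ l ∈ Finset.univ.filter (fun l : (ZMod p × ZMod p) ⊕ ZMod p => 2 ≤ iLine A A l),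
        (iLine A A l : ℝ) ^ 2

theorem sum_le_thirdMoment {A : Finset (ZMod p)} (hA : 2 ≤ A.card) :
    ∑ l ∈ Finset.univ.filter (fun l : ZMod p × ZMod p => l.1 ≠ 0),
      (if 2 ≤ hits A l then (hits A l : ℝ) ^ 2 * (hits A l - (A.card : ℝ) ^ 2 / p) else 0) ≤
      thirdMoment A := by
  have hp := prime_cast_pos (p := p)
  have h1 : (A.card : ℝ) ^ 2 / p ≤ A.card := by
    rw [div_le_iff₀ hp, sq]
    exact mul_le_mul_of_nonneg_left (card_le_prime A) (Nat.cast_nonneg _)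
  have h2 := sum_iLine_eq hA fun i => (i : ℝ) ^ 2 * (i - (A.card : ℝ) ^ 2 / p)
  have h3 : thirdMoment A = ∑ l ∈ Finset.univ.filter
      (fun l : (ZMod p × ZMod p) ⊕ ZMod p => 2 ≤ iLine A A l),
      (iLine A A l : ℝ) ^ 2 * (iLine A A l - (A.card : ℝ) ^ 2 / p) := by
    rw [thirdMoment, Finset.mul_sum, ← Finset.sum_sub_distrib]
    exact Finset.sum_congr rfl fun l _ => by ring
  rw [h3, h2]
  have h4 : 0 ≤ (A.card : ℝ) - (A.card : ℝ) ^ 2 / p := by linarith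
  have h5 : 0 ≤ 2 * ((A.card : ℝ) * ((A.card : ℝ) ^ 2 * ((A.card : ℝ) - (A.card : ℝ) ^ 2 / p))) := by
    positivity
  linarith

theorem sum_cube_add_le_thirdMoment {A : Finset (ZMod p)} (hA : 2 ≤ A.card)
    (hμ : 1 ≤ (A.card : ℝ) ^ 2 / p) :
    ∑ l ∈ Finset.univ.filter (fun l : ZMod p × ZMod p => l.1 ≠ 0), corr A l ^ 3 +
      2 * ((A.card : ℝ) ^ 2 / p) *
        ∑ l ∈ Finset.univ.filter (fun l : ZMod p × ZMod p => l.1 ≠ 0), corr A l ^ 2 ≤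
      thirdMoment A := by
  refine le_trans ?_ (sum_le_thirdMoment hA)
  set μ := (A.card : ℝ) ^ 2 / p with hμdef
  have h1 : ∑ l ∈ Finset.univ.filter (fun l : ZMod p × ZMod p => l.1 ≠ 0), corr A l ^ 3 +
      2 * μ * ∑ l ∈ Finset.univ.filter (fun l : ZMod p × ZMod p => l.1 ≠ 0), corr A l ^ 2 =
      ∑ l ∈ Finset.univ.filter (fun l : ZMod p × ZMod p => l.1 ≠ 0),
        (corr A l ^ 3 + 2 * μ * corr A l ^ 2 + μ ^ 2 * corr A l) := by
    rw [Finset.sum_add_distrib, Finset.sum_add_distrib, ← Finset.mul_sum, ← Finset.mul_sum,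
      sum_corr, mul_zero, add_zero]
  rw [h1]
  refine Finset.sum_le_sum fun l hl => ?_
  have h2 := corr_eq (A := A) (Finset.mem_filter.1 hl).2
  rw [← hμdef] at h2
  have h3 : corr A l ^ 3 + 2 * μ * corr A l ^ 2 + μ ^ 2 * corr A l =
      (hits A l : ℝ) ^ 2 * (hits A l - μ) := by
    rw [h2]
    ring
  rw [h3]
  split_ifs with h
  · exact le_rfl
  · have h4 : (hits A l : ℝ) ≤ 1 := by
      exact_mod_cast Nat.lt_succ_iff.1 (not_le.1 h)
    exact mul_nonpos_of_nonneg_of_nonpos (sq_nonneg _) (by linarith)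

theorem thirdMoment_nonneg {A : Finset (ZMod p)} (hA : 2 ≤ A.card) : 0 ≤ thirdMoment A := by
  by_cases hμ : 1 ≤ (A.card : ℝ) ^ 2 / p
  · refine le_trans ?_ (sum_cube_add_le_thirdMoment hA hμ)
    rw [Finset.mul_sum, ← Finset.sum_add_distrib]
    refine Finset.sum_nonneg fun l hl => ?_
    have h2 := corr_eq (A := A) (Finset.mem_filter.1 hl).2
    have h3 : corr A l ^ 3 + 2 * ((A.card : ℝ) ^ 2 / p) * corr A l ^ 2 =
        corr A l ^ 2 * (hits A l + (A.card : ℝ) ^ 2 / p) := by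
      rw [h2]
      ring
    rw [h3]
    positivity
  · refine le_trans (Finset.sum_nonneg fun l _ => ?_) (sum_le_thirdMoment hA)
    split_ifs with h
    · have h4 : (2 : ℝ) ≤ hits A l := by exact_mod_cast h
      exact mul_nonneg (sq_nonneg _) (by linarith [not_le.1 hμ])
    · exact le_rfl

theorem pow_five_le {μ e : ℝ} (hμ : 1 ≤ μ) (he : 0 ≤ μ + e) :
    (μ + e) ^ 5 ≤ μ ^ 5 + 5 * μ ^ 4 * e + 38 * μ ^ 3 * e ^ 2 + 10 * μ ^ 2 * e ^ 3 +
      4 * if 2 ≤ e then e ^ 5 else 0 := by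
  have h1 : (μ + e) ^ 5 = μ ^ 5 + 5 * μ ^ 4 * e + 10 * μ ^ 3 * e ^ 2 + 10 * μ ^ 2 * e ^ 3 +
      (5 * μ * e ^ 4 + e ^ 5) := by ring
  have h2 : 5 * μ * e ^ 4 + e ^ 5 ≤ 28 * μ ^ 3 * e ^ 2 + 4 * if 2 ≤ e then e ^ 5 else 0 := by
    by_cases h : e ≤ 2 * μ
    · have h3 : (0 : ℝ) ≤ 4 * if 2 ≤ e then e ^ 5 else 0 := by split_ifs <;> positivity
      have h4 : e ^ 2 ≤ 4 * μ ^ 2 := by nlinarith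
      have h5 : e ^ 3 ≤ 8 * μ ^ 3 := by
        have h8 : e ^ 3 ≤ (2 * μ) ^ 3 := (Odd.strictMono_pow (by decide)).monotone h
        rw [mul_pow] at h8
        linarith
      have h6 : e ^ 4 * μ ≤ 4 * μ ^ 2 * e ^ 2 * μ := by
        have : e ^ 4 = e ^ 2 * e ^ 2 := by ring
        rw [this]
        gcongr
      have h7 : e ^ 5 ≤ 8 * μ ^ 3 * e ^ 2 := by
        have : e ^ 5 = e ^ 3 * e ^ 2 := by ring
        rw [this]
        gcongr
      nlinarith
    · rw [if_pos (by linarith)]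
      have h3 : 0 ≤ μ ^ 3 * e ^ 2 := by positivity
      have h4 : 2 * μ * e ^ 4 ≤ e * e ^ 4 := by
        gcongr
        exact (not_le.1 h).le
      nlinarith
  rw [h1]
  linarith

theorem card_two_hits_le (A : Finset (ZMod p)) :
    (Finset.univ.filter fun l : ZMod p × ZMod p => 2 ≤ hits A l).card ≤ A.card ^ 4 := by
  have h : (Finset.univ.filter fun l : ZMod p × ZMod p => 2 ≤ hits A l) ⊆
      ((A ×ˢ A) ×ˢ A ×ˢ A).image fun z => ((z.2.2 - z.1.2) / (z.2.1 - z.1.1),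
        z.1.2 - (z.2.2 - z.1.2) / (z.2.1 - z.1.1) * z.1.1) := by
    intro l hl
    obtain ⟨x, hx, y, hy, hxy⟩ := Finset.one_lt_card.1 (Finset.mem_filter.1 hl).2
    obtain ⟨hx1, hx2⟩ := Finset.mem_filter.1 hx
    obtain ⟨hy1, hy2⟩ := Finset.mem_filter.1 hy
    refine Finset.mem_image.2 ⟨((x, l.1 * x + l.2), (y, l.1 * y + l.2)), by simp [*], ?_⟩
    have h0 : y - x ≠ 0 := sub_ne_zero.2 (Ne.symm hxy)
    have h1 : (l.1 * y + l.2 - (l.1 * x + l.2)) / (y - x) = l.1 := by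
      field_simp
      ring
    simp only [h1]
    exact Prod.ext rfl (by ring)
  refine (Finset.card_le_card h).trans (Finset.card_image_le.trans (le_of_eq ?_))
  simp only [Finset.card_product]
  ring

theorem sum_hits_pow_five_le {A : Finset (ZMod p)} (hA : 2 ≤ A.card) {J : ℕ}
    (hJ : A.card < 2 ^ J) :
    ∑ l ∈ Finset.univ.filter (fun l : ZMod p × ZMod p => l.1 ≠ 0),
      (if 2 ≤ hits A l then (hits A l : ℝ) ^ 5 else 0) ≤
      (A.card : ℝ) ^ 10 / (p : ℝ) ^ 3 + 1100 * 10 ^ 7 * (J : ℝ) ^ 3 *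
        (errorTerm A + (A.card : ℝ) ^ 4 / (p : ℝ) ^ 2 * thirdMoment A) := by
  have hA0 : A.Nonempty := Finset.card_pos.1 (by omega)
  have hp := prime_cast_pos (p := p)
  have hn : (1 : ℝ) ≤ A.card := by exact_mod_cast hA0.card_pos
  have hJ1 : (1 : ℝ) ≤ J := by
    have : J ≠ 0 := by
      rintro rfl
      omega
    exact_mod_cast Nat.one_le_iff_ne_zero.2 this
  have hJ3 : (1 : ℝ) ≤ (J : ℝ) ^ 3 := one_le_pow₀ hJ1
  have hT := errorTerm_nonneg A
  have hB := thirdMoment_nonneg hA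
  have h5 := sum_pow_five_corr_le hA0 hJ
  have hfilt : richLines A 2 =
      (Finset.univ.filter fun l : ZMod p × ZMod p => l.1 ≠ 0).filter
        fun l => 2 ≤ corr A l := by
    ext l
    simp [mem_richLines]
  rw [hfilt, Finset.sum_filter] at h5
  have hTJ : errorTerm A ≤ (J : ℝ) ^ 3 * errorTerm A := le_mul_of_one_le_left hT hJ3
  have hBJ : (A.card : ℝ) ^ 4 / (p : ℝ) ^ 2 * thirdMoment A ≤
      (J : ℝ) ^ 3 * ((A.card : ℝ) ^ 4 / (p : ℝ) ^ 2 * thirdMoment A) :=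
    le_mul_of_one_le_left (by positivity) hJ3
  have hB0 : 0 ≤ (A.card : ℝ) ^ 4 / (p : ℝ) ^ 2 * thirdMoment A := by positivity
  have h10 : 0 ≤ (A.card : ℝ) ^ 10 / (p : ℝ) ^ 3 := by positivity
  by_cases hμ : 1 ≤ (A.card : ℝ) ^ 2 / p
  · have hcube := sum_cube_add_le_thirdMoment hA hμ
    set N := Finset.univ.filter fun l : ZMod p × ZMod p => l.1 ≠ 0
    have hsq := sum_corr_sq_le A
    set μ := (A.card : ℝ) ^ 2 / p with hμdef
    have hsq0 : 0 ≤ ∑ l ∈ N, corr A l ^ 2 := by positivity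
    have hN : (N.card : ℝ) ≤ (p : ℝ) ^ 2 := by
      have : N.card ≤ p ^ 2 := by
        refine (Finset.card_filter_le _ _).trans (le_of_eq ?_)
        simp [ZMod.card, sq]
      exact_mod_cast this
    have h1 : ∑ l ∈ N, (if 2 ≤ hits A l then (hits A l : ℝ) ^ 5 else 0) ≤
        ∑ l ∈ N, (μ ^ 5 + 5 * μ ^ 4 * corr A l + 38 * μ ^ 3 * corr A l ^ 2 +
          10 * μ ^ 2 * corr A l ^ 3 + 4 * if 2 ≤ corr A l then corr A l ^ 5 else 0) := by
      refine Finset.sum_le_sum fun l hl => ?_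
      have h2 := corr_eq (A := A) (Finset.mem_filter.1 hl).2
      have h3 : (hits A l : ℝ) = μ + corr A l := by
        rw [h2]
        ring
      refine le_trans ?_ (pow_five_le hμ (h3 ▸ Nat.cast_nonneg _))
      rw [← h3]
      split_ifs
      · exact le_rfl
      · positivity
    simp only [Finset.sum_add_distrib, ← Finset.mul_sum, Finset.sum_const, nsmul_eq_mul] at h1
    rw [sum_corr, mul_zero, add_zero] at h1
    have e1 : N.card * μ ^ 5 ≤ (A.card : ℝ) ^ 10 / (p : ℝ) ^ 3 := by
      calc N.card * μ ^ 5 ≤ (p : ℝ) ^ 2 * μ ^ 5 := by gcongr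
        _ = _ := by
          rw [hμdef]
          field_simp
    have e2 : μ ^ 3 * ∑ l ∈ N, corr A l ^ 2 ≤ errorTerm A := by
      calc μ ^ 3 * ∑ l ∈ N, corr A l ^ 2 ≤ μ ^ 3 * (p * (A.card : ℝ) ^ 2) := by gcongr
        _ = (A.card : ℝ) ^ 7 / p * (A.card / p) := by
          rw [hμdef]
          field_simp
        _ ≤ (A.card : ℝ) ^ 7 / p * 1 := by
          gcongr
          exact (div_le_one hp).2 (card_le_prime A)
        _ ≤ errorTerm A := by
          have hE := addEfun_nonneg (balanced A)
          have hF := mulEbarFun_nonneg (balanced A)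
          rw [errorTerm, mul_one, add_assoc]
          exact le_add_of_nonneg_right (by positivity)
    have e3 : μ ^ 2 * ∑ l ∈ N, corr A l ^ 3 ≤
        (A.card : ℝ) ^ 4 / (p : ℝ) ^ 2 * thirdMoment A := by
      calc μ ^ 2 * ∑ l ∈ N, corr A l ^ 3 ≤ μ ^ 2 * thirdMoment A := by
            gcongr
            have : 0 ≤ 2 * μ * ∑ l ∈ N, corr A l ^ 2 := by positivity
            linarith
        _ = _ := by
          rw [hμdef]
          field_simp
    linarith
  · have h1 : ∑ l ∈ Finset.univ.filter (fun l : ZMod p × ZMod p => l.1 ≠ 0),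
        (if 2 ≤ hits A l then (hits A l : ℝ) ^ 5 else 0) ≤
        ∑ l ∈ Finset.univ.filter (fun l : ZMod p × ZMod p => l.1 ≠ 0),
          (32 * (if 2 ≤ corr A l then corr A l ^ 5 else 0) +
            if 2 ≤ hits A l then 243 else 0) := by
      refine Finset.sum_le_sum fun l hl => ?_
      have h2 := corr_eq (A := A) (Finset.mem_filter.1 hl).2
      by_cases h3 : 2 ≤ hits A l
      · have h4 : (2 : ℝ) ≤ hits A l := by exact_mod_cast h3
        rw [if_pos h3, if_pos h3]
        split_ifs with h6
        · have : (hits A l : ℝ) ^ 5 ≤ (2 * corr A l) ^ 5 := by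
            gcongr
            linarith
          rw [mul_pow] at this
          linarith
        · have : (hits A l : ℝ) ^ 5 ≤ 3 ^ 5 := by
            gcongr
            linarith
          linarith
      · rw [if_neg h3, if_neg h3]
        split_ifs <;> positivity
    have h6 : ∑ l ∈ Finset.univ.filter (fun l : ZMod p × ZMod p => l.1 ≠ 0),
        (if 2 ≤ hits A l then (243 : ℝ) else 0) ≤ 243 * (2 * errorTerm A) := by
      calc ∑ l ∈ Finset.univ.filter (fun l : ZMod p × ZMod p => l.1 ≠ 0),
            (if 2 ≤ hits A l then (243 : ℝ) else 0)
          ≤ ∑ l : ZMod p × ZMod p, (if 2 ≤ hits A l then (243 : ℝ) else 0) :=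
            Finset.sum_le_sum_of_subset_of_nonneg (Finset.subset_univ _)
              fun l _ _ => by split_ifs <;> norm_num
        _ = 243 * (Finset.univ.filter fun l : ZMod p × ZMod p => 2 ≤ hits A l).card := by
            rw [← Finset.sum_filter, Finset.sum_const, nsmul_eq_mul, mul_comm]
        _ ≤ 243 * (A.card : ℝ) ^ 4 := by
            gcongr
            exact_mod_cast card_two_hits_le A
        _ ≤ 243 * (A.card : ℝ) ^ (11 / 2 : ℝ) := by
            gcongr
            rw [← Real.rpow_natCast]
            exact Real.rpow_le_rpow_of_exponent_le hn (by norm_num)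
        _ ≤ _ := by
            gcongr
            exact rpow_card_le_errorTerm hA0
    rw [Finset.sum_add_distrib, ← Finset.mul_sum] at h1
    nlinarith

end Moments

section CollinearTuples
variable {p : ℕ} [Fact p.Prime]

theorem exists_onLine {ι : Type*} {f : ι → ZMod p × ZMod p}
    (hf : Collinear (ZMod p) (Set.range f)) (i : ι) :
    ∃ l : (ZMod p × ZMod p) ⊕ ZMod p, ∀ j, onLine l (f j) := by
  obtain ⟨v, hv⟩ := (collinear_iff_of_mem (Set.mem_range_self i)).1 hf
  by_cases h : v.1 = 0
  · refine ⟨.inr (f i).1, fun j => ?_⟩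
    obtain ⟨r, hr⟩ := hv _ (Set.mem_range_self j)
    change (f j).1 = (f i).1
    rw [hr]
    simp [h]
  · refine ⟨.inl (v.2 / v.1, (f i).2 - v.2 / v.1 * (f i).1), fun j => ?_⟩
    obtain ⟨r, hr⟩ := hv _ (Set.mem_range_self j)
    change (f j).2 = v.2 / v.1 * (f j).1 + ((f i).2 - v.2 / v.1 * (f i).1)
    rw [hr]
    simp only [vadd_eq_add, Prod.snd_add, Prod.smul_snd, Prod.fst_add, Prod.smul_fst, smul_eq_mul]
    field_simp
    ring

theorem Ctuples_le_pow (k : ℕ) (A : Finset (ZMod p)) :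
    Ctuples (ZMod p) k A A ≤ (A.card * A.card) ^ k := by
  refine (Finset.card_filter_le _ _).trans (le_of_eq ?_)
  rw [Fintype.card_piFinset_const, Finset.card_product]

theorem Ctuples_five_le (A : Finset (ZMod p)) :
    Ctuples (ZMod p) 5 A A ≤ A.card * A.card +
      ∑ l ∈ Finset.univ.filter (fun l : (ZMod p × ZMod p) ⊕ ZMod p => 2 ≤ iLine A A l),
        iLine A A l ^ 5 := by
  have h : ((Fintype.piFinset fun _ : Fin 5 => A ×ˢ A).filter
      fun f => Collinear (ZMod p) (Set.range f)) ⊆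
      ((A ×ˢ A).image fun q _ => q) ∪
        (Finset.univ.filter fun l : (ZMod p × ZMod p) ⊕ ZMod p => 2 ≤ iLine A A l).biUnion
          fun l => Fintype.piFinset fun _ : Fin 5 => (A ×ˢ A).filter fun q => onLine l q := by
    intro f hf
    obtain ⟨hfA, hfc⟩ := Finset.mem_filter.1 hf
    rw [Fintype.mem_piFinset] at hfA
    by_cases hconst : ∀ i, f i = f 0
    · exact Finset.mem_union_left _
        (Finset.mem_image.2 ⟨f 0, hfA 0, funext fun i => (hconst i).symm⟩)
    · push Not at hconst
      obtain ⟨i, hi⟩ := hconst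
      obtain ⟨l, hl⟩ := exists_onLine hfc 0
      have hmem : ∀ j, f j ∈ (A ×ˢ A).filter fun q => onLine l q :=
        fun j => Finset.mem_filter.2 ⟨hfA j, hl j⟩
      refine Finset.mem_union_right _ (Finset.mem_biUnion.2 ⟨l, Finset.mem_filter.2
        ⟨Finset.mem_univ _, ?_⟩, Fintype.mem_piFinset.2 hmem⟩)
      exact Finset.one_lt_card.2 ⟨f i, hmem i, f 0, hmem 0, hi⟩
  refine (Finset.card_le_card h).trans ((Finset.card_union_le _ _).trans (add_le_add ?_ ?_))
  · exact Finset.card_image_le.trans (Finset.card_product _ _).le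
  · refine Finset.card_biUnion_le.trans (Finset.sum_le_sum fun l _ => le_of_eq ?_)
    rw [Fintype.card_piFinset_const, iLine]

theorem log_succ_le {n : ℕ} (hn : 2 ≤ n) : ((Nat.log 2 n + 1 : ℕ) : ℝ) ≤ 3 * Real.log n := by
  have h1 : ((2 ^ Nat.log 2 n : ℕ) : ℝ) ≤ n := by
    exact_mod_cast Nat.pow_log_le_self 2 (by omega)
  have h2 : (Nat.log 2 n : ℝ) * Real.log 2 ≤ Real.log n := by
    rw [← Real.log_pow]
    refine Real.log_le_log (by positivity) ?_
    rwa [Nat.cast_pow, Nat.cast_ofNat] at h1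
  have h3 : Real.log 2 ≤ Real.log n :=
    Real.log_le_log two_pos (by exact_mod_cast hn)
  have h4 := Real.log_two_gt_d9
  have h5 : (0 : ℝ) ≤ (Nat.log 2 n : ℝ) := Nat.cast_nonneg _
  push_cast
  nlinarith

theorem Ctuples_five_sub_le {A : Finset (ZMod p)} (hA : 2 ≤ A.card) :
    (Ctuples (ZMod p) 5 A A : ℝ) - (A.card : ℝ) ^ 10 / (p : ℝ) ^ 3 - 2 * (A.card : ℝ) ^ 6 ≤
      10 ^ 12 * Real.log A.card ^ 3 *
        (errorTerm A + (A.card : ℝ) ^ 4 / (p : ℝ) ^ 2 * thirdMoment A) := by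
  have hA0 : A.Nonempty := Finset.card_pos.1 (by omega)
  have hn : (1 : ℝ) ≤ A.card := by exact_mod_cast hA0.card_pos
  have h1 : (Ctuples (ZMod p) 5 A A : ℝ) ≤ A.card * A.card +
      ∑ l ∈ Finset.univ.filter (fun l : (ZMod p × ZMod p) ⊕ ZMod p => 2 ≤ iLine A A l),
        (iLine A A l : ℝ) ^ 5 := by
    exact_mod_cast Ctuples_five_le A
  rw [sum_iLine_eq hA fun i => (i : ℝ) ^ 5] at h1
  have h2 := sum_hits_pow_five_le hA (Nat.lt_pow_succ_log_self one_lt_two A.card)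
  have h3 := log_succ_le hA
  set J : ℝ := ((Nat.log 2 A.card + 1 : ℕ) : ℝ)
  have hJ : 1 ≤ J := by
    simp only [J, Nat.cast_add, Nat.cast_one]
    exact le_add_of_nonneg_left (Nat.cast_nonneg _)
  have h4 : J ^ 3 ≤ 27 * Real.log A.card ^ 3 := by
    have := pow_le_pow_left₀ (by linarith) h3 3
    rw [mul_pow] at this
    linarith
  have h5 : (A.card : ℝ) * A.card ≤ 2 * errorTerm A := by
    refine le_trans ?_ (rpow_card_le_errorTerm hA0)
    rw [← sq, ← Real.rpow_natCast]
    exact Real.rpow_le_rpow_of_exponent_le hn (by norm_num)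
  have hB : 0 ≤ (A.card : ℝ) ^ 4 / (p : ℝ) ^ 2 * thirdMoment A := by
    have := thirdMoment_nonneg hA
    positivity
  have hT := errorTerm_nonneg A
  set W := errorTerm A + (A.card : ℝ) ^ 4 / (p : ℝ) ^ 2 * thirdMoment A
  have hW : W ≤ J ^ 3 * W := le_mul_of_one_le_left (by positivity) (one_le_pow₀ hJ)
  have h6 : J ^ 3 * W ≤ 27 * Real.log A.card ^ 3 * W := by gcongr
  have h7 : (A.card : ℝ) * (A.card : ℝ) ^ 5 = (A.card : ℝ) ^ 6 := by ring
  rw [h7] at h1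
  have h8 : errorTerm A ≤ W := le_add_of_nonneg_right hB
  have h9 : 0 ≤ W := by positivity
  linarith

end CollinearTuples

theorem stmt5 :
    ∃ C D : ℝ, 0 < C ∧ 0 < D ∧ ∀ (p : ℕ) [Fact p.Prime] (A : Finset (ZMod p)),
      (Ctuples (ZMod p) 5 A A : ℝ) - (A.card : ℝ) ^ 10 / (p : ℝ) ^ 3 - 2 * (A.card : ℝ) ^ 6 ≤
        C * Real.log A.card ^ D *
          ((A.card : ℝ) ^ 7 / p
            + (A.card : ℝ) ^ 4 / (p : ℝ) ^ 2 *
                ((∑ l ∈ Finset.univ.filter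
                      (fun l : (ZMod p × ZMod p) ⊕ ZMod p => 2 ≤ iLine A A l),
                    (iLine A A l : ℝ) ^ 3)
                  - (A.card : ℝ) ^ 2 / p *
                    ∑ l ∈ Finset.univ.filter
                        (fun l : (ZMod p × ZMod p) ⊕ ZMod p => 2 ≤ iLine A A l),
                      (iLine A A l : ℝ) ^ 2)
            + addEfun (balanced A) ^ (1 / 6 : ℝ) * (A.card : ℝ) ^ (11 / 2 : ℝ)
            + mulEbarFun (balanced A) ^ (1 / 2 : ℝ) * (A.card : ℝ) ^ (9 / 2 : ℝ)) := by
  refine ⟨10 ^ 12, 3, by norm_num, by norm_num, fun p _ A => ?_⟩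
  by_cases hA : 2 ≤ A.card
  · have h := Ctuples_five_sub_le hA
    have e : Real.log A.card ^ (3 : ℝ) = Real.log A.card ^ 3 := by
      exact_mod_cast Real.rpow_natCast (Real.log A.card) 3
    rw [e]
    refine h.trans (le_of_eq ?_)
    rw [errorTerm, thirdMoment]
    ring
  · have h1 : (Ctuples (ZMod p) 5 A A : ℝ) ≤ ((A.card : ℝ) * A.card) ^ 5 := by
      exact_mod_cast Ctuples_le_pow 5 A
    have h2 : 0 ≤ (A.card : ℝ) ^ 10 / (p : ℝ) ^ 3 := by positivity
    have h3 : A.card = 0 ∨ A.card = 1 := by omega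
    have h4 : Real.log A.card ^ (3 : ℝ) = 0 := by
      rcases h3 with h3 | h3 <;> simp [h3]
    rw [h4, mul_zero, zero_mul]
    have h5 : ((A.card : ℝ) * A.card) ^ 5 ≤ 2 * (A.card : ℝ) ^ 6 := by
      rcases h3 with h3 | h3 <;> norm_num [h3]
    linarith
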